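/- If φ is a continuously differentiable kinematic expansive flow on the closed unit disc D = {p ∈ ℝ² : |p| ≤ 1}, then φ has at least two singular points. -/

import Mathlib

open Metric Set Filter Topology

/-- A continuous flow on a metric space. -/
def IsFlow {X : Type*} [MetricSpace X] (φ : ℝ → X → X) : Prop :=
  Continuous (fun p : ℝ × X => φ p.1 p.2) ∧ (∀ x, φ 0 x = x) ∧
    ∀ s t x, φ s (φ t x) = φ (s + t) x

/-- Kinematic expansiveness. -/
def KinematicExpansive {X : Type*} [MetricSpace X] (φ : ℝ → X → X) : Prop :=
  ∀ ε > (0 : ℝ), ∃ δ > (0 : ℝ), ∀ x y : X,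
    (∀ t : ℝ, dist (φ t x) (φ t y) < δ) → ∃ s : ℝ, |s| < ε ∧ y = φ s x

/-- `f` has a continuous logarithm along `ℝ` that increases by `2πik` over each unit period. -/
def HasWind (f : ℝ → ℂ) (k : ℤ) : Prop :=
  ∃ θ : ℝ → ℂ, Continuous θ ∧ (∀ t, Complex.exp (θ t) = f t) ∧
    ∀ t, θ (t + 1) = θ t + k * (2 * Real.pi * Complex.I)

/-- A continuous closed curve, parametrized with period one. -/
structure IsLoop (c : ℝ → ℂ) : Prop where
  cont : Continuous c
  per : ∀ t, c (t + 1) = c t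

open Classical in
/-- The winding number of `c` around `q`. -/
noncomputable def wind (c : ℝ → ℂ) (q : ℂ) : ℤ :=
  if h : ∃ k, HasWind (fun t => c t - q) k then h.choose else 0

lemma two_pi_I_ne : (2 * Real.pi * Complex.I : ℂ) ≠ 0 := Complex.two_pi_I_ne_zero

lemma isDiscrete_exp_eq_one : IsDiscrete {z : ℂ | Complex.exp z = 1} := by
  have := (Complex.isCoveringMapOn_exp 1 (by simp)).discreteTopology_fiber
  rw [isDiscrete_iff_discreteTopology]
  exact this

lemma IsPreconnected.eq_of_exp_eq_one {X : Type*} [TopologicalSpace X] {A : Set X}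
    (hA : IsPreconnected A) {g : X → ℂ} (hg : ContinuousOn g A)
    (h1 : ∀ x ∈ A, Complex.exp (g x) = 1) {x y : X} (hx : x ∈ A) (hy : y ∈ A) : g x = g y :=
  hA.constant_of_mapsTo isDiscrete_exp_eq_one hg h1 hx hy

lemma HasWind.unique {f : ℝ → ℂ} {k l : ℤ} (hk : HasWind f k) (hl : HasWind f l) : k = l := by
  obtain ⟨θ, hθ, hθe, hθp⟩ := hk
  obtain ⟨η, hη, hηe, hηp⟩ := hl
  have h := isPreconnected_univ.eq_of_exp_eq_one (g := fun t : ℝ => θ t - η t)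
    (hθ.sub hη).continuousOn
    (fun t _ => by
      have : f t ≠ 0 := by rw [← hθe]; exact Complex.exp_ne_zero _
      rw [Complex.exp_sub, hθe, hηe, div_self this]) (mem_univ (0 + 1)) (mem_univ 0)
  simp only [hθp, hηp] at h
  have h2 : (k : ℂ) * (2 * Real.pi * Complex.I) = l * (2 * Real.pi * Complex.I) := by
    linear_combination h
  exact_mod_cast mul_right_cancel₀ two_pi_I_ne h2

lemma HasWind.div {f g : ℝ → ℂ} {k l : ℤ} (hk : HasWind f k) (hl : HasWind g l) :
    HasWind (fun t => f t / g t) (k - l) := by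
  obtain ⟨θ, hθ, hθe, hθp⟩ := hk
  obtain ⟨η, hη, hηe, hηp⟩ := hl
  refine ⟨fun t => θ t - η t, hθ.sub hη, fun t => by rw [Complex.exp_sub, hθe, hηe], fun t => ?_⟩
  simp only [hθp, hηp]
  push_cast
  ring

lemma exists_hasWind_of_convex {S : Set ℝ} (hS : Convex ℝ S) (hSo : IsOpen S) (hne : S.Nonempty)
    {F : ℝ → ℝ → ℂ} (hF : ContinuousOn (fun p : ℝ × ℝ => F p.1 p.2) (S ×ˢ univ))
    (h0 : ∀ s ∈ S, ∀ t, F s t ≠ 0) (hp : ∀ s t, F s (t + 1) = F s t) :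
    ∃ θ : ℝ × ℝ → ℂ, ContinuousOn θ (S ×ˢ univ) ∧
      (∀ s ∈ S, ∀ t, Complex.exp (θ (s, t)) = F s t) ∧
      ∃ k : ℤ, ∀ s ∈ S, ∀ t, θ (s, t + 1) = θ (s, t) + k * (2 * Real.pi * Complex.I) := by
  have hc : Convex ℝ (S ×ˢ (univ : Set ℝ)) := hS.prod convex_univ
  have hne' : (S ×ˢ (univ : Set ℝ)).Nonempty := hne.prod univ_nonempty
  have hU : IsSimplyConnected (S ×ˢ (univ : Set ℝ)) := by
    have := hc.contractibleSpace hne'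
    have : SimplyConnectedSpace (S ×ˢ (univ : Set ℝ)) := inferInstance
    exact this
  obtain ⟨θ, hθ, hθe⟩ := Complex.exists_continuousOn_eqOn_exp_comp hU (hSo.prod isOpen_univ) hF
    (by rintro ⟨⟨s, t⟩, ⟨hs, -⟩, h⟩; exact h0 s hs t h)
  have hθe' : ∀ s ∈ S, ∀ t, Complex.exp (θ (s, t)) = F s t := fun s hs t => hθe ⟨hs, mem_univ t⟩
  obtain ⟨s₀, hs₀⟩ := hne
  have hdiff : ∀ s ∈ S, ∀ t, Complex.exp (θ (s, t + 1) - θ (s, t)) = 1 := fun s hs t => by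
    rw [Complex.exp_sub, hθe' s hs, hθe' s hs, hp, div_self (h0 s hs t)]
  obtain ⟨k, hk⟩ := Complex.exp_eq_one_iff.1 (hdiff s₀ hs₀ 0)
  refine ⟨θ, hθ, hθe', k, fun s hs t => ?_⟩
  have hcont : ContinuousOn (fun p : ℝ × ℝ => θ (p.1, p.2 + 1) - θ p) (S ×ˢ univ) :=
    (hθ.comp (by fun_prop) (fun p hp => ⟨hp.1, mem_univ _⟩)).sub hθ
  have := hc.isPreconnected.eq_of_exp_eq_one hcont (fun p hp => hdiff p.1 hp.1 p.2)
    (x := (s, t)) (y := (s₀, 0)) ⟨hs, mem_univ _⟩ ⟨hs₀, mem_univ _⟩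
  simp only at this
  linear_combination this + hk

lemma exists_hasWind_family {S : Set ℝ} (hS : Convex ℝ S) (hSo : IsOpen S) (hne : S.Nonempty)
    {F : ℝ → ℝ → ℂ} (hF : ContinuousOn (fun p : ℝ × ℝ => F p.1 p.2) (S ×ˢ univ))
    (h0 : ∀ s ∈ S, ∀ t, F s t ≠ 0) (hp : ∀ s t, F s (t + 1) = F s t) :
    ∃ k, ∀ s ∈ S, HasWind (F s) k := by
  obtain ⟨θ, hθ, hθe, k, hk⟩ := exists_hasWind_of_convex hS hSo hne hF h0 hp
  refine ⟨k, fun s hs => ⟨fun t => θ (s, t), ?_, hθe s hs, hk s hs⟩⟩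
  rw [← continuousOn_univ]
  exact hθ.comp (by fun_prop) (fun t _ => ⟨hs, mem_univ t⟩)

/-- Homotopy invariance of the winding number. -/
lemma exists_hasWind_homotopy {F : ℝ → ℝ → ℂ} (hF : ContinuousOn (fun p : ℝ × ℝ => F p.1 p.2)
      (Icc 0 1 ×ˢ univ))
    (h0 : ∀ s ∈ Icc (0 : ℝ) 1, ∀ t, F s t ≠ 0) (hp : ∀ s t, F s (t + 1) = F s t) :
    ∃ k, HasWind (F 0) k ∧ HasWind (F 1) k := by
  have hcl : ∀ s : ℝ, max 0 (min s 1) ∈ Icc (0 : ℝ) 1 := fun s =>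
    ⟨le_max_left _ _, max_le zero_le_one (min_le_right _ _)⟩
  obtain ⟨k, hk⟩ := exists_hasWind_family (S := univ) convex_univ isOpen_univ univ_nonempty
    (F := fun s t => F (max 0 (min s 1)) t)
    (hF.comp (f := fun p : ℝ × ℝ => (max 0 (min p.1 1), p.2)) (by fun_prop)
      (fun p _ => ⟨hcl p.1, mem_univ _⟩))
    (fun s _ t => h0 _ (hcl s) t) (fun s t => hp _ t)
  refine ⟨k, ?_, ?_⟩
  · simpa using hk 0 (mem_univ _)
  · simpa using hk 1 (mem_univ _)

lemma HasWind.homotopy {f g : ℝ → ℂ} {k : ℤ} (h : HasWind f k) (F : ℝ → ℝ → ℂ)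
    (hf : ∀ t, F 0 t = f t) (hg : ∀ t, F 1 t = g t)
        (hF : ContinuousOn (fun p : ℝ × ℝ => F p.1 p.2) (Icc 0 1 ×ˢ univ))
    (h0 : ∀ s ∈ Icc (0 : ℝ) 1, ∀ t, F s t ≠ 0) (hp : ∀ s t, F s (t + 1) = F s t) :
    HasWind g k := by
  obtain rfl : F 0 = f := funext hf
  obtain rfl : F 1 = g := funext hg
  obtain ⟨l, hl0, hl1⟩ := exists_hasWind_homotopy hF h0 hp
  rwa [h.unique hl0]

lemma hasWind_const {a : ℂ} (ha : a ≠ 0) : HasWind (fun _ => a) 0 :=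
  ⟨fun _ => Complex.log a, continuous_const, fun _ => Complex.exp_log ha, fun _ => by simp⟩

lemma hasWind_zero_of_re_neg {f : ℝ → ℂ} (hf : Continuous f) (hp : ∀ t, f (t + 1) = f t)
    {a : ℂ} (h : ∀ t, (a * f t).re < 0) : HasWind f 0 := by
  have ha : a ≠ 0 := fun h0 => by simpa [h0] using h 0
  have ha' : -a⁻¹ ≠ 0 := neg_ne_zero.2 (inv_ne_zero ha)
  refine (hasWind_const ha').homotopy (fun s t => (1 - s : ℝ) * (-a⁻¹) + s * f t)
    (by simp) (by simp) (by fun_prop) ?_ (fun s t => by rw [hp])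
  · intro s hs t h0
    have h1 : a * ((1 - s : ℝ) * (-a⁻¹) + s * f t) = -(1 - s : ℝ) + s * (a * f t) := by
      field_simp
    rw [h0, mul_zero] at h1
    have h2 := congrArg Complex.re h1
    rw [Complex.zero_re, Complex.add_re, Complex.re_ofReal_mul, Complex.neg_re,
      Complex.ofReal_re] at h2
    rcases hs.1.eq_or_lt with hs0 | hs0
    · subst hs0
      norm_num at h2
    · nlinarith [h t, hs.2, mul_neg_of_pos_of_neg hs0 (h t)]

namespace IsLoop

variable {c : ℝ → ℂ} (hc : IsLoop c)
include hc

lemma per_int (n : ℤ) (t : ℝ) : c (t + n) = c t := by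
  have : Function.Periodic c 1 := hc.per
  simpa using this.int_mul n t

lemma isCompact_range : IsCompact (range c) :=
  Function.Periodic.compact_of_continuous (c := 1) hc.per one_ne_zero hc.cont

lemma isOpen_compl : IsOpen (range c)ᶜ := hc.isCompact_range.isClosed.isOpen_compl

lemma isPreconnected_range : IsPreconnected (range c) := _root_.isPreconnected_range hc.cont

lemma hasWind {q : ℂ} (hq : q ∉ range c) : HasWind (fun t => c t - q) (wind c q) := by
  have : ∃ k, HasWind (fun t => c t - q) k := by
    obtain ⟨k, hk, -⟩ := exists_hasWind_homotopy (F := fun _ t => c t - q)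
      (by have := hc.cont; fun_prop) (fun _ _ t h => hq ⟨t, sub_eq_zero.1 h⟩)
      (fun _ t => by rw [hc.per])
    exact ⟨k, hk⟩
  rw [wind, dif_pos this]
  exact this.choose_spec

lemma wind_eq {q : ℂ} (hq : q ∉ range c) {k : ℤ} (h : HasWind (fun t => c t - q) k) :
    wind c q = k := (hc.hasWind hq).unique h

lemma wind_continuousOn : ContinuousOn (wind c) (range c)ᶜ := by
  intro q hq
  apply ContinuousAt.continuousWithinAt
  obtain ⟨r, hr, hball⟩ := Metric.isOpen_iff.1 hc.isOpen_compl q hq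
  have : wind c =ᶠ[𝓝 q] fun _ => wind c q := by
    filter_upwards [ball_mem_nhds q hr] with q' hq'
    refine hc.wind_eq (hball hq') ?_
    refine (hc.hasWind hq).homotopy (fun s t => c t - (q + s * (q' - q)))
      (by simp) (by simp) ?_ ?_ ?_
    · have := hc.cont
      fun_prop
    · intro s hs t h
      refine hball ?_ ⟨t, sub_eq_zero.1 h⟩
      rw [mem_ball, dist_eq_norm, add_sub_cancel_left, norm_mul, Complex.norm_real,
        Real.norm_of_nonneg hs.1]
      rw [mem_ball, dist_eq_norm] at hq'
      nlinarith [norm_nonneg (q' - q), hs.2]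
    · intro s t
      rw [hc.per]
  exact (continuousAt_congr this).2 continuousAt_const

lemma wind_eq_of_preconnected {A : Set ℂ} (hA : IsPreconnected A) (hd : ∀ q ∈ A, q ∉ range c)
    {x y : ℂ} (hx : x ∈ A) (hy : y ∈ A) : wind c x = wind c y :=
  hA.constant (hc.wind_continuousOn.mono hd) hx hy

lemma eventually_wind_eq {q : ℂ} (hq : q ∉ range c) :
    ∀ᶠ q' in 𝓝 q, q' ∉ range c ∧ wind c q' = wind c q := by
  have h1 := hc.isOpen_compl.mem_nhds hq
  have h2 := (hc.wind_continuousOn.continuousAt h1).eventually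
    (show ∀ᶠ k in 𝓝 (wind c q), k = wind c q by simp)
  exact Filter.Eventually.and h1 h2

lemma wind_eq_zero {q : ℂ} (hq : q ∉ range c) (h : ∀ t, ‖c t‖ ≤ ‖q‖) : wind c q = 0 := by
  refine hc.wind_eq hq (hasWind_zero_of_re_neg (a := starRingEnd ℂ q)
    (by have := hc.cont; fun_prop) (fun t => by rw [hc.per]) fun t => ?_)
  have hne : c t ≠ q := fun h => hq ⟨t, h⟩
  have h1 : 0 < Complex.normSq (c t - q) := Complex.normSq_pos.2 (sub_ne_zero.2 hne)
  have h2 := h t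
  have h3 : Complex.normSq (c t) ≤ Complex.normSq q := by
    rw [Complex.normSq_eq_norm_sq, Complex.normSq_eq_norm_sq]; gcongr
  simp only [Complex.normSq_apply, Complex.sub_re, Complex.sub_im] at h1 h3
  simp only [Complex.mul_re, Complex.conj_re, Complex.conj_im, Complex.sub_re, Complex.sub_im]
  nlinarith

lemma not_mutually_inside {b : ℝ → ℂ} (hb : IsLoop b) (hd : Disjoint (range c) (range b))
    (h1 : ∀ t, wind c (b t) ≠ 0) (h2 : ∀ t, wind b (c t) ≠ 0) : False := by
  obtain ⟨q, hq, hmax⟩ := (hc.isCompact_range.union hb.isCompact_range).exists_isMaxOn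
    ⟨c 0, Or.inl ⟨0, rfl⟩⟩ continuous_norm.continuousOn
  rcases hq with ⟨t, rfl⟩ | ⟨t, rfl⟩
  · exact h2 t (hb.wind_eq_zero (fun h => hd.le_bot ⟨⟨t, rfl⟩, h⟩)
      fun s => hmax (Or.inr ⟨s, rfl⟩))
  · exact h1 t (hc.wind_eq_zero (fun h => hd.le_bot ⟨h, ⟨t, rfl⟩⟩)
      fun s => hmax (Or.inl ⟨s, rfl⟩))

end IsLoop

lemma HasWind.comp_add {f : ℝ → ℂ} {k : ℤ} (h : HasWind f k) (a : ℝ) :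
    HasWind (fun t => f (t + a)) k := by
  obtain ⟨θ, hθ, hθe, hθp⟩ := h
  refine ⟨fun t => θ (t + a), by fun_prop, fun t => hθe _, fun t => ?_⟩
  rw [← hθp, add_right_comm]

lemma cross_im {z : ℂ} {ε : ℝ} :
    ((z - ε * Complex.I) / (z + ε * Complex.I)).im =
      -2 * ε * z.re / Complex.normSq (z + ε * Complex.I) := by
  rw [Complex.div_im]
  simp only [Complex.sub_re, Complex.sub_im, Complex.add_re, Complex.add_im, Complex.mul_re,
    Complex.mul_im, Complex.ofReal_re, Complex.ofReal_im, Complex.I_re, Complex.I_im]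
  ring

lemma mem_slitPlane_cross {z : ℂ} {ε : ℝ} (hε : 0 < ε) (h : z.re ≠ 0 ∨ ε < ‖z‖) :
    (z - ε * Complex.I) / (z + ε * Complex.I) ∈ Complex.slitPlane := by
  have key : z + ε * Complex.I ≠ 0 := by
    intro h0
    have h1 : z = -(ε * Complex.I) := eq_neg_of_add_eq_zero_left h0
    rcases h with h | h
    · simp [h1] at h
    · rw [h1] at h
      simp [abs_of_pos hε] at h
  have hn : 0 < Complex.normSq (z + ε * Complex.I) := Complex.normSq_pos.2 key
  by_cases hz : z.re = 0
  · left
    have h2 : ε < ‖z‖ := h.resolve_left (fun h => h hz)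
    have h3 : ε * ε < Complex.normSq z := by
      rw [Complex.normSq_eq_norm_sq]
      nlinarith
    rw [Complex.div_re, ← add_div]
    apply div_pos _ hn
    rw [Complex.normSq_apply] at h3
    simp only [Complex.sub_re, Complex.sub_im, Complex.add_re, Complex.add_im, Complex.mul_re,
      Complex.mul_im, Complex.ofReal_re, Complex.ofReal_im, Complex.I_re, Complex.I_im]
    nlinarith
  · right
    rw [cross_im]
    exact div_ne_zero (mul_ne_zero (by simpa using hε.ne') hz) hn.ne'

lemma not_hasWind_zero_cross {b : ℝ → ℂ} (hb : Continuous b) (h0 : b 0 = 0) (h1 : b 1 = 0)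
    {ε : ℝ} (hε : 0 < ε) (hne : ∀ t ∈ Ioo (0 : ℝ) 1, (b t).re ≠ 0 ∨ ε < ‖b t‖)
    (hR : ∀ᶠ t in 𝓝[>] (0 : ℝ), 0 < (b t).re) (hL : ∀ᶠ t in 𝓝[<] (1 : ℝ), (b t).re < 0) :
    ¬ HasWind (fun t => (b t - ε * Complex.I) / (b t + ε * Complex.I)) 0 := by
  rintro ⟨θ, hθ, hθe, hθp⟩
  set f : ℝ → ℂ := fun t => (b t - ε * Complex.I) / (b t + ε * Complex.I) with hf
  have hεI : (ε : ℂ) * Complex.I ≠ 0 := mul_ne_zero (by exact_mod_cast hε.ne') Complex.I_ne_zero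
  have hcont : ∀ t, b t = 0 → Tendsto f (𝓝 t) (𝓝 (-1)) := fun t ht => by
    have : f t = -1 := by
      rw [hf]
      simp only [ht, zero_sub, zero_add]
      rw [neg_div, div_self hεI]
    rw [← this]
    refine ContinuousAt.div (by fun_prop) (by fun_prop) ?_
    rw [ht, zero_add]
    exact hεI
  have hconst : ∀ s ∈ Ioo (0 : ℝ) 1, ∀ t ∈ Ioo (0 : ℝ) 1,
      θ s - Complex.log (f s) = θ t - Complex.log (f t) := by
    intro s hs t ht
    refine (convex_Ioo (0 : ℝ) 1).isPreconnected.eq_of_exp_eq_one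
      (g := fun t => θ t - Complex.log (f t)) ?_ ?_ hs ht
    · refine hθ.continuousOn.sub (ContinuousOn.clog ?_ fun t ht =>
        mem_slitPlane_cross hε (hne t ht))
      refine ContinuousOn.div (by fun_prop) (by fun_prop) fun t ht h => ?_
      have := Complex.slitPlane_ne_zero (mem_slitPlane_cross hε (hne t ht))
      rw [h, div_zero] at this
      exact this rfl
    · intro t ht
      have := Complex.slitPlane_ne_zero (mem_slitPlane_cross hε (hne t ht))
      rw [Complex.exp_sub, hθe, Complex.exp_log this, div_self this]
  set K := θ (1 / 2) - Complex.log (f (1 / 2)) with hK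
  have hKe : ∀ t ∈ Ioo (0 : ℝ) 1, θ t = K + Complex.log (f t) := fun t ht => by
    rw [hK, hconst (1 / 2) (by norm_num) t ht]
    ring
  have hlim0 : Tendsto θ (𝓝[>] 0) (𝓝 (K + (Real.log ‖(-1 : ℂ)‖ - Real.pi * Complex.I))) := by
    have hI : ∀ᶠ t in 𝓝[>] (0 : ℝ), t ∈ Ioo (0 : ℝ) 1 := Ioo_mem_nhdsGT one_pos
    have h2 : Tendsto f (𝓝[>] 0) (𝓝[{z | z.im < 0}] (-1)) := by
      refine tendsto_nhdsWithin_iff.2 ⟨(hcont 0 h0).mono_left nhdsWithin_le_nhds, ?_⟩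
      filter_upwards [hR, hI] with t ht hI
      change ((b t - ε * Complex.I) / (b t + ε * Complex.I)).im < 0
      rw [cross_im]
      refine div_neg_of_neg_of_pos (by nlinarith) (Complex.normSq_pos.2 fun h => ?_)
      have := congrArg Complex.re h
      simp at this
      exact ht.ne' this
    have h3 := (Complex.tendsto_log_nhdsWithin_im_neg_of_re_neg_of_im_zero
      (z := -1) (by simp) (by simp)).comp h2
    refine (tendsto_const_nhds.add h3).congr' ?_
    filter_upwards [hI] with t ht
    exact (hKe t ht).symm
  have hlim1 : Tendsto θ (𝓝[<] 1) (𝓝 (K + (Real.log ‖(-1 : ℂ)‖ + Real.pi * Complex.I))) := by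
    have hI : ∀ᶠ t in 𝓝[<] (1 : ℝ), t ∈ Ioo (0 : ℝ) 1 := Ioo_mem_nhdsLT one_pos
    have h2 : Tendsto f (𝓝[<] 1) (𝓝[{z | 0 ≤ z.im}] (-1)) := by
      refine tendsto_nhdsWithin_iff.2 ⟨(hcont 1 h1).mono_left nhdsWithin_le_nhds, ?_⟩
      filter_upwards [hL, hI] with t ht hI
      change 0 ≤ ((b t - ε * Complex.I) / (b t + ε * Complex.I)).im
      rw [cross_im]
      exact div_nonneg (by nlinarith) (Complex.normSq_nonneg _)
    have h3 := (Complex.tendsto_log_nhdsWithin_im_nonneg_of_re_neg_of_im_zero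
      (z := -1) (by simp) (by simp)).comp h2
    refine (tendsto_const_nhds.add h3).congr' ?_
    filter_upwards [hI] with t ht
    exact (hKe t ht).symm
  have e0 := tendsto_nhds_unique (hθ.continuousAt.mono_left nhdsWithin_le_nhds) hlim0
  have e1 := tendsto_nhds_unique (hθ.continuousAt.mono_left nhdsWithin_le_nhds) hlim1
  have e2 := hθp 0
  rw [zero_add, e0, e1] at e2
  have e3 : (2 * Real.pi * Complex.I : ℂ) = 0 := by
    push_cast at e2
    linear_combination e2
  exact two_pi_I_ne e3

/-- The winding number of a loop changes across a transversal simple point. -/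
lemma IsLoop.eventually_wind_ne {c : ℝ → ℂ} (hc : IsLoop c) {t₀ : ℝ} {d : ℂ}
    (hne : ∀ t ∈ Ioo t₀ (t₀ + 1), c t ≠ c t₀) (hd : d ≠ 0)
    (hR : ∀ᶠ t in 𝓝[>] t₀, 0 < ((c t - c t₀) / d).re)
    (hL : ∀ᶠ t in 𝓝[<] t₀, ((c t - c t₀) / d).re < 0) :
    ∀ᶠ ε : ℝ in 𝓝[>] 0, c t₀ + ε * (Complex.I * d) ∉ range c ∧
      c t₀ - ε * (Complex.I * d) ∉ range c ∧
      wind c (c t₀ + ε * (Complex.I * d)) ≠ wind c (c t₀ - ε * (Complex.I * d)) := by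
  set b : ℝ → ℂ := fun t => (c (t + t₀) - c t₀) / d with hbdef
  have hcc := hc.cont
  have hb : Continuous b := by fun_prop
  have hbl : IsLoop b := ⟨hb, fun t => by simp only [hbdef]; rw [add_right_comm, hc.per]⟩
  have h0 : b 0 = 0 := by simp [hbdef]
  have h1 : b 1 = 0 := by rw [← zero_add (1 : ℝ), hbl.per, h0]
  have hbR : ∀ᶠ t in 𝓝[>] (0 : ℝ), 0 < (b t).re := by
    refine Tendsto.eventually (f := fun t : ℝ => t + t₀) ?_ hR
    refine tendsto_nhdsWithin_iff.2 ⟨?_, ?_⟩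
    · have : Tendsto (fun t : ℝ => t + t₀) (𝓝 0) (𝓝 (0 + t₀)) :=
        (continuous_id.add continuous_const).tendsto 0
      rw [zero_add] at this
      exact this.mono_left nhdsWithin_le_nhds
    · filter_upwards [self_mem_nhdsWithin] with t ht
      simpa using ht
  have hbL : ∀ᶠ t in 𝓝[<] (1 : ℝ), (b t).re < 0 := by
    have : ∀ᶠ t in 𝓝[<] (1 : ℝ), ((c (t - 1 + t₀) - c t₀) / d).re < 0 := by
      refine Tendsto.eventually (f := fun t : ℝ => t - 1 + t₀) ?_ hL
      refine tendsto_nhdsWithin_iff.2 ⟨?_, ?_⟩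
      · have : Tendsto (fun t : ℝ => t - 1 + t₀) (𝓝 1) (𝓝 (1 - 1 + t₀)) :=
          ((continuous_id.sub continuous_const).add continuous_const).tendsto 1
        rw [sub_self, zero_add] at this
        exact this.mono_left nhdsWithin_le_nhds
      · filter_upwards [self_mem_nhdsWithin] with t ht
        simpa using ht
    filter_upwards [this] with t ht
    have := hbl.per (t - 1)
    rw [sub_add_cancel] at this
    rw [this]
    exact ht
  have hbne : ∀ t ∈ Ioo (0 : ℝ) 1, b t ≠ 0 := fun t ht h => by
    refine hne (t + t₀) ⟨by linarith [ht.1], by linarith [ht.2]⟩ (sub_eq_zero.1 ?_)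
    simpa [hbdef, hd] using h
  obtain ⟨u, hu0, hu⟩ := mem_nhdsGT_iff_exists_Ioo_subset.1 hbR
  obtain ⟨l, hl1, hl⟩ := mem_nhdsLT_iff_exists_Ioo_subset.1 hbL
  obtain ⟨ρ, hρ, hρb⟩ : ∃ ρ > 0, ∀ t ∈ Icc u l, t ∈ Ioo (0 : ℝ) 1 → ρ ≤ ‖b t‖ := by
    rcases (Icc u l).eq_empty_or_nonempty with he | hn
    · exact ⟨1, one_pos, by simp [he]⟩
    · obtain ⟨t, ht, hmin⟩ := isCompact_Icc.exists_isMinOn hn (f := fun t => ‖b t‖)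
        (by fun_prop)
      exact ⟨‖b t‖, norm_pos_iff.2 (hbne t ⟨lt_of_lt_of_le hu0 ht.1, lt_of_le_of_lt ht.2 hl1⟩),
        fun s hs _ => hmin hs⟩
  have hgood : ∀ ε : ℝ, 0 < ε → ε < ρ → ∀ t ∈ Ioo (0 : ℝ) 1, (b t).re ≠ 0 ∨ ε < ‖b t‖ := by
    intro ε hε hερ t ht
    by_cases h1 : t < u
    · exact Or.inl (hu ⟨ht.1, h1⟩ : 0 < (b t).re).ne'
    by_cases h2 : l < t
    · exact Or.inl (hl ⟨h2, ht.2⟩ : (b t).re < 0).ne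
    · exact Or.inr (hερ.trans_le (hρb t ⟨not_lt.1 h1, not_lt.1 h2⟩ ht))
  have hmiss : ∀ ε : ℝ, 0 < |ε| → |ε| < ρ → c t₀ + ε * (Complex.I * d) ∉ range c := by
    rintro ε hε hερ ⟨t, ht⟩
    have e1 : b (Int.fract (t - t₀)) = ε * Complex.I := by
      have : b (t - t₀) = ε * Complex.I := by
        simp only [hbdef, sub_add_cancel, ht]
        field_simp
        ring
      rw [← this, ← hbl.per_int ⌊t - t₀⌋ (Int.fract _), Int.fract_add_floor]
    rcases (Int.fract_nonneg (t - t₀)).eq_or_lt with h | h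
    · rw [← h, h0] at e1
      have : (ε : ℂ) = 0 := by simpa using e1.symm
      simp at this
      simp [this] at hε
    · rcases hgood |ε| hε hερ _ ⟨h, Int.fract_lt_one _⟩ with h3 | h3
      · simp [e1] at h3
      · simp [e1] at h3
  filter_upwards [Ioo_mem_nhdsGT hρ] with ε hε
  have m1 : c t₀ + ε * (Complex.I * d) ∉ range c :=
    hmiss ε (abs_pos.2 hε.1.ne') (by rw [abs_of_pos hε.1]; exact hε.2)
  have m2 : c t₀ - ε * (Complex.I * d) ∉ range c := by
    have := hmiss (-ε) (abs_pos.2 (neg_ne_zero.2 hε.1.ne'))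
      (by rw [abs_neg, abs_of_pos hε.1]; exact hε.2)
    push_cast at this
    rwa [neg_mul, ← sub_eq_add_neg] at this
  refine ⟨m1, m2, fun heq => ?_⟩
  refine not_hasWind_zero_cross hb h0 h1 hε.1 (hgood ε hε.1 hε.2) hbR hbL ?_
  have h3 := ((hc.hasWind m1).comp_add t₀).div ((hc.hasWind m2).comp_add t₀)
  rw [heq, sub_self] at h3
  convert h3 using 2 with t
  have e1 : c (t + t₀) - (c t₀ + ε * (Complex.I * d)) = d * (b t - ε * Complex.I) := by
    simp only [hbdef]
    field_simp
    ring
  have e2 : c (t + t₀) - (c t₀ - ε * (Complex.I * d)) = d * (b t + ε * Complex.I) := by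
    simp only [hbdef]
    field_simp
    ring
  rw [e1, e2, mul_div_mul_left _ _ hd]

/-- A periodic curve homotopic to the secants of a simple loop has nonzero winding number. -/
lemma IsLoop.exists_hasWind_of_aligned {c : ℝ → ℂ} (hc : IsLoop c)
    (hinj : ∀ s t, c s = c t → ∃ n : ℤ, t = s + n) {W : ℝ → ℂ} (hW : Continuous W)
    (hWp : ∀ t, W (t + 1) = W t) {ε : ℝ} (hε : ε ∈ Ioo (0 : ℝ) 1)
    (ha : ∀ s, ∀ r ∈ Icc (0 : ℝ) 1, (1 - r : ℝ) * (c (s + ε) - c s) + r * W s ≠ 0) :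
    ∃ k : ℤ, k ≠ 0 ∧ HasWind W k := by
  have hcc := hc.cont
  have hDp : ∀ e s : ℝ, c (s + 1 + e) - c (s + 1) = c (s + e) - c s := fun e s => by
    rw [add_right_comm, hc.per, hc.per]
  obtain ⟨k, hk⟩ := exists_hasWind_family (convex_Ioo (0 : ℝ) 1) isOpen_Ioo ⟨1 / 2, by norm_num⟩
    (F := fun e s => c (s + e) - c s) (by fun_prop)
    (by
      intro e he s h
      obtain ⟨n, hn⟩ := hinj _ _ (sub_eq_zero.1 h)
      have h1 : e = -n := by linarith
      rw [h1] at he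
      have h2 : (0 : ℤ) < -n := by exact_mod_cast he.1
      have h3 : -n < (1 : ℤ) := by exact_mod_cast he.2
      omega) hDp
  refine ⟨k, ?_, (hk ε hε).homotopy
    (fun r s => (1 - r : ℝ) * (c (s + ε) - c s) + r * W s) (by simp) (by simp)
    (by fun_prop) (fun r hr s => ha s r hr) fun r s => by rw [hDp, hWp]⟩
  obtain ⟨θ, hθ, hθe, hθp⟩ := hk (1 / 2) (by norm_num)
  replace hθe : ∀ t, Complex.exp (θ t) = c (t + 1 / 2) - c t := hθe
  have h1 : ∀ s, Complex.exp (θ (s + 1 / 2) - θ s - Real.pi * Complex.I) = 1 := fun s => by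
    have hne := Complex.exp_ne_zero (θ s)
    rw [Complex.exp_sub, Complex.exp_sub, Complex.exp_pi_mul_I]
    rw [div_neg, div_one, neg_eq_iff_eq_neg, div_eq_iff hne, hθe, hθe, neg_one_mul, neg_sub]
    rw [show s + 1 / 2 + 1 / 2 = s + 1 by ring, hc.per]
  have h2 := isPreconnected_univ.eq_of_exp_eq_one
    (g := fun s => θ (s + 1 / 2) - θ s - Real.pi * Complex.I) (by fun_prop)
    (fun s _ => h1 s) (mem_univ (0 + 1 / 2)) (mem_univ 0)
  obtain ⟨n, hn⟩ := Complex.exp_eq_one_iff.1 (h1 0)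
  have h3 := hθp 0
  rw [show (0 : ℝ) + 1 / 2 + 1 / 2 = 0 + 1 by norm_num] at h2
  have h4 : (k : ℂ) * (2 * Real.pi * Complex.I) = (2 * n + 1) * (2 * Real.pi * Complex.I) := by
    linear_combination h2 + 2 * hn - h3
  have h5 : (k : ℂ) = 2 * n + 1 := mul_right_cancel₀ two_pi_I_ne h4
  have h6 : k = 2 * n + 1 := by exact_mod_cast h5
  omega

/-- If a field on the unit disc vanishes at most at `p` and turns along a loop, the loop winds
around `p`. -/
lemma IsLoop.wind_ne_zero {c : ℝ → ℂ} (hc : IsLoop c) {V : ℂ → ℂ} {p : ℂ}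
    (hV : ContinuousOn V (closedBall 0 1)) (hV0 : ∀ x ∈ closedBall (0 : ℂ) 1, x ≠ p → V x ≠ 0)
    (hcX : ∀ t, c t ∈ closedBall (0 : ℂ) 1) (hcp : p ∉ range c) {k : ℤ} (hk0 : k ≠ 0)
    (hk : HasWind (fun t => V (c t)) k) : wind c p ≠ 0 := by
  intro hw
  have hcc := hc.cont
  have hcp' : ∀ t, c t ≠ p := fun t h => hcp ⟨t, h⟩
  rcases le_or_gt 1 ‖p‖ with hp | hp
  · have hmem : ∀ s ∈ Icc (0 : ℝ) 1, ∀ t, ((1 - s : ℝ) : ℂ) * c t ∈ closedBall (0 : ℂ) 1 ∧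
        ((1 - s : ℝ) : ℂ) * c t ≠ p := by
      intro s hs t
      have h1 := hcX t
      rw [mem_closedBall_zero_iff] at h1
      have h2 : ‖((1 - s : ℝ) : ℂ) * c t‖ = (1 - s) * ‖c t‖ := by
        rw [norm_mul, Complex.norm_real, Real.norm_of_nonneg (by linarith [hs.2])]
      refine ⟨?_, fun h => ?_⟩
      · rw [mem_closedBall_zero_iff, h2]
        nlinarith [hs.1, norm_nonneg (c t)]
      · rcases hs.1.eq_or_lt with h3 | h3
        · refine hcp' t ?_
          rw [← h, ← h3]
          simp
        · rw [← h, h2] at hp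
          nlinarith [mul_le_mul_of_nonneg_left h1 (show 0 ≤ 1 - s by linarith [hs.2])]
    have h0 : V 0 ≠ 0 := hV0 0 (by simp) (by rintro rfl; simp at hp; linarith)
    have := hk.homotopy (g := fun _ => V 0) (fun s t => V (((1 - s : ℝ) : ℂ) * c t))
      (by simp) (by simp) (hV.comp (by fun_prop) fun x hx => (hmem x.1 hx.1 x.2).1)
      (fun s hs t => hV0 _ (hmem s hs t).1 (hmem s hs t).2) (fun s t => by rw [hc.per])
    exact hk0 (this.unique (hasWind_const h0))
  · have h1 := hc.hasWind hcp
    rw [hw] at h1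
    obtain ⟨ζ, hζ, hζe, hζp⟩ := h1
    replace hζp : ∀ t, ζ (t + 1) = ζ t := by simpa using hζp
    set L := Real.log (1 - ‖p‖) with hL
    have hζl : IsLoop ζ := ⟨hζ, hζp⟩
    obtain ⟨M, hM0, hM⟩ : ∃ M : ℝ, 0 ≤ M ∧ ∀ t, (ζ t).re - M ≤ L := by
      obtain ⟨M, hM⟩ := hζl.isCompact_range.bddAbove_image
        (f := fun z : ℂ => z.re) Complex.continuous_re.continuousOn
      refine ⟨max 0 (M - L), le_max_left _ _, fun t => ?_⟩
      have := hM ⟨ζ t, ⟨t, rfl⟩, rfl⟩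
      have h2 := le_max_right 0 (M - L)
      simp only at this
      linarith
    have hexp : ∀ z : ℂ, p + Complex.exp z ≠ p := fun z h =>
      Complex.exp_ne_zero z (by simp at h)
    have hsmall : ∀ z : ℂ, z.re ≤ L → p + Complex.exp z ∈ closedBall (0 : ℂ) 1 := fun z hz => by
      rw [mem_closedBall_zero_iff]
      have h2 : ‖Complex.exp z‖ ≤ 1 - ‖p‖ := by
        rw [Complex.norm_exp, ← Real.exp_log (show 0 < 1 - ‖p‖ by linarith)]
        exact Real.exp_le_exp.2 hz
      linarith [norm_add_le p (Complex.exp z)]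
    have hmem : ∀ s ∈ Icc (0 : ℝ) 1, ∀ t,
        p + Complex.exp (ζ t - (s * M : ℝ)) ∈ closedBall (0 : ℂ) 1 := by
      intro s hs t
      have h2 : p + Complex.exp (ζ t - (s * M : ℝ)) =
          p + (Real.exp (-(s * M))) • (c t - p) := by
        rw [sub_eq_add_neg, Complex.exp_add, hζe, Complex.real_smul]
        push_cast
        ring
      rw [h2]
      refine (convex_closedBall (0 : ℂ) 1).add_smul_sub_mem
        (by rw [mem_closedBall_zero_iff]; exact hp.le) (hcX t) ⟨(Real.exp_pos _).le, ?_⟩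
      rw [Real.exp_le_one_iff]
      nlinarith [mul_nonneg hs.1 hM0]
    have hk1 := hk.homotopy (g := fun t => V (p + Complex.exp (ζ t - M)))
      (fun s t => V (p + Complex.exp (ζ t - (s * M : ℝ))))
      (fun t => by simp [hζe]) (fun t => by simp)
      (hV.comp (by fun_prop) fun x hx => hmem x.1 hx.1 x.2)
      (fun s hs t => hV0 _ (hmem s hs t) (hexp _)) (fun s t => by rw [hζp])
    have hre : ∀ s ∈ Icc (0 : ℝ) 1, ∀ t,
        (((1 - s : ℝ) : ℂ) * (ζ t - M) + (s : ℂ) * L).re ≤ L := by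
      intro s hs t
      rw [Complex.add_re, Complex.re_ofReal_mul, Complex.re_ofReal_mul]
      simp only [Complex.sub_re, Complex.ofReal_re]
      nlinarith [hM t, hs.1, hs.2]
    have hk2 := hk1.homotopy (g := fun _ => V (p + Complex.exp L))
      (fun s t => V (p + Complex.exp (((1 - s : ℝ) : ℂ) * (ζ t - M) + (s : ℂ) * L)))
      (fun t => by simp) (fun t => by simp)
      (hV.comp (by fun_prop) fun x hx => hsmall _ (hre x.1 hx.1 x.2))
      (fun s hs t => hV0 _ (hsmall _ (hre s hs t)) (hexp _)) (fun s t => by rw [hζp])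
    exact hk0 (hk2.unique (hasWind_const (hV0 _ (hsmall _ (by simp)) (hexp _))))

/-- The closed unit disc of the complex plane. -/
abbrev Disc : Set ℂ := closedBall 0 1

lemma IsFlow.apply_eq_self_of_velocity_eq_zero {φ : ℝ → Disc → Disc} (hφ : IsFlow φ)
    (hlip : ∀ T : ℝ, ∃ K, 0 < K ∧ ∀ t, |t| ≤ T → ∀ x y, dist (φ t x) (φ t y) ≤ K * dist x y)
    {x : Disc} (hx : HasDerivAt (fun s => (φ s x : ℂ)) 0 0) (t : ℝ) : φ t x = x := by
  have hd : ∀ t, HasDerivAt (fun s => (φ s x : ℂ)) 0 t := by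
    intro t
    obtain ⟨K, hK0, hK⟩ := hlip |t|
    rw [hasDerivAt_iff_isLittleO] at hx
    have h0 : (fun s => (φ s x : ℂ) - φ 0 x) =o[𝓝 0] fun s : ℝ => s := by simpa using hx
    rw [hasDerivAt_iff_isLittleO_nhds_zero]
    simp only [smul_zero, sub_zero]
    refine Asymptotics.IsBigO.trans_isLittleO ?_ h0
    refine Asymptotics.IsBigO.of_bound K (Eventually.of_forall fun s => ?_)
    have := hK t le_rfl (φ s x) (φ 0 x)
    rw [hφ.2.2, hφ.2.2, add_zero] at this
    rwa [← dist_eq_norm, ← dist_eq_norm]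
  have := is_const_of_deriv_eq_zero (f := fun s => (φ s x : ℂ))
    (fun t => (hd t).differentiableAt) (fun t => (hd t).deriv) t 0
  rw [hφ.2.1] at this
  exact Subtype.ext this

/-- A kinematic expansive flow on the closed unit disc, generated by a continuous field `V` that
vanishes at most at `p`, with time-`t` maps that are Lipschitz locally uniformly in `t`. -/
structure DiscFlow (φ : ℝ → Disc → Disc) (V : ℂ → ℂ) (p : ℂ) : Prop where
  flow : IsFlow φ
  contV : ContinuousOn V Disc
  deriv : ∀ x t, HasDerivAt (fun s => (φ s x : ℂ)) (V (φ t x)) t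
  lip : ∀ T : ℝ, ∃ K : ℝ, 0 < K ∧ ∀ t, |t| ≤ T → ∀ x y, dist (φ t x) (φ t y) ≤ K * dist x y
  ke : KinematicExpansive φ
  V_ne : ∀ x ∈ Disc, x ≠ p → V x ≠ 0

/-- A point with an injective orbit map. -/
def NonPer (φ : ℝ → Disc → Disc) (x : Disc) : Prop := Function.Injective fun t => φ t x

lemma NonPer.rev {φ : ℝ → Disc → Disc} {x : Disc} (hx : NonPer φ x) : NonPer (fun t => φ (-t)) x :=
  fun _ _ h => neg_injective (hx h)

namespace DiscFlow

variable {φ : ℝ → Disc → Disc} {V : ℂ → ℂ} {p : ℂ} (hF : DiscFlow φ V p)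
include hF

lemma zero (x : Disc) : φ 0 x = x := hF.flow.2.1 x

lemma add (s t : ℝ) (x : Disc) : φ s (φ t x) = φ (s + t) x := hF.flow.2.2 s t x

lemma cont : Continuous (fun q : ℝ × Disc => φ q.1 q.2) := hF.flow.1

lemma cont_t (x : Disc) : Continuous (fun t => φ t x) :=
  hF.cont.comp (by fun_prop : Continuous fun t : ℝ => (t, x))

lemma cont_x (t : ℝ) : Continuous (φ t) :=
  hF.cont.comp (by fun_prop : Continuous fun x : Disc => (t, x))

lemma contC (x : Disc) : Continuous (fun t => (φ t x : ℂ)) :=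
  continuous_subtype_val.comp (hF.cont_t x)

lemma neg_cancel (t : ℝ) (x : Disc) : φ (-t) (φ t x) = x := by
  rw [hF.add, neg_add_cancel, hF.zero]

lemma inj {t : ℝ} {x y : Disc} (h : φ t x = φ t y) : x = y := by
  rw [← hF.neg_cancel t x, h, hF.neg_cancel]

lemma contV' : Continuous fun x : Disc => V x := continuousOn_iff_continuous_domRestrict.1 hF.contV

/-- Time reversal. -/
lemma rev : DiscFlow (fun t => φ (-t)) (fun x => -V x) p where
  flow := ⟨hF.cont.comp (by fun_prop : Continuous fun q : ℝ × Disc => (-q.1, q.2)),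
    fun x => by simp only [neg_zero, hF.zero], fun s t x => by simp only [hF.add, neg_add]⟩
  contV := hF.contV.neg
  deriv x t := by
    have := (hF.deriv x (-t)).scomp t (hasDerivAt_neg t)
    simpa [Function.comp_def] using this
  lip T := by
    obtain ⟨K, hK, h⟩ := hF.lip T
    exact ⟨K, hK, fun t ht => h (-t) (by rwa [abs_neg])⟩
  ke ε hε := by
    obtain ⟨δ, hδ, h⟩ := hF.ke ε hε
    refine ⟨δ, hδ, fun x y hxy => ?_⟩
    obtain ⟨s, hs, rfl⟩ := h x y fun t => by simpa using hxy (-t)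
    exact ⟨-s, by rwa [abs_neg], by simp only [neg_neg]⟩
  V_ne x hx hxp := neg_ne_zero.2 (hF.V_ne x hx hxp)

lemma singular_of_V_eq_zero {x : Disc} (hx : V x = 0) (t : ℝ) : φ t x = x := by
  refine hF.flow.apply_eq_self_of_velocity_eq_zero hF.lip ?_ t
  simpa only [hF.zero, hx] using hF.deriv x 0

lemma exists_bound : ∃ M : ℝ, 0 < M ∧ ∀ x ∈ Disc, ‖V x‖ ≤ M := by
  obtain ⟨M, hM⟩ := (isCompact_closedBall (0 : ℂ) 1).exists_bound_of_continuousOn hF.contV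
  exact ⟨max M 1, by positivity, fun x hx => (hM x hx).trans (le_max_left _ _)⟩

lemma speed {M : ℝ} (hM : ∀ x ∈ Disc, ‖V x‖ ≤ M) (x : Disc) (s t : ℝ) :
    dist (φ s x) (φ t x) ≤ M * |s - t| := by
  have := convex_univ.norm_image_sub_le_of_norm_hasDerivWithin_le (f := fun s => (φ s x : ℂ))
    (fun u _ => (hF.deriv x u).hasDerivWithinAt) (fun u _ => hM _ (φ u x).2) (mem_univ t)
    (mem_univ s)
  rwa [← dist_eq_norm, Real.norm_eq_abs] at this

lemma arc_aligned (x : Disc) {a b : ℝ} (h0 : ∀ t ∈ Icc a b, V (φ t x) ≠ 0) :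
    ∃ η > 0, ∀ u ∈ Icc a b, ∀ v ∈ Icc a b, u < v → v - u ≤ η → ∀ r ∈ Icc (0 : ℝ) 1,
      ∀ l : ℝ, 0 < l →
      (1 - r : ℝ) * ((φ v x : ℂ) - φ u x) + r * (l * V (φ u x)) ≠ 0 := by
  rcases (Icc a b).eq_empty_or_nonempty with he | hne
  · exact ⟨1, one_pos, by simp [he]⟩
  have hVc : Continuous fun t => V (φ t x) := hF.contV'.comp (hF.cont_t x)
  obtain ⟨t₀, ht₀, hmin⟩ := isCompact_Icc.exists_isMinOn hne hVc.norm.continuousOn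
  have hm : 0 < ‖V (φ t₀ x)‖ := norm_pos_iff.2 (h0 _ ht₀)
  obtain ⟨η, hη, hu⟩ := Metric.uniformContinuousOn_iff_le.1
    (isCompact_Icc.uniformContinuousOn_of_continuous (s := Icc a b) hVc.continuousOn)
    (‖V (φ t₀ x)‖ / 2) (by positivity)
  refine ⟨η, hη, fun u hu' v hv huv hle r hr l hl h => ?_⟩
  have hsub : Icc u v ⊆ Icc a b := Icc_subset_Icc hu'.1 hv.2
  have h1 : ‖((φ v x : ℂ) - v • V (φ u x)) - ((φ u x : ℂ) - u • V (φ u x))‖ ≤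
      ‖V (φ t₀ x)‖ / 2 * ‖v - u‖ := by
    refine (convex_Icc u v).norm_image_sub_le_of_norm_hasDerivWithin_le
      (f := fun s => (φ s x : ℂ) - s • V (φ u x)) (f' := fun s => V (φ s x) - V (φ u x)) ?_ ?_
      (left_mem_Icc.2 huv.le) (right_mem_Icc.2 huv.le)
    · intro s _
      have := (hF.deriv x s).fun_sub ((hasDerivAt_id' s).smul_const (V (φ u x)))
      simpa using this.hasDerivWithinAt
    · intro s hs
      rw [← dist_eq_norm]
      refine hu s (hsub hs) u hu' ?_
      rw [Real.dist_eq, abs_of_nonneg (by linarith [hs.1])]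
      linarith [hs.2]
  rw [Real.norm_of_nonneg (by linarith)] at h1
  set E : ℂ := ((φ v x : ℂ) - v • V (φ u x)) - ((φ u x : ℂ) - u • V (φ u x)) with hE
  have h2 : (((1 - r) * (v - u) + r * l : ℝ) : ℂ) * V (φ u x) = -((1 - r : ℝ) * E) := by
    rw [hE]
    simp only [Complex.real_smul]
    push_cast at h ⊢
    linear_combination h
  have h3 := congrArg norm h2
  have hr1 : 0 ≤ 1 - r := by linarith [hr.2]
  have hr0 := hr.1
  have hpos : 0 ≤ (1 - r) * (v - u) + r * l := by
    have := mul_nonneg hr1 (sub_nonneg.2 huv.le)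
    have := mul_nonneg hr0 hl.le
    linarith
  rw [norm_mul, norm_neg, norm_mul, Complex.norm_real, Complex.norm_real,
    Real.norm_of_nonneg hpos, Real.norm_of_nonneg hr1] at h3
  have h4 : ‖V (φ t₀ x)‖ ≤ ‖V (φ u x)‖ := hmin hu'
  have h5 : (1 - r) * ‖E‖ ≤ (1 - r) * (‖V (φ t₀ x)‖ / 2 * (v - u)) :=
    mul_le_mul_of_nonneg_left h1 hr1
  have h6 := mul_le_mul_of_nonneg_left h4 hpos
  rcases hr1.eq_or_lt with h7 | h7
  · have : r = 1 := by linarith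
    subst this
    nlinarith [mul_pos hl hm]
  · nlinarith [mul_pos (mul_pos h7 (sub_pos.2 huv)) hm, mul_nonneg (mul_nonneg hr0 hl.le) hm.le]

lemma nonPer_of_forall {x : Disc} (h : ∀ T > 0, φ T x ≠ x) : NonPer φ x := by
  intro s t hst
  simp only at hst
  by_contra hne
  rcases lt_or_gt_of_ne hne with h1 | h1
  · refine h (t - s) (sub_pos.2 h1) ?_
    rw [sub_eq_neg_add, ← hF.add, ← hst, hF.neg_cancel]
  · refine h (s - t) (sub_pos.2 h1) ?_
    rw [sub_eq_neg_add, ← hF.add, hst, hF.neg_cancel]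

lemma nonPer_or (x : Disc) : NonPer φ x ∨ ∃ T > 0, φ T x = x := by
  by_cases h : ∃ T > 0, φ T x = x
  · exact Or.inr h
  · push Not at h
    exact Or.inl (hF.nonPer_of_forall h)

lemma nonPer_ne {x : Disc} (hx : NonPer φ x) {T : ℝ} (hT : T ≠ 0) : φ T x ≠ x := by
  intro h
  exact hT (hx (by simpa [hF.zero] using h))

lemma V_ne_of_nonPer {x : Disc} (hx : NonPer φ x) (t : ℝ) : V (φ t x) ≠ 0 := by
  intro h
  have := hF.singular_of_V_eq_zero h 1
  rw [hF.add] at this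
  have := hx this
  linarith

end DiscFlow

/-- The height of `q` over the line through `z` orthogonal to `d`. -/
noncomputable def ht (z d q : ℂ) : ℝ := ((q - z) / d).re

/-- The cross section of radius `ρ` at `z` orthogonal to `d`. -/
def sec (z d : ℂ) (ρ : ℝ) : Set ℂ := {q | ht z d q = 0 ∧ dist q z ≤ ρ}

lemma continuous_ht (z d : ℂ) : Continuous (ht z d) := by
  unfold ht
  fun_prop

lemma ht_add (z d q v : ℂ) : ht z d (q + v) = ht z d q + (v / d).re := by
  unfold ht
  rw [← Complex.add_re, ← add_div]
  congr 2
  ring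

lemma ht_add_mul {z d q : ℂ} (hd : d ≠ 0) (r : ℝ) : ht z d (q + r * d) = ht z d q + r := by
  rw [ht_add, mul_div_cancel_right₀ _ hd, Complex.ofReal_re]

lemma ht_neg (z d q : ℂ) : ht z (-d) q = -ht z d q := by
  unfold ht
  rw [div_neg, Complex.neg_re]

lemma ht_self (z d : ℂ) : ht z d z = 0 := by simp [ht]

lemma ht_comb (z d x y : ℂ) (r : ℝ) :
    ht z d (x + (r : ℂ) * (y - x)) = ht z d x + r * (ht z d y - ht z d x) := by
  unfold ht
  rw [← Complex.sub_re, ← Complex.re_ofReal_mul, ← Complex.add_re]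
  congr 1
  ring

lemma isClosed_sec (z d : ℂ) (ρ : ℝ) : IsClosed (sec z d ρ) :=
  (isClosed_eq (continuous_ht z d) continuous_const).inter
    (isClosed_le (continuous_id.dist continuous_const) continuous_const)

lemma convex_ht_neg (z d : ℂ) : Convex ℝ {q | ht z d q < 0} := by
  intro x hx y hy a b ha hb hab
  have h : a • x + b • y = x + (b : ℂ) * (y - x) := by
    have : a = 1 - b := by linarith
    subst this
    simp only [Complex.real_smul]
    push_cast
    ring
  simp only [mem_ofPred_eq] at hx hy ⊢
  rw [h, ht_comb]
  rcases ha.eq_or_lt with h0 | h0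
  · have : b = 1 := by linarith
    subst this
    linarith
  · nlinarith [mul_nonpos_of_nonneg_of_nonpos hb hy.le, mul_neg_of_pos_of_neg h0 hx]

/-- A flow box at `z`: on the ball of radius `R` the field has a positive component along `d`. -/
structure Box (V : ℂ → ℂ) (z d : ℂ) (R : ℝ) : Prop where
  ne : d ≠ 0
  pos : 0 < R
  re : ∀ x ∈ Disc, dist x z ≤ R → 1 / 2 < (V x / d).re

lemma Box.rev {V : ℂ → ℂ} {z d : ℂ} {R : ℝ} (hB : Box V z d R) :
    Box (fun x => -V x) z (-d) R :=
  ⟨neg_ne_zero.2 hB.ne, hB.pos, fun x hx h => by rw [neg_div_neg_eq]; exact hB.re x hx h⟩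

lemma Box.mono {V : ℂ → ℂ} {z d : ℂ} {R R' : ℝ} (hB : Box V z d R) (h : R' ≤ R) (h0 : 0 < R') :
    Box V z d R' :=
  ⟨hB.ne, h0, fun x hx hR => hB.re x hx (hR.trans h)⟩

lemma bound_nonneg {V : ℂ → ℂ} {M : ℝ} (hM : ∀ x ∈ Disc, ‖V x‖ ≤ M) : 0 ≤ M :=
  (norm_nonneg _).trans (hM 0 (by simp))

namespace DiscFlow

variable {φ : ℝ → Disc → Disc} {V : ℂ → ℂ} {p : ℂ} (hF : DiscFlow φ V p)
include hF

lemma exists_box {z : Disc} (hz : V z ≠ 0) : ∃ R, Box V z (V z) R := by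
  have h1 : ContinuousAt (fun x : Disc => (V x / V z).re) z :=
    (Complex.continuous_re.comp (hF.contV'.div_const _)).continuousAt
  have h2 : ∀ᶠ x : Disc in 𝓝 z, 1 / 2 < (V x / V z).re := by
    refine h1.eventually (lt_mem_nhds ?_)
    simp only [div_self hz, Complex.one_re]
    norm_num
  obtain ⟨r, hr, h⟩ := Metric.nhds_basis_closedBall.eventually_iff.1 h2
  exact ⟨r, hz, hr, fun x hx hxr => h (x := ⟨x, hx⟩)
      (by rw [mem_closedBall, Subtype.dist_eq]; exact hxr)⟩

variable {z d : ℂ} {R : ℝ} (hB : Box V z d R)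
include hB

lemma ht_mono {x : Disc} {a b : ℝ} (hab : a ≤ b)
    (h : ∀ s ∈ Icc a b, dist (φ s x : ℂ) z ≤ R) :
    ht z d (φ a x) + (b - a) / 2 ≤ ht z d (φ b x) := by
  have hd : ∀ s, HasDerivAt (fun s => ht z d (φ s x)) (V (φ s x) / d).re s := fun s => by
    have h1 := ((hF.deriv x s).sub_const z).div_const d
    exact (Complex.reCLM.hasFDerivAt.comp_hasDerivAt s h1)
  have := (convex_Icc a b).mul_sub_le_image_sub_of_le_deriv (f := fun s => ht z d (φ s x))
    (C := 1 / 2) (fun s _ => (hd s).continuousAt.continuousWithinAt)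
    (fun s _ => (hd s).differentiableAt.differentiableWithinAt)
    (fun s hs => by
      rw [(hd s).deriv]
      exact (hB.re _ (φ s x).2 (h s (interior_subset hs))).le)
    a (left_mem_Icc.2 hab) b (right_mem_Icc.2 hab) hab
  linarith

variable {M : ℝ} (hM : ∀ x ∈ Disc, ‖V x‖ ≤ M)
include hM

omit hB in
lemma near_arc {x : Disc} {a s ρ R : ℝ} (ha : dist (φ a x : ℂ) z ≤ ρ) (h : M * |s - a| ≤ R - ρ) :
    dist (φ s x : ℂ) z ≤ R := by
  have h1 := hF.speed hM x s a
  have h2 := dist_triangle (φ s x : ℂ) (φ a x) z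
  rw [Subtype.dist_eq] at h1
  linarith

lemma ht_after {x : Disc} {a s ρ : ℝ} (ha : dist (φ a x : ℂ) z ≤ ρ) (has : a ≤ s)
    (h : M * (s - a) ≤ R - ρ) : ht z d (φ a x) + (s - a) / 2 ≤ ht z d (φ s x) := by
  refine hF.ht_mono hB has fun u hu => hF.near_arc hM ha ?_
  rw [abs_of_nonneg (by linarith [hu.1])]
  have := mul_le_mul_of_nonneg_left (show u - a ≤ s - a by linarith [hu.2]) (bound_nonneg hM)
  linarith

lemma ht_before {x : Disc} {a s ρ : ℝ} (ha : dist (φ a x : ℂ) z ≤ ρ) (has : s ≤ a)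
    (h : M * (a - s) ≤ R - ρ) : ht z d (φ s x) + (a - s) / 2 ≤ ht z d (φ a x) := by
  refine hF.ht_mono hB has fun u hu => hF.near_arc hM ha ?_
  rw [abs_of_nonpos (by linarith [hu.2])]
  have := mul_le_mul_of_nonneg_left (show a - u ≤ a - s by linarith [hu.1]) (bound_nonneg hM)
  linarith

lemma hit_sep {x : Disc} {a s ρ : ℝ} (ha : (φ a x : ℂ) ∈ sec z d ρ)
    (hs : (φ s x : ℂ) ∈ sec z d ρ) (has : a < s) : R - ρ < M * (s - a) := by
  by_contra! h
  have := hF.ht_after hB hM ha.2 has.le h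
  rw [ha.1, hs.1] at this
  linarith

omit hM in
lemma exists_hit {ρ : ℝ} (hρ : 0 < ρ) : ∃ η > 0, ∀ x : Disc, dist (x : ℂ) z < η →
    ∃ s, |s| < ρ ∧ (φ s x : ℂ) ∈ sec z d ρ := by
  obtain ⟨M, hM0, hM⟩ := hF.exists_bound
  have hd := norm_pos_iff.2 hB.ne
  set m := min ρ R with hm
  have hmpos : 0 < m := lt_min hρ hB.pos
  set A := 1 + 2 / ‖d‖ * (1 + M) with hA
  have hA1 : 1 ≤ A := by
    rw [hA]
    have : 0 ≤ 2 / ‖d‖ * (1 + M) := by positivity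
    linarith
  refine ⟨m / (2 * A), by positivity, fun x hx => ?_⟩
  set η := m / (2 * A) with hη
  have hη0 : 0 < η := by positivity
  have hηA : η * A = m / 2 := by rw [hη]; field_simp
  set σ := 2 / ‖d‖ * η with hσ
  have hσ0 : 0 < σ := by positivity
  have hsum : η + σ + M * σ = m / 2 := by rw [← hηA, hA, hσ]; ring
  have hMσ : 0 < M * σ := by positivity
  have hht : |ht z d x| ≤ σ / 2 := by
    unfold ht
    refine (Complex.abs_re_le_norm _).trans ?_
    rw [norm_div, ← dist_eq_norm, hσ, div_mul_eq_mul_div, div_div, mul_comm ‖d‖ 2, ← div_div]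
    gcongr
    linarith
  rw [abs_le] at hht
  have h0 : dist (φ 0 x : ℂ) z ≤ η := by rw [hF.zero]; exact hx.le
  have hmR : m ≤ R := min_le_right _ _
  have hmρ : m ≤ ρ := min_le_left _ _
  have h1 := hF.ht_after hB hM h0 hσ0.le (by linarith)
  have h2 := hF.ht_before (s := -σ) hB hM h0 (by linarith) (by linarith)
  rw [hF.zero] at h1 h2
  obtain ⟨s, hs, hs0⟩ := intermediate_value_Icc (show -σ ≤ σ by linarith)
    ((continuous_ht z d).comp (hF.contC x)).continuousOn
    (show (0 : ℝ) ∈ Icc _ _ from ⟨by simp only [Function.comp]; linarith,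
      by simp only [Function.comp]; linarith⟩)
  have hsa : |s| ≤ σ := abs_le.2 hs
  refine ⟨s, by linarith, hs0, hF.near_arc hM h0 ?_⟩
  rw [sub_zero]
  have := mul_le_mul_of_nonneg_left hsa hM0.le
  linarith

/-- Two visits of a cross section can be replaced by consecutive ones. -/
lemma exists_consecutive {x : Disc} {a b ρ : ℝ} (hM0 : 0 < M) (hρ : ρ < R)
    (ha : (φ a x : ℂ) ∈ sec z d ρ)
    (hb : (φ b x : ℂ) ∈ sec z d ρ) (hab : a < b) :
    ∃ t₁, a < t₁ ∧ t₁ ≤ b ∧ (φ t₁ x : ℂ) ∈ sec z d ρ ∧ ∀ t ∈ Ioo a t₁, (φ t x : ℂ) ∉ sec z d ρ := by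
  set κ := (R - ρ) / M with hκ
  have hκ0 : 0 < κ := div_pos (sub_pos.2 hρ) hM0
  have hMκ : M * κ = R - ρ := by rw [hκ]; field_simp
  have hsep : ∀ s, a < s → (φ s x : ℂ) ∈ sec z d ρ → a + κ < s := fun s has hs => by
    have := hF.hit_sep hB hM ha hs has
    rw [← hMκ] at this
    linarith [lt_of_mul_lt_mul_left this hM0.le]
  have hK : IsCompact (Icc (a + κ) b ∩ (fun t => (φ t x : ℂ)) ⁻¹' sec z d ρ) :=
    isCompact_Icc.inter_right ((isClosed_sec z d ρ).preimage (hF.contC x))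
  obtain ⟨t₁, ht, hleast⟩ := hK.exists_isLeast ⟨b, ⟨(hsep b hab hb).le, le_rfl⟩, hb⟩
  refine ⟨t₁, by linarith [ht.1.1], ht.1.2, ht.2, fun t htt hts => ?_⟩
  have := hleast ⟨⟨(hsep t htt.1 hts).le, htt.2.le.trans ht.1.2⟩, hts⟩
  linarith [htt.2]

end DiscFlow

/-- The closed curve obtained by traversing `g` on the unit interval again and again. -/
lemma isLoop_fract {g : ℝ → ℂ} (hg : ContinuousOn g (Icc 0 1)) (h : g 0 = g 1) :
    IsLoop (fun s => g (Int.fract s)) :=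
  ⟨hg.comp_fract'' h, fun t => by simp⟩

lemma fract_injective_mod {g : ℝ → ℂ} (hg : InjOn g (Ico 0 1)) (s t : ℝ)
    (h : g (Int.fract s) = g (Int.fract t)) : ∃ n : ℤ, t = s + n := by
  have := hg ⟨Int.fract_nonneg s, Int.fract_lt_one s⟩ ⟨Int.fract_nonneg t, Int.fract_lt_one t⟩ h
  refine ⟨⌊t⌋ - ⌊s⌋, ?_⟩
  rw [Int.fract, Int.fract] at this
  push_cast
  linarith

/-- Near a preconnected part `S` of a line, on a side of it that the loop does not meet near `S`,
the winding number is constant. -/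
lemma IsLoop.side_const {c : ℝ → ℂ} (hc : IsLoop c) {z d : ℂ} (hd : d ≠ 0) {S : Set ℂ}
    (hS : IsPreconnected S) (hne : S.Nonempty) (hS0 : ∀ m ∈ S, ht z d m = 0)
    (hfree : ∀ m ∈ S, ∃ r > 0, ∀ q, dist q m < r → ht z d q < 0 → q ∉ range c) :
    ∃ k : ℤ, ∀ m ∈ S, ∃ r > 0, ∀ q, dist q m < r → ht z d q < 0 → q ∉ range c ∧ wind c q = k := by
  have hloc : ∀ m, ∃ (r : ℝ) (k : ℤ), m ∈ S → 0 < r ∧ ∀ q, dist q m < r → ht z d q < 0 →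
      q ∉ range c ∧ wind c q = k := by
    intro m
    by_cases hm : m ∈ S
    · obtain ⟨r, hr, h⟩ := hfree m hm
      have hconv : Convex ℝ (ball m r ∩ {q | ht z d q < 0}) :=
        (convex_ball m r).inter (convex_ht_neg z d)
      by_cases he : (ball m r ∩ {q | ht z d q < 0}).Nonempty
      · obtain ⟨q₀, hq₀⟩ := he
        refine ⟨r, wind c q₀, fun _ => ⟨hr, fun q hq hq' => ⟨h q hq hq', ?_⟩⟩⟩
        exact hc.wind_eq_of_preconnected hconv.isPreconnected (fun q hq => h q hq.1 hq.2)
          ⟨hq, hq'⟩ hq₀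
      · exact ⟨r, 0, fun _ => ⟨hr, fun q hq hq' => absurd ⟨q, hq, hq'⟩ he⟩⟩
    · exact ⟨1, 0, fun h => absurd h hm⟩
  choose r k hrk using hloc
  have hcont : ContinuousOn k S := by
    intro m hm
    have : ∀ᶠ m' in 𝓝[S] m, k m' = k m := by
      have h1 : ∀ᶠ m' in 𝓝[S] m, m' ∈ ball m (r m) :=
        nhdsWithin_le_nhds (ball_mem_nhds m (hrk m hm).1)
      filter_upwards [h1, self_mem_nhdsWithin] with m' hm' hm'S
      have hlim : Tendsto (fun τ : ℝ => m' + ((-τ : ℝ) : ℂ) * d) (𝓝[>] 0) (𝓝 m') := by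
        have : ContinuousAt (fun τ : ℝ => m' + ((-τ : ℝ) : ℂ) * d) 0 := by fun_prop
        have h2 := this.tendsto
        simp only [neg_zero, Complex.ofReal_zero, zero_mul, add_zero] at h2
        exact h2.mono_left nhdsWithin_le_nhds
      have h2 := hlim.eventually (ball_mem_nhds m' (hrk m' hm'S).1)
      have h3 := hlim.eventually (isOpen_ball.mem_nhds hm')
      obtain ⟨τ, ⟨hτ2, hτ3⟩, hτ⟩ := ((h2.and h3).and self_mem_nhdsWithin).exists
      have h4 : ht z d (m' + ((-τ : ℝ) : ℂ) * d) < 0 := by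
        rw [ht_add_mul hd, hS0 m' hm'S]
        simpa using hτ
      rw [← ((hrk m' hm'S).2 _ hτ2 h4).2, ((hrk m hm).2 _ hτ3 h4).2]
    rw [ContinuousWithinAt]
    exact (tendsto_congr' this).2 tendsto_const_nhds
  obtain ⟨m₀, hm₀⟩ := hne
  refine ⟨k m₀, fun m hm => ⟨r m, (hrk m hm).1, fun q hq hq' => ?_⟩⟩
  rw [hS.constant hcont hm₀ hm]
  exact (hrk m hm).2 q hq hq'

/-- A path that starts on the `k`-side of a loop and could only come back from the `l`-side never
meets the loop. -/
lemma IsLoop.no_hit {c : ℝ → ℂ} (hc : IsLoop c) {γ : ℝ → ℂ} (hγ : Continuous γ) {A : ℝ} {k l : ℤ}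
    (hkl : l ≠ k) (h0 : ∀ᶠ t in 𝓝[>] A, γ t ∉ range c ∧ wind c (γ t) = k)
    (h1 : ∀ t > A, γ t ∈ range c → ∀ᶠ s in 𝓝[<] t, wind c (γ s) = l) :
    ∀ t > A, γ t ∉ range c ∧ wind c (γ t) = k := by
  obtain ⟨u, hu, hsub⟩ := mem_nhdsGT_iff_exists_Ioc_subset.1 h0
  have hu' : A < u := hu
  have hseg : ∀ a b, A < a → a ≤ b → (∀ s ∈ Icc a b, γ s ∉ range c) →
      wind c (γ a) = wind c (γ b) := by
    intro a b _ hab h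
    exact hc.wind_eq_of_preconnected
      ((isPreconnected_Icc (a := a) (b := b)).image γ hγ.continuousOn)
      (by rintro _ ⟨s, hs, rfl⟩; exact h s hs) ⟨a, left_mem_Icc.2 hab, rfl⟩
      ⟨b, right_mem_Icc.2 hab, rfl⟩
  have hno : ∀ t > A, γ t ∉ range c := by
    intro t ht hmem
    have hut : u < t := by
      by_contra! h
      exact (hsub ⟨ht, h⟩).1 hmem
    have hK : IsCompact (Icc u t ∩ γ ⁻¹' range c) :=
      isCompact_Icc.inter_right (hc.isCompact_range.isClosed.preimage hγ)
    obtain ⟨τ, hτ, hleast⟩ := hK.exists_isLeast ⟨t, ⟨hut.le, le_rfl⟩, hmem⟩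
    have huτ : u < τ := lt_of_le_of_ne hτ.1.1 fun h => (hsub ⟨hu', le_rfl⟩).1 (h ▸ hτ.2)
    have h2 := h1 τ (hu'.trans huτ) hτ.2
    obtain ⟨s, hs1, hs2⟩ := (h2.and (Ioo_mem_nhdsLT huτ)).exists
    have h3 := hseg u s hu' hs2.1.le fun v hv hvc => by
      have := hleast ⟨⟨hv.1, by linarith [hv.2, hs2.2, hτ.1.2]⟩, hvc⟩
      linarith [hv.2, hs2.2]
    rw [hs1, (hsub ⟨hu', le_rfl⟩).2] at h3
    exact hkl h3.symm
  intro t ht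
  refine ⟨hno t ht, ?_⟩
  rcases le_total t u with h | h
  · exact (hsub ⟨ht, h⟩).2
  · rw [← hseg u t hu' h fun s hs => hno s (hu'.trans_le hs.1)]
    exact (hsub ⟨hu', le_rfl⟩).2

lemma IsLoop.no_hit_before {c : ℝ → ℂ} (hc : IsLoop c) {γ : ℝ → ℂ} (hγ : Continuous γ) {A : ℝ}
    {k l : ℤ} (hkl : l ≠ k) (h0 : ∀ᶠ t in 𝓝[<] A, γ t ∉ range c ∧ wind c (γ t) = k)
    (h1 : ∀ t < A, γ t ∈ range c → ∀ᶠ s in 𝓝[>] t, wind c (γ s) = l) :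
    ∀ t < A, γ t ∉ range c ∧ wind c (γ t) = k := by
  intro t ht
  have := hc.no_hit (γ := fun t => γ (-t)) (A := -A) (hγ.comp continuous_neg) hkl
    ((tendsto_neg_nhdsGT (a := -A)).eventually
      (p := fun t => γ t ∉ range c ∧ wind c (γ t) = k) (by rwa [neg_neg]))
    (fun s hs hm => by
      exact (tendsto_neg_nhdsLT (a := s)).eventually (p := fun t => wind c (γ t) = l)
        (h1 (-s) (by linarith) hm)) (-t)
    (by simpa using ht)
  simpa using this

/-- A loop made of an orbit arc and a chord of a cross section: the flow crosses it in one
direction only. -/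
structure IsCycle (φ : ℝ → Disc → Disc) (p : ℂ) (x : Disc) (z : ℂ) (ρ : ℝ) (c : ℝ → ℂ)
    (t₀ t₁ : ℝ) (km kp : ℤ) : Prop where
  loop : IsLoop c
  mem : ∀ s, c s ∈ Disc
  lt : t₀ < t₁
  sub : ∀ s, (∃ t, c s = φ t x) ∨ dist (c s) z ≤ ρ
  arc : ∀ t ∈ Icc t₀ t₁, (φ t x : ℂ) ∈ range c
  ne : km ≠ kp
  fwd : ∀ t > t₁, (φ t x : ℂ) ∉ range c ∧ wind c (φ t x) = kp
  bwd : ∀ t < t₀, (φ t x : ℂ) ∉ range c ∧ wind c (φ t x) = km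
  cross_fwd : ∀ y : Disc, (∀ t, y ≠ φ t x) → ∀ a, (φ a y : ℂ) ∈ range c →
    ∀ t > a, (φ t y : ℂ) ∉ range c ∧ wind c (φ t y) = kp
  cross_bwd : ∀ y : Disc, (∀ t, y ≠ φ t x) → ∀ a, (φ a y : ℂ) ∈ range c →
    ∀ t < a, (φ t y : ℂ) ∉ range c ∧ wind c (φ t y) = km
  wp : p ∉ range c → wind c p ≠ 0

/-- Consecutive visits of a cross section by a nonperiodic orbit. -/
structure CycData (φ : ℝ → Disc → Disc) (V : ℂ → ℂ) (p z d : ℂ) (R M ρ : ℝ) (x : Disc)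
    (t₀ t₁ : ℝ) : Prop where
  F : DiscFlow φ V p
  B : Box V z d R
  M_pos : 0 < M
  bound : ∀ x ∈ Disc, ‖V x‖ ≤ M
  ρ_lt : ρ < R
  nonPer : NonPer φ x
  lt : t₀ < t₁
  h0 : (φ t₀ x : ℂ) ∈ sec z d ρ
  h1 : (φ t₁ x : ℂ) ∈ sec z d ρ
  hio : ∀ t ∈ Ioo t₀ t₁, (φ t x : ℂ) ∉ sec z d ρ

/-- The segment from `a` to `b`. -/
noncomputable def chord (a b : ℂ) (u : ℝ) : ℂ := a + (u : ℂ) * (b - a)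

lemma continuous_chord (a b : ℂ) : Continuous (chord a b) := by
  unfold chord
  fun_prop

lemma chord_zero (a b : ℂ) : chord a b 0 = a := by simp [chord]

lemma chord_one (a b : ℂ) : chord a b 1 = b := by simp [chord]

lemma chord_sub (a b : ℂ) (u v : ℝ) : chord a b u - chord a b v = ((u - v : ℝ) : ℂ) * (b - a) := by
  simp only [chord]
  push_cast
  ring

lemma chord_inj {a b : ℂ} (h : b ≠ a) {u v : ℝ} (huv : chord a b u = chord a b v) : u = v := by
  have h1 := chord_sub a b u v
  rw [huv, sub_self, eq_comm, mul_eq_zero] at h1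
  rcases h1 with h1 | h1
  · exact sub_eq_zero.1 (by exact_mod_cast h1)
  · exact absurd (sub_eq_zero.1 h1) h

lemma chord_mem_sec {z d : ℂ} {ρ : ℝ} {a b : ℂ} (ha : a ∈ sec z d ρ) (hb : b ∈ sec z d ρ) {u : ℝ}
    (hu : u ∈ Icc (0 : ℝ) 1) : chord a b u ∈ sec z d ρ := by
  refine ⟨?_, ?_⟩
  · rw [chord, ht_comb, ha.1, hb.1]
    ring
  · have := (convex_closedBall z ρ).add_smul_sub_mem (x := a) (y := b) ha.2 hb.2 hu
    simpa [chord] using this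

namespace CycData

/-- The closed curve on the unit interval. -/
noncomputable def base (φ : ℝ → Disc → Disc) (x : Disc) (t₀ t₁ s : ℝ) : ℂ :=
  if s ≤ 1 / 2 then (φ (t₀ + 2 * s * (t₁ - t₀)) x : ℂ) else chord (φ t₁ x) (φ t₀ x) (2 * s - 1)

/-- The closed curve. -/
noncomputable def curve (φ : ℝ → Disc → Disc) (x : Disc) (t₀ t₁ s : ℝ) : ℂ :=
  base φ x t₀ t₁ (Int.fract s)

variable {φ : ℝ → Disc → Disc} {V : ℂ → ℂ} {p z d : ℂ} {R M ρ : ℝ} {x : Disc} {t₀ t₁ : ℝ}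
  (hC : CycData φ V p z d R M ρ x t₀ t₁)
include hC

lemma continuous_base : Continuous (base φ x t₀ t₁) := by
  refine Continuous.if_le ((hC.F.contC x).comp (by fun_prop))
    ((continuous_chord _ _).comp (by fun_prop)) continuous_id continuous_const ?_
  rintro s rfl
  norm_num
  simp [chord_zero]

omit hC in
lemma base_le {s : ℝ} (hs : s ≤ 1 / 2) :
    base φ x t₀ t₁ s = φ (t₀ + 2 * s * (t₁ - t₀)) x := if_pos hs

omit hC in
lemma base_ge {s : ℝ} (hs : 1 / 2 ≤ s) :
    base φ x t₀ t₁ s = chord (φ t₁ x) (φ t₀ x) (2 * s - 1) := by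
  rcases hs.eq_or_lt with h | h
  · subst h
    rw [base_le le_rfl]
    norm_num
    simp [chord_zero]
  · exact if_neg (not_le.2 h)

omit hC in
lemma base_zero : base φ x t₀ t₁ 0 = φ t₀ x := by
  rw [base_le (by norm_num)]
  simp

omit hC in
lemma base_one : base φ x t₀ t₁ 1 = φ t₀ x := by
  rw [base_ge (by norm_num)]
  norm_num [chord_one]

lemma loop : IsLoop (curve φ x t₀ t₁) :=
  isLoop_fract hC.continuous_base.continuousOn (by rw [base_zero, base_one])

omit hC in
lemma curve_eq {s : ℝ} (hs : s ∈ Icc (0 : ℝ) 1) : curve φ x t₀ t₁ s = base φ x t₀ t₁ s := by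
  rcases hs.2.eq_or_lt with h | h
  · subst h
    rw [curve, Int.fract_one, base_zero, base_one]
  · rw [curve, Int.fract_eq_self.2 ⟨hs.1, h⟩]

lemma orbit_inj {s t : ℝ} (h : (φ s x : ℂ) = φ t x) : s = t := hC.nonPer (Subtype.ext h)

lemma ends_ne : (φ t₀ x : ℂ) ≠ φ t₁ x := fun h => hC.lt.ne (hC.orbit_inj h)

lemma chord_sec {u : ℝ} (hu : u ∈ Icc (0 : ℝ) 1) : chord (φ t₁ x) (φ t₀ x) u ∈ sec z d ρ :=
  chord_mem_sec hC.h1 hC.h0 hu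

lemma arc_ne_chord {t u : ℝ} (ht : t ∈ Icc t₀ t₁) (hu : u ∈ Ioo (0 : ℝ) 1) :
    (φ t x : ℂ) ≠ chord (φ t₁ x) (φ t₀ x) u := by
  intro h
  rcases ht.1.eq_or_lt with h0 | h0
  · subst h0
    nth_rw 1 [← chord_one (φ t₁ x) (φ t₀ x)] at h
    exact hu.2.ne' (chord_inj hC.ends_ne h)
  rcases ht.2.eq_or_lt with h1 | h1
  · subst h1
    nth_rw 1 [← chord_zero (φ t x) (φ t₀ x)] at h
    exact hu.1.ne (chord_inj hC.ends_ne h)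
  · exact hC.hio t ⟨h0, h1⟩ (h ▸ hC.chord_sec (Ioo_subset_Icc_self hu))

lemma time_mem {s : ℝ} (hs : s ∈ Icc (0 : ℝ) (1 / 2)) :
    t₀ + 2 * s * (t₁ - t₀) ∈ Icc t₀ t₁ := by
  have := hC.lt
  constructor <;> nlinarith [hs.1, hs.2]

lemma injOn_base : InjOn (base φ x t₀ t₁) (Ico 0 1) := by
  have hT := sub_pos.2 hC.lt
  intro s hs t ht h
  by_cases h1 : s ≤ 1 / 2 <;> by_cases h2 : t ≤ 1 / 2
  · rw [base_le h1, base_le h2] at h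
    have := hC.orbit_inj h
    nlinarith
  · push Not at h2
    rw [base_le h1, base_ge h2.le] at h
    exact absurd h (hC.arc_ne_chord (hC.time_mem ⟨hs.1, h1⟩) ⟨by linarith, by linarith [ht.2]⟩)
  · push Not at h1
    rw [base_le h2, base_ge h1.le] at h
    exact absurd h.symm
      (hC.arc_ne_chord (hC.time_mem ⟨ht.1, h2⟩) ⟨by linarith, by linarith [hs.2]⟩)
  · push Not at h1 h2
    rw [base_ge h1.le, base_ge h2.le] at h
    linarith [chord_inj hC.ends_ne h]

lemma curve_inj (s t : ℝ) (h : curve φ x t₀ t₁ s = curve φ x t₀ t₁ t) : ∃ n : ℤ, t = s + n :=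
  fract_injective_mod hC.injOn_base s t h

lemma mem_arc {t : ℝ} (ht : t ∈ Icc t₀ t₁) : (φ t x : ℂ) ∈ range (curve φ x t₀ t₁) := by
  have hT := sub_pos.2 hC.lt
  have h2 : (t - t₀) / (2 * (t₁ - t₀)) ≤ 1 / 2 := by
    rw [div_le_div_iff₀ (by linarith) (by norm_num)]
    linarith [ht.2]
  have h1 : 0 ≤ (t - t₀) / (2 * (t₁ - t₀)) := div_nonneg (by linarith [ht.1]) (by linarith)
  refine ⟨(t - t₀) / (2 * (t₁ - t₀)), ?_⟩
  rw [curve_eq ⟨h1, by linarith⟩, base_le h2]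
  congr 2
  field_simp
  ring

lemma curve_cases (s : ℝ) : (∃ t ∈ Icc t₀ t₁, curve φ x t₀ t₁ s = φ t x) ∨
    ∃ u ∈ Ioo (0 : ℝ) 1, curve φ x t₀ t₁ s = chord (φ t₁ x) (φ t₀ x) u := by
  rcases le_or_gt (Int.fract s) (1 / 2) with h | h
  · exact Or.inl ⟨_, hC.time_mem ⟨Int.fract_nonneg s, h⟩, base_le h⟩
  · exact Or.inr ⟨_, ⟨by linarith, by linarith [Int.fract_lt_one s]⟩, base_ge h.le⟩

lemma curve_mem_disc (s : ℝ) : curve φ x t₀ t₁ s ∈ Disc := by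
  rcases hC.curve_cases s with ⟨t, -, h⟩ | ⟨u, hu, h⟩
  · rw [h]
    exact (φ t x).2
  · rw [h]
    have := (convex_closedBall (0 : ℂ) 1).add_smul_sub_mem (φ t₁ x).2 (φ t₀ x).2
      (Ioo_subset_Icc_self hu)
    simpa only [chord, Complex.real_smul] using this

lemma exists_aligned : ∃ ε ∈ Ioo (0 : ℝ) 1, ∀ s, ∀ r ∈ Icc (0 : ℝ) 1,
    (1 - r : ℝ) * (curve φ x t₀ t₁ (s + ε) - curve φ x t₀ t₁ s) + r * V (curve φ x t₀ t₁ s) ≠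
      0 := by
  obtain ⟨η, hη, hal⟩ := hC.F.arc_aligned x (a := t₀) (b := t₁)
    fun t _ => hC.F.V_ne_of_nonPer hC.nonPer t
  have hT := sub_pos.2 hC.lt
  have hM := hC.M_pos
  have hRρ := sub_pos.2 hC.ρ_lt
  set κ := min (η / (2 * (t₁ - t₀))) ((R - ρ) / (2 * M * (t₁ - t₀))) with hκ
  have hκ0 : 0 < κ := by positivity
  set ε := min (1 / 4) κ with hε
  have hε0 : 0 < ε := by positivity
  have hε1 : ε ≤ 1 / 4 := min_le_left _ _
  have hεη : 2 * ε * (t₁ - t₀) ≤ η := by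
    have : ε ≤ η / (2 * (t₁ - t₀)) := (min_le_right _ _).trans (min_le_left _ _)
    rw [le_div_iff₀ (by linarith)] at this
    linarith
  have hεM : M * (2 * ε * (t₁ - t₀)) ≤ R - ρ := by
    have : ε ≤ (R - ρ) / (2 * M * (t₁ - t₀)) := (min_le_right _ _).trans (min_le_right _ _)
    rw [le_div_iff₀ (by positivity)] at this
    linarith
  refine ⟨ε, ⟨hε0, by linarith⟩, fun s r hr => ?_⟩
  wlog hs : s ∈ Ico (0 : ℝ) 1 generalizing s
  · have h1 := hC.loop.per_int ⌊s⌋ (Int.fract s + ε)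
    have h2 := hC.loop.per_int ⌊s⌋ (Int.fract s)
    rw [add_right_comm, Int.fract_add_floor] at h1
    rw [Int.fract_add_floor] at h2
    rw [h1, h2]
    exact this _ ⟨Int.fract_nonneg s, Int.fract_lt_one s⟩
  have hcs := curve_eq (φ := φ) (x := x) (t₀ := t₀) (t₁ := t₁) ⟨hs.1, hs.2.le⟩
  rcases le_or_gt (s + ε) (1 / 2) with h1 | h1
  · have e1 : curve φ x t₀ t₁ s = φ (t₀ + 2 * s * (t₁ - t₀)) x := by
      rw [hcs, base_le (by linarith)]
    have e2 : curve φ x t₀ t₁ (s + ε) = φ (t₀ + 2 * (s + ε) * (t₁ - t₀)) x := by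
      rw [curve_eq ⟨by linarith [hs.1], by linarith⟩, base_le h1]
    rw [e1, e2]
    have := hal _ (hC.time_mem ⟨hs.1, by linarith⟩) _ (hC.time_mem ⟨by linarith [hs.1], h1⟩)
      (by nlinarith) (by linarith) r hr 1 one_pos
    simpa using this
  · have hlow : ht z d (curve φ x t₀ t₁ s) ≤ 0 ∧ dist (curve φ x t₀ t₁ s) z ≤ R := by
      rw [hcs]
      rcases le_or_gt s (1 / 2) with h2 | h2
      · rw [base_le h2]
        have h3 : t₁ - (t₀ + 2 * s * (t₁ - t₀)) = 2 * (1 / 2 - s) * (t₁ - t₀) := by ring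
        have h4 : M * (t₁ - (t₀ + 2 * s * (t₁ - t₀))) ≤ R - ρ := by
          rw [h3]
          refine le_trans ?_ hεM
          gcongr
          linarith
        have h5 := hC.F.ht_before hC.B hC.bound hC.h1.2 (hC.time_mem ⟨hs.1, h2⟩).2 h4
        rw [hC.h1.1] at h5
        refine ⟨by linarith [(hC.time_mem ⟨hs.1, h2⟩).2], hC.F.near_arc hC.bound hC.h1.2 ?_⟩
        rw [abs_sub_comm, abs_of_nonneg (by linarith [(hC.time_mem ⟨hs.1, h2⟩).2])]
        exact h4
      · rw [base_ge h2.le]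
        have h3 := hC.chord_sec (u := 2 * s - 1) ⟨by linarith, by linarith [hs.2]⟩
        exact ⟨h3.1.le, h3.2.trans hC.ρ_lt.le⟩
    have hup : 0 ≤ ht z d (curve φ x t₀ t₁ (s + ε)) := by
      rcases le_or_gt (s + ε) 1 with h2 | h2
      · rw [curve_eq ⟨by linarith [hs.1], h2⟩, base_ge h1.le]
        exact (hC.chord_sec ⟨by linarith, by linarith⟩).1.ge
      · have h0 : s + ε - 1 ∈ Icc (0 : ℝ) (1 / 2) := ⟨by linarith, by linarith [hs.2]⟩
        have e : curve φ x t₀ t₁ (s + ε) = φ (t₀ + 2 * (s + ε - 1) * (t₁ - t₀)) x := by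
          have h3 := hC.loop.per (s + ε - 1)
          rw [sub_add_cancel] at h3
          rw [h3, curve_eq ⟨h0.1, by linarith [h0.2]⟩, base_le h0.2]
        rw [e]
        have h4 : M * (t₀ + 2 * (s + ε - 1) * (t₁ - t₀) - t₀) ≤ R - ρ := by
          rw [add_sub_cancel_left]
          refine le_trans ?_ hεM
          gcongr
          linarith [hs.2]
        have h5 := hC.F.ht_after hC.B hC.bound hC.h0.2 (hC.time_mem h0).1 h4
        rw [hC.h0.1] at h5
        linarith [(hC.time_mem h0).1]
    intro h
    have h3 := hC.B.re _ (hC.curve_mem_disc s) hlow.2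
    have h4 := congrArg (fun w : ℂ => (w / d).re) h
    have h5 : ht z d (curve φ x t₀ t₁ (s + ε)) - ht z d (curve φ x t₀ t₁ s) =
        ((curve φ x t₀ t₁ (s + ε) - curve φ x t₀ t₁ s) / d).re := by
      unfold ht
      rw [← Complex.sub_re, ← sub_div]
      congr 2
      ring
    simp only [add_div, mul_div_assoc, Complex.add_re, Complex.re_ofReal_mul, zero_div,
      Complex.zero_re] at h4
    rw [← h5] at h4
    have h6 : 0 ≤ (1 - r) * (ht z d (curve φ x t₀ t₁ (s + ε)) - ht z d (curve φ x t₀ t₁ s)) :=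
      mul_nonneg (by linarith [hr.2]) (by linarith [hlow.1])
    rcases hr.1.eq_or_lt with h7 | h7
    · have h8 : curve φ x t₀ t₁ (s + ε) = curve φ x t₀ t₁ s := by
        rw [← h7] at h
        have : curve φ x t₀ t₁ (s + ε) - curve φ x t₀ t₁ s = 0 := by simpa using h
        exact sub_eq_zero.1 this
      obtain ⟨n, hn⟩ := hC.curve_inj _ _ h8
      have h9 : (0 : ℝ) < -n := by linarith
      have h10 : (-n : ℝ) < 1 := by linarith
      have h11 : (0 : ℤ) < -n := by exact_mod_cast h9
      have h12 : -n < (1 : ℤ) := by exact_mod_cast h10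
      omega
    · nlinarith [mul_pos h7 (show 0 < (V (curve φ x t₀ t₁ s) / d).re by linarith)]

lemma wind_ne_zero (hp : p ∉ range (curve φ x t₀ t₁)) : wind (curve φ x t₀ t₁) p ≠ 0 := by
  obtain ⟨ε, hε, hal⟩ := hC.exists_aligned
  have hW : Continuous fun s => V (curve φ x t₀ t₁ s) :=
    hC.F.contV.comp_continuous hC.loop.cont hC.curve_mem_disc
  obtain ⟨k, hk0, hk⟩ := hC.loop.exists_hasWind_of_aligned hC.curve_inj hW
    (fun t => by rw [hC.loop.per]) hε hal
  exact hC.loop.wind_ne_zero hC.F.contV hC.F.V_ne hC.curve_mem_disc hp hk0 hk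

end CycData

namespace CycData

variable {φ : ℝ → Disc → Disc} {V : ℂ → ℂ} {p z d : ℂ} {R M ρ : ℝ} {x : Disc} {t₀ t₁ : ℝ}
  (hC : CycData φ V p z d R M ρ x t₀ t₁)
include hC

lemma free_below {u : ℝ} (hu : u ∈ Ioc (0 : ℝ) 1) :
    ∃ r > 0, ∀ q, dist q (chord (φ t₁ x) (φ t₀ x) u) < r → ht z d q < 0 →
      q ∉ range (curve φ x t₀ t₁) := by
  have hκ : 0 < (R - ρ) / M := div_pos (sub_pos.2 hC.ρ_lt) hC.M_pos
  set κ := (R - ρ) / M with hκd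
  have hMκ : M * κ = R - ρ := by
    rw [hκd]
    field_simp [hC.M_pos.ne']
  have hK : IsClosed ((fun t => (φ t x : ℂ)) '' Icc (t₀ + κ) t₁) :=
    (isCompact_Icc.image (hC.F.contC x)).isClosed
  have hm : chord (φ t₁ x) (φ t₀ x) u ∈ ((fun t => (φ t x : ℂ)) '' Icc (t₀ + κ) t₁)ᶜ := by
    rintro ⟨t, ht, h⟩
    rcases hu.2.eq_or_lt with h1 | h1
    · rw [h1, chord_one] at h
      have := hC.orbit_inj h
      linarith [ht.1]
    · exact hC.arc_ne_chord ⟨by linarith [ht.1], ht.2⟩ ⟨hu.1, h1⟩ h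
  obtain ⟨r, hr, hball⟩ := Metric.isOpen_iff.1 hK.isOpen_compl _ hm
  refine ⟨r, hr, fun q hq hneg ⟨s, hs⟩ => ?_⟩
  rcases hC.curve_cases s with ⟨t, ht, h⟩ | ⟨v, hv, h⟩
  · rw [hs] at h
    rcases le_or_gt (t₀ + κ) t with h1 | h1
    · exact hball hq ⟨t, ⟨h1, ht.2⟩, h.symm⟩
    · have h2 := hC.F.ht_after (s := t) hC.B hC.bound hC.h0.2 ht.1
        (by rw [← hMκ]; exact mul_le_mul_of_nonneg_left (by linarith) hC.M_pos.le)
      rw [hC.h0.1, ← h] at h2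
      linarith [ht.1]
  · rw [hs] at h
    rw [h, (hC.chord_sec (Ioo_subset_Icc_self hv)).1] at hneg
    exact lt_irrefl _ hneg

lemma free_above {u : ℝ} (hu : u ∈ Ico (0 : ℝ) 1) :
    ∃ r > 0, ∀ q, dist q (chord (φ t₁ x) (φ t₀ x) u) < r → ht z (-d) q < 0 →
      q ∉ range (curve φ x t₀ t₁) := by
  have hκ : 0 < (R - ρ) / M := div_pos (sub_pos.2 hC.ρ_lt) hC.M_pos
  set κ := (R - ρ) / M with hκd
  have hMκ : M * κ = R - ρ := by
    rw [hκd]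
    field_simp [hC.M_pos.ne']
  have hK : IsClosed ((fun t => (φ t x : ℂ)) '' Icc t₀ (t₁ - κ)) :=
    (isCompact_Icc.image (hC.F.contC x)).isClosed
  have hm : chord (φ t₁ x) (φ t₀ x) u ∈ ((fun t => (φ t x : ℂ)) '' Icc t₀ (t₁ - κ))ᶜ := by
    rintro ⟨t, ht, h⟩
    rcases hu.1.eq_or_lt with h1 | h1
    · rw [← h1, chord_zero] at h
      have := hC.orbit_inj h
      linarith [ht.2]
    · exact hC.arc_ne_chord ⟨ht.1, by linarith [ht.2]⟩ ⟨h1, hu.2⟩ h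
  obtain ⟨r, hr, hball⟩ := Metric.isOpen_iff.1 hK.isOpen_compl _ hm
  refine ⟨r, hr, fun q hq hneg ⟨s, hs⟩ => ?_⟩
  rw [ht_neg] at hneg
  rcases hC.curve_cases s with ⟨t, ht, h⟩ | ⟨v, hv, h⟩
  · rw [hs] at h
    rcases le_or_gt t (t₁ - κ) with h1 | h1
    · exact hball hq ⟨t, ⟨ht.1, h1⟩, h.symm⟩
    · have h2 := hC.F.ht_before (s := t) hC.B hC.bound hC.h1.2 ht.2
        (by rw [← hMκ]; exact mul_le_mul_of_nonneg_left (by linarith) hC.M_pos.le)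
      rw [hC.h1.1, ← h] at h2
      linarith [ht.2]
  · rw [hs] at h
    rw [h, (hC.chord_sec (Ioo_subset_Icc_self hv)).1] at hneg
    linarith

lemma exists_sides : ∃ km kp : ℤ, km ≠ kp ∧
    (∀ u ∈ Ioc (0 : ℝ) 1, ∃ r > 0, ∀ q, dist q (chord (φ t₁ x) (φ t₀ x) u) < r → ht z d q < 0 →
      q ∉ range (curve φ x t₀ t₁) ∧ wind (curve φ x t₀ t₁) q = km) ∧
    (∀ u ∈ Ico (0 : ℝ) 1, ∃ r > 0, ∀ q, dist q (chord (φ t₁ x) (φ t₀ x) u) < r → 0 < ht z d q →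
      q ∉ range (curve φ x t₀ t₁) ∧ wind (curve φ x t₀ t₁) q = kp) := by
  have hcc := continuous_chord (φ t₁ x) (φ t₀ x)
  obtain ⟨km, hkm⟩ := hC.loop.side_const (z := z) hC.B.ne
    (S := chord (φ t₁ x) (φ t₀ x) '' Ioc 0 1) (isPreconnected_Ioc.image _ hcc.continuousOn)
    ⟨_, mem_image_of_mem _ (right_mem_Ioc.2 one_pos)⟩
    (by rintro _ ⟨u, hu, rfl⟩; exact (hC.chord_sec (Ioc_subset_Icc_self hu)).1)
    (by rintro _ ⟨u, hu, rfl⟩; exact hC.free_below hu)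
  obtain ⟨kp, hkp⟩ := hC.loop.side_const (z := z) (neg_ne_zero.2 hC.B.ne)
    (S := chord (φ t₁ x) (φ t₀ x) '' Ico 0 1) (isPreconnected_Ico.image _ hcc.continuousOn)
    ⟨_, mem_image_of_mem _ (left_mem_Ico.2 one_pos)⟩
    (by rintro _ ⟨u, hu, rfl⟩; rw [ht_neg, (hC.chord_sec (Ico_subset_Icc_self hu)).1, neg_zero])
    (by rintro _ ⟨u, hu, rfl⟩; exact hC.free_above hu)
  have hm : ∀ u ∈ Ioc (0 : ℝ) 1, ∃ r > 0, ∀ q, dist q (chord (φ t₁ x) (φ t₀ x) u) < r →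
      ht z d q < 0 → q ∉ range (curve φ x t₀ t₁) ∧ wind (curve φ x t₀ t₁) q = km :=
    fun u hu => hkm _ (mem_image_of_mem _ hu)
  have hp : ∀ u ∈ Ico (0 : ℝ) 1, ∃ r > 0, ∀ q, dist q (chord (φ t₁ x) (φ t₀ x) u) < r →
      0 < ht z d q → q ∉ range (curve φ x t₀ t₁) ∧ wind (curve φ x t₀ t₁) q = kp := fun u hu => by
    obtain ⟨r, hr, h⟩ := hkp _ (mem_image_of_mem _ hu)
    exact ⟨r, hr, fun q hq h0 => h q hq (by rw [ht_neg]; linarith)⟩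
  refine ⟨km, kp, ?_, hm, hp⟩
  obtain ⟨r₁, hr₁, h₁⟩ := hm (1 / 2) (by norm_num)
  obtain ⟨r₂, hr₂, h₂⟩ := hp (1 / 2) (by norm_num)
  set m := chord (φ t₁ x) (φ t₀ x) (1 / 2) with hmdef
  set D : ℂ := φ t₀ x - φ t₁ x with hD
  have hD0 : D ≠ 0 := sub_ne_zero.2 hC.ends_ne
  have hcm : ∀ t ∈ Ioo (1 / 2 : ℝ) 1, (curve φ x t₀ t₁ t - curve φ x t₀ t₁ (3 / 4)) / D =
      ((2 * (t - 3 / 4) : ℝ) : ℂ) := fun t ht => by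
    rw [curve_eq ⟨by linarith [ht.1], ht.2.le⟩, curve_eq (by norm_num),
      base_ge ht.1.le, base_ge (by norm_num), chord_sub, ← hD, mul_div_cancel_right₀ _ hD0]
    push_cast
    ring
  have hc34 : curve φ x t₀ t₁ (3 / 4) = m := by
    rw [curve_eq (by norm_num), base_ge (by norm_num), hmdef]
    norm_num
  have hw := hC.loop.eventually_wind_ne (t₀ := 3 / 4) (d := D)
    (fun t ht h => by
      obtain ⟨n, hn⟩ := hC.curve_inj _ _ h.symm
      have h1 : (0 : ℝ) < n := by linarith [ht.1]
      have h2 : (n : ℝ) < 1 := by linarith [ht.2]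
      have h3 : (0 : ℤ) < n := by exact_mod_cast h1
      have h4 : n < (1 : ℤ) := by exact_mod_cast h2
      omega) hD0
    (by
      filter_upwards [Ioo_mem_nhdsGT (show (3 / 4 : ℝ) < 1 by norm_num)] with t ht
      rw [hcm t ⟨by linarith [ht.1], ht.2⟩, Complex.ofReal_re]
      linarith [ht.1])
    (by
      filter_upwards [Ioo_mem_nhdsLT (show (1 / 2 : ℝ) < 3 / 4 by norm_num)] with t ht
      rw [hcm t ⟨ht.1, by linarith [ht.2]⟩, Complex.ofReal_re]
      linarith [ht.2])
  rw [hc34] at hw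
  have hsm : ∀ᶠ ε : ℝ in 𝓝[>] 0, ε * ‖D‖ < min r₁ r₂ := by
    have : ContinuousAt (fun ε : ℝ => ε * ‖D‖) 0 := by fun_prop
    refine (this.eventually (gt_mem_nhds ?_)).filter_mono nhdsWithin_le_nhds
    simpa using lt_min hr₁ hr₂
  obtain ⟨ε, ⟨⟨-, -, hne⟩, hsm⟩, hε⟩ := ((hw.and hsm).and self_mem_nhdsWithin).exists
  have hε : 0 < ε := hε
  have hsec := hC.chord_sec (u := 1 / 2) (by norm_num)
  have hre : (D / d).re = 0 := by
    have h0 := hC.h0.1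
    have h1 := hC.h1.1
    unfold ht at h0 h1
    have : D / d = (φ t₀ x - z) / d - (φ t₁ x - z) / d := by rw [hD]; ring
    rw [this, Complex.sub_re, h0, h1, sub_zero]
  have him : (D / d).im ≠ 0 := fun h =>
    div_ne_zero hD0 hC.B.ne (Complex.ext hre h)
  have hnorm : ‖(ε : ℂ) * (Complex.I * D)‖ = ε * ‖D‖ := by
    rw [norm_mul, norm_mul, Complex.norm_I, one_mul, Complex.norm_real, Real.norm_eq_abs,
      abs_of_pos hε]
  have d1 : dist (m + ε * (Complex.I * D)) m < min r₁ r₂ := by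
    rw [dist_eq_norm, add_sub_cancel_left, hnorm]
    exact hsm
  have d2 : dist (m - ε * (Complex.I * D)) m < min r₁ r₂ := by
    rw [dist_eq_norm, sub_sub_cancel_left, norm_neg, hnorm]
    exact hsm
  have hrot : ((ε : ℂ) * (Complex.I * D) / d).re = -(ε * (D / d).im) := by
    rw [mul_div_assoc, Complex.re_ofReal_mul, mul_div_assoc, Complex.I_mul_re]
    ring
  have e1 : ht z d (m + ε * (Complex.I * D)) = -(ε * (D / d).im) := by
    rw [ht_add, hsec.1, hrot, zero_add]
  have e2 : ht z d (m - ε * (Complex.I * D)) = ε * (D / d).im := by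
    rw [sub_eq_add_neg, ht_add, hsec.1, neg_div, Complex.neg_re, hrot, zero_add, neg_neg]
  rintro rfl
  rcases him.lt_or_gt with h | h
  · have h0 := mul_neg_of_pos_of_neg hε h
    exact hne ((h₂ _ (d1.trans_le (min_le_right _ _)) (by linarith)).2.trans
      (h₁ _ (d2.trans_le (min_le_left _ _)) (by linarith)).2.symm)
  · have h0 := mul_pos hε h
    exact hne ((h₁ _ (d1.trans_le (min_le_left _ _)) (by linarith)).2.trans
      (h₂ _ (d2.trans_le (min_le_right _ _)) (by linarith)).2.symm)

lemma eventually_after {y : Disc} {a : ℝ} (ha : (φ a y : ℂ) ∈ sec z d ρ) :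
    ∀ᶠ t in 𝓝[>] a, 0 < ht z d (φ t y) := by
  have hκ : 0 < (R - ρ) / M := div_pos (sub_pos.2 hC.ρ_lt) hC.M_pos
  filter_upwards [Ioo_mem_nhdsGT (show a < a + (R - ρ) / M by linarith)] with t ht
  have h1 : M * (t - a) ≤ R - ρ := by
    rw [← le_div_iff₀' hC.M_pos]
    linarith [ht.2]
  have := hC.F.ht_after hC.B hC.bound ha.2 ht.1.le h1
  rw [ha.1] at this
  linarith [ht.1]

lemma eventually_before {y : Disc} {a : ℝ} (ha : (φ a y : ℂ) ∈ sec z d ρ) :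
    ∀ᶠ t in 𝓝[<] a, ht z d (φ t y) < 0 := by
  have hκ : 0 < (R - ρ) / M := div_pos (sub_pos.2 hC.ρ_lt) hC.M_pos
  filter_upwards [Ioo_mem_nhdsLT (show a - (R - ρ) / M < a by linarith)] with t ht
  have h1 : M * (a - t) ≤ R - ρ := by
    rw [← le_div_iff₀' hC.M_pos]
    linarith [ht.1]
  have := hC.F.ht_before hC.B hC.bound ha.2 ht.2.le h1
  rw [ha.1] at this
  linarith [ht.2]

theorem isCycle : ∃ km kp, IsCycle φ p x z ρ (curve φ x t₀ t₁) t₀ t₁ km kp := by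
  obtain ⟨km, kp, hne, hm, hp⟩ := hC.exists_sides
  have after : ∀ (y : Disc) (a u : ℝ), u ∈ Ico (0 : ℝ) 1 →
      (φ a y : ℂ) = chord (φ t₁ x) (φ t₀ x) u → ∀ᶠ t in 𝓝[>] a,
        (φ t y : ℂ) ∉ range (curve φ x t₀ t₁) ∧ wind (curve φ x t₀ t₁) (φ t y) = kp := by
    intro y a u hu hy
    obtain ⟨r, hr, h⟩ := hp u hu
    have hd : ∀ᶠ t in 𝓝[>] a, (φ t y : ℂ) ∈ ball (chord (φ t₁ x) (φ t₀ x) u) r :=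
      ((hC.F.contC y).continuousAt.eventually
        (by beta_reduce; rw [hy]; exact ball_mem_nhds _ hr)).filter_mono
        nhdsWithin_le_nhds
    filter_upwards [hd, hC.eventually_after (y := y) (a := a)
      (by rw [hy]; exact hC.chord_sec (Ico_subset_Icc_self hu))] with t h1 h2
    exact h _ h1 h2
  have before : ∀ (y : Disc) (a u : ℝ), u ∈ Ioc (0 : ℝ) 1 →
      (φ a y : ℂ) = chord (φ t₁ x) (φ t₀ x) u → ∀ᶠ t in 𝓝[<] a,
        (φ t y : ℂ) ∉ range (curve φ x t₀ t₁) ∧ wind (curve φ x t₀ t₁) (φ t y) = km := by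
    intro y a u hu hy
    obtain ⟨r, hr, h⟩ := hm u hu
    have hd : ∀ᶠ t in 𝓝[<] a, (φ t y : ℂ) ∈ ball (chord (φ t₁ x) (φ t₀ x) u) r :=
      ((hC.F.contC y).continuousAt.eventually
        (by beta_reduce; rw [hy]; exact ball_mem_nhds _ hr)).filter_mono
        nhdsWithin_le_nhds
    filter_upwards [hd, hC.eventually_before (y := y) (a := a)
      (by rw [hy]; exact hC.chord_sec (Ioc_subset_Icc_self hu))] with t h1 h2
    exact h _ h1 h2
  have cases_x : ∀ t ∉ Icc t₀ t₁, (φ t x : ℂ) ∈ range (curve φ x t₀ t₁) →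
      ∃ u ∈ Ioo (0 : ℝ) 1, (φ t x : ℂ) = chord (φ t₁ x) (φ t₀ x) u := by
    rintro t ht ⟨s, hs⟩
    rcases hC.curve_cases s with ⟨t', ht', h⟩ | ⟨u, hu, h⟩
    · rw [hs] at h
      exact absurd (hC.orbit_inj h ▸ ht') ht
    · exact ⟨u, hu, hs ▸ h⟩
  have cases_y : ∀ y : Disc, (∀ t, y ≠ φ t x) → ∀ t, (φ t y : ℂ) ∈ range (curve φ x t₀ t₁) →
      ∃ u ∈ Ioo (0 : ℝ) 1, (φ t y : ℂ) = chord (φ t₁ x) (φ t₀ x) u := by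
    rintro y hy t ⟨s, hs⟩
    rcases hC.curve_cases s with ⟨t', ht', h⟩ | ⟨u, hu, h⟩
    · rw [hs] at h
      exfalso
      apply hy (-t + t')
      rw [← hC.F.add, ← (Subtype.ext h : φ t y = φ t' x), hC.F.add, neg_add_cancel, hC.F.zero]
    · exact ⟨u, hu, hs ▸ h⟩
  refine ⟨km, kp, ⟨hC.loop, hC.curve_mem_disc, hC.lt, fun s => ?_, fun t ht => hC.mem_arc ht, hne,
    ?_, ?_, ?_, ?_, hC.wind_ne_zero⟩⟩
  · rcases hC.curve_cases s with ⟨t, -, h⟩ | ⟨u, hu, h⟩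
    · exact Or.inl ⟨t, h⟩
    · exact Or.inr (h ▸ (hC.chord_sec (Ioo_subset_Icc_self hu)).2)
  · refine hC.loop.no_hit (hC.F.contC x) hne (after x t₁ 0 (by norm_num) (chord_zero _ _).symm) ?_
    intro t ht h
    obtain ⟨u, hu, h⟩ := cases_x t (fun h => absurd h.2 (not_le.2 ht)) h
    exact (before x t u (Ioo_subset_Ioc_self hu) h).mono fun _ h => h.2
  · refine hC.loop.no_hit_before (hC.F.contC x) hne.symm
      (before x t₀ 1 (by norm_num) (chord_one _ _).symm) ?_
    intro t ht h
    obtain ⟨u, hu, h⟩ := cases_x t (fun h => absurd h.1 (not_le.2 ht)) h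
    exact (after x t u (Ioo_subset_Ico_self hu) h).mono fun _ h => h.2
  · intro y hy a ha
    obtain ⟨u, hu, h⟩ := cases_y y hy a ha
    refine hC.loop.no_hit (hC.F.contC y) hne (after y a u (Ioo_subset_Ico_self hu) h) ?_
    intro t _ h
    obtain ⟨u, hu, h⟩ := cases_y y hy t h
    exact (before y t u (Ioo_subset_Ioc_self hu) h).mono fun _ h => h.2
  · intro y hy a ha
    obtain ⟨u, hu, h⟩ := cases_y y hy a ha
    refine hC.loop.no_hit_before (hC.F.contC y) hne.symm (before y a u (Ioo_subset_Ioc_self hu) h)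
        ?_
    intro t _ h
    obtain ⟨u, hu, h⟩ := cases_y y hy t h
    exact (after y t u (Ioo_subset_Ico_self hu) h).mono fun _ h => h.2

end CycData

namespace DiscFlow

variable {φ : ℝ → Disc → Disc} {V : ℂ → ℂ} {p : ℂ} (hF : DiscFlow φ V p)
include hF

theorem exists_cycle {z d : ℂ} {R ρ : ℝ} (hB : Box V z d R) (hρ : ρ < R) {x : Disc}
    (hx : NonPer φ x) {a b : ℝ} (hab : a < b) (ha : (φ a x : ℂ) ∈ sec z d ρ)
    (hb : (φ b x : ℂ) ∈ sec z d ρ) :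
    ∃ c t₁ km kp, t₁ ≤ b ∧ IsCycle φ p x z ρ c a t₁ km kp := by
  obtain ⟨M, hM0, hM⟩ := hF.exists_bound
  obtain ⟨t₁, h1, h2, h3, h4⟩ := hF.exists_consecutive hB hM hM0 hρ ha hb hab
  obtain ⟨km, kp, h⟩ := CycData.isCycle (⟨hF, hB, hM0, hM, hρ, hx, h1, ha, h3, h4⟩ :
    CycData φ V p z d R M ρ x a t₁)
  exact ⟨_, t₁, km, kp, h2, h⟩

end DiscFlow

/-- `T` is the minimal period of `y`. -/
structure MinPer (φ : ℝ → Disc → Disc) (y : Disc) (T : ℝ) : Prop where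
  pos : 0 < T
  eq : φ T y = y
  ne : ∀ t ∈ Ioo 0 T, φ t y ≠ y

/-- The closed curve traced by a periodic orbit. -/
noncomputable def perCurve (φ : ℝ → Disc → Disc) (y : Disc) (T s : ℝ) : ℂ := φ (s * T) y

namespace DiscFlow

variable {φ : ℝ → Disc → Disc} {V : ℂ → ℂ} {p : ℂ} (hF : DiscFlow φ V p)
include hF

lemma V_orbit_ne {y : Disc} (hV : V y ≠ 0) (t : ℝ) : V (φ t y) ≠ 0 := by
  intro h
  have h1 := hF.singular_of_V_eq_zero h (-t)
  rw [hF.neg_cancel] at h1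
  exact hV (h1 ▸ h)

lemma exists_minPer {y : Disc} (hV : V y ≠ 0) {T : ℝ} (hT : 0 < T) (hy : φ T y = y) :
    ∃ T, MinPer φ y T := by
  obtain ⟨η, hη, hal⟩ := hF.arc_aligned y (a := 0) (b := 1) fun t _ => hF.V_orbit_ne hV t
  have hne : ∀ t, 0 < t → t ≤ min η 1 → φ t y ≠ y := fun t ht htm h => by
    have := hal 0 (by simp) t ⟨ht.le, htm.trans (min_le_right _ _)⟩ ht
      (by linarith [min_le_left η 1]) 0 (by simp) 1 one_pos
    rw [h, hF.zero] at this
    simp at this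
  have hm : 0 < min η 1 := lt_min hη one_pos
  have hT' : min η 1 ≤ T := by
    by_contra! h
    exact hne T hT h.le hy
  have hK : IsCompact (Icc (min η 1) T ∩ {t | φ t y = y}) :=
    isCompact_Icc.inter_right (isClosed_eq (hF.cont_t y) continuous_const)
  obtain ⟨t, ht, hl⟩ := hK.exists_isLeast ⟨T, ⟨hT', le_rfl⟩, hy⟩
  refine ⟨t, hm.trans_le ht.1.1, ht.2, fun s hs hsy => ?_⟩
  have h1 : min η 1 ≤ s := by
    by_contra! h
    exact hne s hs.1 h.le hsy
  exact absurd (hl ⟨⟨h1, hs.2.le.trans ht.1.2⟩, hsy⟩) (not_le.2 hs.2)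

section

variable {y : Disc} {T : ℝ} (hT : MinPer φ y T)
include hT

lemma period_int (n : ℤ) (t : ℝ) : φ (t + n * T) y = φ t y := by
  have h1 : Function.Periodic (fun t => φ t y) T := fun t => by
    beta_reduce
    rw [← hF.add, hT.eq]
  exact h1.int_mul n t

lemma perCurve_loop : IsLoop (perCurve φ y T) where
  cont := (hF.contC y).comp (by fun_prop)
  per t := by
    have := hF.period_int hT 1 (t * T)
    rw [perCurve, perCurve, ← this]
    congr 2
    push_cast
    ring

lemma perCurve_inj (s t : ℝ) (h : perCurve φ y T s = perCurve φ y T t) : ∃ n : ℤ, t = s + n := by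
  have h1 : φ (s * T) y = φ (t * T) y := Subtype.ext h
  have h2 : φ ((t - s) * T) y = y := by
    have : (t - s) * T = -(s * T) + t * T := by ring
    rw [this, ← hF.add, ← h1, hF.neg_cancel]
  have h3 : φ (Int.fract (t - s) * T) y = y := by
    rw [← hF.period_int hT ⌊t - s⌋, ← add_mul, Int.fract_add_floor, h2]
  have h4 : Int.fract (t - s) = 0 := by
    by_contra h0
    have h5 : 0 < Int.fract (t - s) := lt_of_le_of_ne (Int.fract_nonneg _) (Ne.symm h0)
    exact hT.ne _ ⟨mul_pos h5 hT.pos, by nlinarith [Int.fract_lt_one (t - s), hT.pos]⟩ h3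
  refine ⟨⌊t - s⌋, ?_⟩
  have := Int.fract_add_floor (t - s)
  rw [h4] at this
  linarith

lemma perCurve_wind (hV : V y ≠ 0) (hp : p ∉ range (perCurve φ y T)) :
    wind (perCurve φ y T) p ≠ 0 := by
  have hT0 := hT.pos
  have hc := hF.perCurve_loop hT
  obtain ⟨η, hη, hal⟩ := hF.arc_aligned y (a := 0) (b := 2 * T) fun t _ => hF.V_orbit_ne hV t
  set ε := min (1 / 2) (η / T) with hε
  have hε0 : 0 < ε := by positivity
  have hε1 : ε ≤ 1 / 2 := min_le_left _ _
  have hε2 : ε * T ≤ η := by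
    rw [← le_div_iff₀ hT0]
    exact min_le_right _ _
  have hmem : ∀ s, perCurve φ y T s ∈ Disc := fun s => (φ (s * T) y).2
  have hW : Continuous fun s => V (perCurve φ y T s) := hF.contV.comp_continuous hc.cont hmem
  obtain ⟨k, hk0, hk⟩ := hc.exists_hasWind_of_aligned (hF.perCurve_inj hT) hW
    (fun t => by rw [hc.per]) (ε := ε) ⟨hε0, by linarith⟩ (fun s r hr => by
      wlog hs : s ∈ Ico (0 : ℝ) 1 generalizing s
      · have h1 := hc.per_int ⌊s⌋ (Int.fract s + ε)
        have h2 := hc.per_int ⌊s⌋ (Int.fract s)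
        rw [add_right_comm, Int.fract_add_floor] at h1
        rw [Int.fract_add_floor] at h2
        rw [h1, h2]
        exact this _ ⟨Int.fract_nonneg s, Int.fract_lt_one s⟩
      have h1 := hs.1
      have h2 := hs.2
      have := hal (s * T) ⟨by positivity, by nlinarith⟩ ((s + ε) * T)
        ⟨by positivity, by nlinarith⟩ (by nlinarith) (by linarith) r hr 1 one_pos
      simpa [perCurve] using this)
  exact hc.wind_ne_zero hF.contV hF.V_ne hmem hp hk0 hk

end

end DiscFlow

/-- `z` is an `ω`-limit point of `y`. -/
def Om (φ : ℝ → Disc → Disc) (y z : Disc) : Prop := MapClusterPt z atTop fun t => φ t y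

lemma om_iff {φ : ℝ → Disc → Disc} {y z : Disc} :
    Om φ y z ↔ ∀ U ∈ 𝓝 z, ∀ N : ℝ, ∃ t, N ≤ t ∧ φ t y ∈ U := by
  simp only [Om, mapClusterPt_iff_frequently, frequently_atTop]

lemma exists_om (φ : ℝ → Disc → Disc) (y : Disc) : ∃ z, Om φ y z :=
  exists_clusterPt_of_compactSpace _

lemma tendsto_of_om {φ : ℝ → Disc → Disc} {y q : Disc} (h : ∀ z, Om φ y z → z = q) :
    Tendsto (fun t => φ t y) atTop (𝓝 q) :=
  le_nhds_of_unique_clusterPt h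

lemma om_of_tendsto {φ : ℝ → Disc → Disc} {y q : Disc}
    (h : Tendsto (fun t => φ t y) atTop (𝓝 q)) : Om φ y q := h.mapClusterPt

lemma Om.mem_of_closed {φ : ℝ → Disc → Disc} {y z : Disc} (hz : Om φ y z) {F : Set Disc}
    (hF : IsClosed F) (h : ∀ᶠ t in atTop, φ t y ∈ F) : z ∈ F := by
  by_contra hn
  obtain ⟨N, hN⟩ := eventually_atTop.1 h
  obtain ⟨t, ht, hU⟩ := om_iff.1 hz _ (hF.isOpen_compl.mem_nhds hn) N
  exact hU (hN t ht)

namespace DiscFlow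

variable {φ : ℝ → Disc → Disc} {V : ℂ → ℂ} {p : ℂ} (hF : DiscFlow φ V p)
include hF

lemma om_flow {y z : Disc} (h : Om φ y z) (s : ℝ) : Om φ y (φ s z) := by
  rw [om_iff] at h ⊢
  intro U hU N
  obtain ⟨t, ht, htU⟩ := h _ ((hF.cont_x s).continuousAt hU) (N - s)
  exact ⟨s + t, by linarith, by rw [← hF.add]; exact htU⟩

lemma om_orbit {y z : Disc} (h : Om φ y z) (s : ℝ) : Om φ (φ s y) z := by
  rw [om_iff] at h ⊢
  intro U hU N
  obtain ⟨t, ht, htU⟩ := h U hU (N + s)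
  exact ⟨t - s, by linarith, by rw [hF.add, sub_add_cancel]; exact htU⟩

lemma om_trans {x y z : Disc} (h : Om φ x y) (h' : Om φ y z) : Om φ x z := by
  rw [om_iff]
  intro U hU N
  obtain ⟨t, -, ht⟩ := om_iff.1 h' _ (interior_mem_nhds.2 hU) 0
  obtain ⟨s, hs, hsU⟩ := om_iff.1 (hF.om_flow h t) _ (isOpen_interior.mem_nhds ht) N
  exact ⟨s, hs, interior_subset hsU⟩

/-- Arbitrarily late hits of a cross section at a limit point. -/
lemma om_hit {y z : Disc} {d : ℂ} {R ρ : ℝ} (hB : Box V z d R) (hρ : 0 < ρ) (h : Om φ y z) (N : ℝ) :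
    ∃ t, N ≤ t ∧ (φ t y : ℂ) ∈ sec z d ρ := by
  obtain ⟨η, hη, hh⟩ := hF.exists_hit hB hρ
  obtain ⟨t, ht, htz⟩ := om_iff.1 h _ (ball_mem_nhds z hη) (N + ρ)
  obtain ⟨s, hs, hsec⟩ := hh (φ t y) htz
  refine ⟨s + t, ?_, by rw [← hF.add]; exact hsec⟩
  linarith [(abs_lt.1 hs).1]

lemma exists_cycle_near {x z : Disc} (hx : NonPer φ x) (hz : Om φ x z) (hV : V z ≠ 0) {ρ : ℝ}
    (hρ : 0 < ρ) : ∃ c t₀ t₁ km kp, IsCycle φ p x z ρ c t₀ t₁ km kp := by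
  obtain ⟨R, hB⟩ := hF.exists_box hV
  have hR := hB.pos
  obtain ⟨a, -, ha⟩ := hF.om_hit hB (lt_min hρ (half_pos hR)) hz 0
  obtain ⟨b, hab, hb⟩ := hF.om_hit hB (lt_min hρ (half_pos hR)) hz (a + 1)
  obtain ⟨c, t₁, km, kp, -, h⟩ := hF.exists_cycle hB
    (lt_of_le_of_lt (min_le_right _ _) (half_lt_self hR)) hx (by linarith) ha hb
  exact ⟨c, a, t₁, km, kp, { h with
    sub := fun s => (h.sub s).imp_right (le_trans · (min_le_left _ _)) }⟩

end DiscFlow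

section

variable {φ : ℝ → Disc → Disc} {p z : ℂ} {x : Disc} {ρ : ℝ} {c : ℝ → ℂ} {t₀ t₁ : ℝ} {km kp : ℤ}

lemma IsCycle.rev (h : IsCycle φ p x z ρ c t₀ t₁ km kp) :
    IsCycle (fun t => φ (-t)) p x z ρ c (-t₁) (-t₀) kp km where
  loop := h.loop
  mem := h.mem
  lt := neg_lt_neg h.lt
  sub s := (h.sub s).imp_left fun ⟨t, ht⟩ => ⟨-t, by rw [ht, neg_neg]⟩
  arc t ht := h.arc _ ⟨by linarith [ht.2], by linarith [ht.1]⟩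
  ne := h.ne.symm
  fwd t ht := h.bwd _ (by linarith)
  bwd t ht := h.fwd _ (by linarith)
  cross_fwd y hy a ha t ht := h.cross_bwd y (fun s hs => hy (-s) (by rwa [neg_neg])) _ ha _
      (by linarith)
  cross_bwd y hy a ha t ht := h.cross_fwd y (fun s hs => hy (-s) (by rwa [neg_neg])) _ ha _
      (by linarith)
  wp := h.wp

/-- A limit point off a loop has the eventual winding number of the orbit. -/
lemma Om.exists_wind (hc : IsLoop c) {y w : Disc} (h : Om φ y w) (hw : (w : ℂ) ∉ range c) (N : ℝ) :
    ∃ t, N ≤ t ∧ (φ t y : ℂ) ∉ range c ∧ wind c (φ t y) = wind c w := by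
  have h1 := (continuous_subtype_val.tendsto w).eventually (hc.eventually_wind_eq hw)
  exact om_iff.1 h _ h1 N

namespace DiscFlow

variable {V : ℂ → ℂ} (hF : DiscFlow φ V p)
include hF

omit hF in
lemma wind_orbit {c : ℝ → ℂ} (hc : IsLoop c) {γ : ℝ → ℂ} (hγ : Continuous γ)
    (h : ∀ t, γ t ∉ range c) (s t : ℝ) : wind c (γ s) = wind c (γ t) :=
  hc.wind_eq_of_preconnected (isPreconnected_range hγ) (by rintro _ ⟨u, rfl⟩; exact h u)
    (mem_range_self s) (mem_range_self t)

/-- Every orbit eventually has a constant winding number around a cycle. -/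
lemma eventually_wind (h : IsCycle φ p x z ρ c t₀ t₁ km kp) (y : Disc) :
    ∃ k N, ∀ t, N ≤ t → (φ t y : ℂ) ∉ range c ∧ wind c (φ t y) = k := by
  by_cases hy : ∀ t, y ≠ φ t x
  · by_cases hh : ∃ a, (φ a y : ℂ) ∈ range c
    · obtain ⟨a, ha⟩ := hh
      exact ⟨kp, a + 1, fun t ht => h.cross_fwd y hy a ha t (by linarith)⟩
    · push Not at hh
      exact ⟨wind c (φ 0 y), 0, fun t _ => ⟨hh t, wind_orbit h.loop (hF.contC y) hh t 0⟩⟩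
  · push Not at hy
    obtain ⟨s, rfl⟩ := hy
    exact ⟨kp, t₁ + 1 - s, fun t ht => by rw [hF.add]; exact h.fwd _ (by linarith)⟩

end DiscFlow

end

namespace DiscFlow

variable {φ : ℝ → Disc → Disc} {V : ℂ → ℂ}

theorem exists_singular {p : ℂ} (hF : DiscFlow φ V p) : ∃ q : Disc, (q : ℂ) = p ∧ V q = 0 := by
  by_contra! hcon
  have hV : ∀ x ∈ Disc, V x ≠ 0 := fun x hx => by
    by_cases h : x = p
    · exact hcon ⟨x, hx⟩ h
    · exact hF.V_ne x hx h
  have hF' : DiscFlow φ V 2 := { hF with V_ne := fun x hx _ => hV x hx }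
  have key : ∀ c, IsLoop c → (∀ s, c s ∈ Disc) → ((2 : ℂ) ∉ range c → wind c 2 ≠ 0) → False := by
    intro c hc hm hw
    have hm' : ∀ s, ‖c s‖ ≤ 1 := fun s => by simpa using hm s
    have h2 : (2 : ℂ) ∉ range c := by
      rintro ⟨s, hs⟩
      have := hm' s
      rw [hs] at this
      norm_num at this
    exact hw h2 (hc.wind_eq_zero h2 fun t => (hm' t).trans (by norm_num))
  set x : Disc := ⟨0, by simp⟩
  rcases hF'.nonPer_or x with hx | ⟨T, hT, hTx⟩
  · obtain ⟨z, hz⟩ := exists_om φ x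
    obtain ⟨c, t₀, t₁, km, kp, h⟩ := hF'.exists_cycle_near hx hz (hV z z.2) one_pos
    exact key c h.loop h.mem h.wp
  · obtain ⟨T, hT⟩ := hF'.exists_minPer (hV x x.2) hT hTx
    exact key _ (hF'.perCurve_loop hT) (fun s => (φ (s * T) x).2)
      (hF'.perCurve_wind hT (hV x x.2))

end DiscFlow

/-- A planar flow with a single singular point `P`. -/
structure OneFlow (φ : ℝ → Disc → Disc) (V : ℂ → ℂ) (P : Disc) : Prop where
  F : DiscFlow φ V P
  zero : V P = 0

namespace OneFlow

variable {φ : ℝ → Disc → Disc} {V : ℂ → ℂ} {P : Disc} (hO : OneFlow φ V P)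
include hO

lemma rev : OneFlow (fun t => φ (-t)) (fun x => -V x) P := ⟨hO.F.rev, by simp [hO.zero]⟩

lemma fix (t : ℝ) : φ t P = P := hO.F.singular_of_V_eq_zero hO.zero t

lemma ne {x : Disc} (h : x ≠ P) : V x ≠ 0 := hO.F.V_ne x x.2 fun h' => h (Subtype.ext h')

lemma orbit_ne {x : Disc} (h : x ≠ P) (t : ℝ) : φ t x ≠ P := fun h' =>
  h (hO.F.inj (h'.trans (hO.fix t).symm))

lemma ne_of_nonPer {x : Disc} (hx : NonPer φ x) : x ≠ P := fun h =>
  hO.F.nonPer_ne hx one_ne_zero (h ▸ hO.fix 1)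

/-- The singular point does not lie on a cycle. -/
lemma notMem_cycle {x : Disc} (hx : x ≠ P) {z : Disc} {ρ : ℝ} (hρ : ρ < dist z P) {c : ℝ → ℂ}
    {t₀ t₁ : ℝ} {km kp : ℤ} (h : IsCycle φ P x z ρ c t₀ t₁ km kp) : (P : ℂ) ∉ range c := by
  rintro ⟨s, hs⟩
  rcases h.sub s with ⟨t, ht⟩ | hd
  · exact hO.orbit_ne hx t (Subtype.ext (ht.symm.trans hs))
  · rw [hs, dist_comm] at hd
    exact absurd hd (not_le.2 hρ)

/-- If the singular point is both an `α`- and an `ω`-limit point then it is the only one. -/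
lemma om_eq {x : Disc} (hx : NonPer φ x) (h1 : Om φ x P) (h2 : Om (fun t => φ (-t)) x P) {z : Disc}
    (hz : Om φ x z) : z = P := by
  by_contra hne
  have hd : 0 < dist z P := dist_pos.2 hne
  obtain ⟨c, t₀, t₁, km, kp, h⟩ := hO.F.exists_cycle_near hx hz (hO.ne hne) (half_pos hd)
  have hP := hO.notMem_cycle (hO.ne_of_nonPer hx) (half_lt_self hd) h
  obtain ⟨t, ht, -, hw⟩ := h1.exists_wind h.loop hP (t₁ + 1)
  obtain ⟨s, hs, -, hw'⟩ := h2.exists_wind h.loop hP (-t₀ + 1)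
  rw [(h.fwd t (by linarith)).2] at hw
  rw [(h.bwd (-s) (by linarith)).2] at hw'
  exact h.ne (hw'.trans hw.symm)

/-- Limit points of an orbit that does not accumulate on the singular point are periodic. -/
lemma om_periodic {y z : Disc} (hy : ¬ Om φ y P) (hz : Om φ y z) : ∃ T > 0, φ T z = z := by
  rcases hO.F.nonPer_or z with h | h
  swap
  · exact h
  exfalso
  obtain ⟨w, hw⟩ := exists_om φ z
  have hwP : w ≠ P := fun e => hy (e ▸ hO.F.om_trans hz hw)
  obtain ⟨c, t₀, t₁, km, kp, hc⟩ := hO.F.exists_cycle_near h hw (hO.ne hwP) one_pos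
  obtain ⟨k, N, hk⟩ := hO.F.eventually_wind hc y
  have h1 := hc.fwd (t₁ + 1) (by linarith)
  have h2 := hc.bwd (t₀ - 1) (by linarith)
  obtain ⟨t, ht, -, e1⟩ := (hO.F.om_flow hz (t₁ + 1)).exists_wind hc.loop h1.1 N
  obtain ⟨s, hs, -, e2⟩ := (hO.F.om_flow hz (t₀ - 1)).exists_wind hc.loop h2.1 N
  rw [(hk t ht).2, h1.2] at e1
  rw [(hk s hs).2, h2.2] at e2
  exact hc.ne (e2.symm.trans e1)

/-- The singular point is isolated from other complete orbits. -/
lemma exists_isolated : ∃ r > 0, (∀ y : Disc, (∀ t, dist (φ t y) P ≤ r) → y = P) := by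
  obtain ⟨δ, hδ, h⟩ := hO.F.ke 1 one_pos
  refine ⟨δ / 2, half_pos hδ, fun y hy => ?_⟩
  obtain ⟨s, -, hs⟩ := h P y fun t => by
    rw [hO.fix, dist_comm]
    exact (hy t).trans_lt (half_lt_self hδ)
  rw [hs, hO.fix]

lemma tendsto_of_eventually_near {r : ℝ} (hr : ∀ y : Disc, (∀ t, dist (φ t y) P ≤ r) → y = P)
    {y : Disc} (h : ∀ᶠ t in atTop, dist (φ t y) P ≤ r) : Tendsto (fun t => φ t y) atTop (𝓝 P) :=
  tendsto_of_om fun z hz => hr z fun t =>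
    (hO.F.om_flow hz t).mem_of_closed (F := {w | dist w P ≤ r})
      (isClosed_le (continuous_id.dist continuous_const) continuous_const) h

end OneFlow

lemma exists_shift {W : Set Disc} (hW : IsOpen W) {y : Disc} (hy : y ∈ W) (hy1 : ‖(y : ℂ)‖ < 1)
    (v : ℂ) {r : ℝ} (hr : 0 < r) :
    ∃ y' ∈ W, ‖(y' : ℂ)‖ < 1 ∧ dist y' y < r ∧ ∃ ε : ℝ, 0 < ε ∧ (y' : ℂ) = y + ε * v := by
  obtain ⟨r', hr', hball⟩ := Metric.isOpen_iff.1 hW y hy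
  have h1 : 0 < min (min r r') (1 - ‖(y : ℂ)‖) := lt_min (lt_min hr hr') (by linarith)
  set m := min (min r r') (1 - ‖(y : ℂ)‖) with hm
  set ε := m / (‖v‖ + 1) with hε
  have hε0 : 0 < ε := by positivity
  have h2 : ‖(ε : ℂ) * v‖ < m := by
    rw [norm_mul, Complex.norm_real, Real.norm_eq_abs, abs_of_pos hε0, hε, div_mul_eq_mul_div,
      div_lt_iff₀ (by positivity)]
    nlinarith [norm_nonneg v]
  have hmr : m ≤ r := (min_le_left _ _).trans (min_le_left _ _)
  have hmr' : m ≤ r' := (min_le_left _ _).trans (min_le_right _ _)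
  have hm1 : m ≤ 1 - ‖(y : ℂ)‖ := min_le_right _ _
  have h3 : ‖(y : ℂ) + ε * v‖ < 1 := by
    have := norm_add_le (y : ℂ) (ε * v)
    linarith
  have h4 : dist (⟨(y : ℂ) + ε * v, by simpa using h3.le⟩ : Disc) y < m := by
    rw [Subtype.dist_eq, dist_eq_norm, add_sub_cancel_left]
    exact h2
  exact ⟨_, hball (h4.trans_le hmr'), h3, h4.trans_le hmr, ε, hε0, rfl⟩

lemma exists_norm_lt {W : Set Disc} (hW : IsOpen W) (hne : W.Nonempty) (P : Disc) :
    ∃ y ∈ W, ‖(y : ℂ)‖ < 1 ∧ y ≠ P := by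
  obtain ⟨x, hx⟩ := hne
  obtain ⟨y, hy, hy1⟩ : ∃ y ∈ W, ‖(y : ℂ)‖ < 1 := by
    obtain ⟨r, hr, hball⟩ := Metric.isOpen_iff.1 hW x hx
    have hx1 : ‖(x : ℂ)‖ ≤ 1 := mem_closedBall_zero_iff.1 x.2
    set ε := min (1 / 2) (r / 2) with hε
    have hε0 : 0 < ε := by positivity
    have hε1 : ε ≤ 1 / 2 := min_le_left _ _
    have hε2 : ε ≤ r / 2 := min_le_right _ _
    have h1 : ‖((1 - ε : ℝ) : ℂ) * x‖ < 1 := by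
      rw [norm_mul, Complex.norm_real, Real.norm_eq_abs, abs_of_pos (by linarith)]
      nlinarith [norm_nonneg (x : ℂ)]
    refine ⟨⟨((1 - ε : ℝ) : ℂ) * x, by simpa using h1.le⟩, hball ?_, h1⟩
    rw [mem_ball, Subtype.dist_eq, dist_eq_norm]
    have : ((1 - ε : ℝ) : ℂ) * x - x = ((-ε : ℝ) : ℂ) * x := by push_cast; ring
    rw [this, norm_mul, Complex.norm_real, Real.norm_eq_abs, abs_neg, abs_of_pos hε0]
    nlinarith [norm_nonneg (x : ℂ)]
  by_cases h : y = P
  · obtain ⟨y', h1, h2, -, ε, hε, h3⟩ := exists_shift hW hy hy1 1 one_pos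
    refine ⟨y', h1, h2, fun e => ?_⟩
    rw [e, h, mul_one, left_eq_add] at h3
    exact hε.ne' (by exact_mod_cast h3)
  · exact ⟨y, hy, hy1, h⟩

/-- A countable closed cover of an open set has a member with interior in that open set. -/
lemma exists_uniform {U : Set Disc} (hU : IsOpen U) (hne : U.Nonempty) (P : Disc) {A : ℕ → Set Disc}
    (hA : ∀ n, IsClosed (A n)) (hcov : ∀ y ∈ U, ∃ n, y ∈ A n) :
    ∃ n, ∃ W : Set Disc, IsOpen W ∧ W.Nonempty ∧ W ⊆ U ∧ W ⊆ A n ∧ ∀ y ∈ W,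
      ‖(y : ℂ)‖ < 1 ∧ y ≠ P := by
  have : CompactSpace Disc := isCompact_iff_compactSpace.1 (isCompact_closedBall _ _)
  have hd : Dense (⋃ n, interior (A n ∪ Uᶜ)) := by
    refine dense_iUnion_interior_of_closed (fun n => (hA n).union hU.isClosed_compl) ?_
    refine eq_univ_of_forall fun y => mem_iUnion.2 ?_
    by_cases hy : y ∈ U
    · obtain ⟨n, hn⟩ := hcov y hy
      exact ⟨n, Or.inl hn⟩
    · exact ⟨0, Or.inr hy⟩
  obtain ⟨y, hyU, hy⟩ := hd.inter_open_nonempty U hU hne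
  obtain ⟨n, hn⟩ := mem_iUnion.1 hy
  obtain ⟨w, hw, hw1, hwP⟩ := exists_norm_lt (hU.inter isOpen_interior) ⟨y, hyU, hn⟩ P
  refine ⟨n, U ∩ interior (A n ∪ Uᶜ) ∩ ({y : Disc | ‖(y : ℂ)‖ < 1} ∩ {P}ᶜ),
    (hU.inter isOpen_interior).inter ((isOpen_lt (by fun_prop) continuous_const).inter
      isOpen_compl_singleton), ⟨w, hw, hw1, hwP⟩, fun y hy => hy.1.1, fun y hy => ?_,
    fun y hy => hy.2⟩
  exact (interior_subset hy.1.2).resolve_right (not_not.2 hy.1.1)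

namespace DiscFlow

variable {φ : ℝ → Disc → Disc} {V : ℂ → ℂ} {p : ℂ} (hF : DiscFlow φ V p)
include hF

/-- Points of a transversal close to `y` are not on the orbit arc of `y` of times below `1`. -/
lemma transversal_sep {y : Disc} (hy : NonPer φ y) : ∃ r > 0, ∀ y' : Disc, dist y' y < r →
    ht y (V y) y' = 0 → y' ≠ y → ∀ s, |s| < 1 → y' ≠ φ s y := by
  have hV : V y ≠ 0 := by simpa only [hF.zero] using hF.V_ne_of_nonPer hy 0
  obtain ⟨R, hB⟩ := hF.exists_box hV
  obtain ⟨M, hM0, hM⟩ := hF.exists_bound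
  set κ := R / M with hκ
  have hκ0 : 0 < κ := div_pos hB.pos hM0
  have hMκ : M * κ = R := by rw [hκ]; field_simp
  have h0 : dist (φ 0 y : ℂ) y ≤ 0 := by rw [hF.zero, dist_self]
  have hK : IsClosed ((fun s => φ s y) '' {s | κ ≤ |s| ∧ |s| ≤ 1}) := by
    refine (IsCompact.image ?_ (hF.cont_t y)).isClosed
    refine (isCompact_Icc (a := (-1 : ℝ)) (b := 1)).of_isClosed_subset
      ((isClosed_le continuous_const continuous_abs).inter
        (isClosed_le continuous_abs continuous_const)) fun s hs => abs_le.1 hs.2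
  have hyK : y ∈ ((fun s => φ s y) '' {s | κ ≤ |s| ∧ |s| ≤ 1})ᶜ := by
    rintro ⟨s, hs, h⟩
    refine hF.nonPer_ne hy ?_ h
    rintro rfl
    have := hs.1
    rw [abs_zero] at this
    linarith
  obtain ⟨r, hr, hball⟩ := Metric.isOpen_iff.1 hK.isOpen_compl _ hyK
  refine ⟨r, hr, fun y' hd hh hne s hs h => ?_⟩
  rcases le_or_gt κ |s| with h1 | h1
  · exact hball hd ⟨s, ⟨h1, hs.le⟩, h.symm⟩
  · rcases lt_trichotomy s 0 with h2 | h2 | h2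
    · rw [abs_of_neg h2] at h1
      have := hF.ht_before (s := s) hB hM h0 h2.le (by nlinarith)
      rw [hF.zero, ht_self, ← h, hh] at this
      linarith
    · rw [h2, hF.zero] at h
      exact hne h
    · rw [abs_of_pos h2] at h1
      have := hF.ht_after (s := s) hB hM h0 h2.le (by nlinarith)
      rw [hF.zero, ht_self, ← h, hh] at this
      linarith

/-- Expansiveness: near every nonperiodic interior point some orbit gets uniformly far away. -/
lemma exists_far : ∃ δ > 0, ∀ y : Disc, NonPer φ y → ‖(y : ℂ)‖ < 1 → ∀ W : Set Disc, IsOpen W →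
    y ∈ W → ∃ y' ∈ W, ∃ t, δ ≤ dist (φ t y) (φ t y') := by
  obtain ⟨δ, hδ, h⟩ := hF.ke 1 one_pos
  refine ⟨δ, hδ, fun y hy hy1 W hW hyW => ?_⟩
  obtain ⟨r, hr, hsep⟩ := hF.transversal_sep hy
  have hV : V y ≠ 0 := by simpa only [hF.zero] using hF.V_ne_of_nonPer hy 0
  obtain ⟨y', hy', -, hd, ε, hε, he⟩ := exists_shift hW hyW hy1 (Complex.I * V y) hr
  refine ⟨y', hy', ?_⟩
  by_contra! hcon
  obtain ⟨s, hs, hsy⟩ := h y y' hcon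
  refine hsep y' hd ?_ ?_ s hs hsy
  · rw [he, ht_add, ht_self, ← mul_assoc, mul_div_cancel_right₀ _ hV, Complex.re_ofReal_mul,
      Complex.I_re, mul_zero, add_zero]
  · intro e
    rw [e, left_eq_add] at he
    have := mul_ne_zero (Complex.ofReal_ne_zero.2 hε.ne') (mul_ne_zero Complex.I_ne_zero hV)
    exact this he

end DiscFlow

namespace OneFlow

variable {φ : ℝ → Disc → Disc} {V : ℂ → ℂ} {P : Disc} (hO : OneFlow φ V P)
include hO

lemma nonPer_of_tendsto {y : Disc} (hy : y ≠ P) (h : Tendsto (fun t => φ (-t) y) atTop (𝓝 P)) :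
    NonPer φ y := by
  refine (hO.F.nonPer_or y).resolve_right fun ⟨T, hT, hTy⟩ => hy ?_
  have h1 : Function.Periodic (fun t => φ t y) T := fun t => by
    beta_reduce
    rw [← hO.F.add, hTy]
  have h2 : Tendsto (fun n : ℕ => φ (-(n * T)) y) atTop (𝓝 P) :=
    h.comp (tendsto_natCast_atTop_atTop.atTop_mul_const hT)
  have h3 : (fun n : ℕ => φ (-(n * T)) y) = fun _ => y := by
    funext n
    have := h1.int_mul (-n) 0
    simpa [hO.F.zero] using this
  rw [h3] at h2
  exact tendsto_nhds_unique tendsto_const_nhds h2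

/-- Homoclinic points have no interior. -/
theorem exists_not_homoclinic {U : Set Disc} (hU : IsOpen U) (hne : U.Nonempty) :
    ∃ y ∈ U, ¬ (Tendsto (fun t => φ t y) atTop (𝓝 P) ∧ Tendsto (fun t => φ (-t) y)
        atTop (𝓝 P)) := by
  by_contra! hcon
  obtain ⟨δ, hδ, hfar⟩ := hO.F.exists_far
  obtain ⟨n, W, hW, ⟨y, hy⟩, hWU, hWA, hW1⟩ := exists_uniform hU hne P
    (A := fun n : ℕ => {y | ∀ t : ℝ, (n : ℝ) ≤ |t| → dist (φ t y) P ≤ δ / 3})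
    (fun n => by
      have : {y | ∀ t : ℝ, (n : ℝ) ≤ |t| → dist (φ t y) P ≤ δ / 3} =
          ⋂ t : ℝ, ⋂ _ : (n : ℝ) ≤ |t|, {y | dist (φ t y) P ≤ δ / 3} := by
        ext y
        simp
      rw [this]
      exact isClosed_iInter fun t => isClosed_iInter fun _ =>
        isClosed_le ((hO.F.cont_x t).dist continuous_const) continuous_const)
    (fun y hy => by
      obtain ⟨h1, h2⟩ := hcon y hy
      obtain ⟨a, ha⟩ := eventually_atTop.1 (h1.eventually
          (closedBall_mem_nhds P (by positivity : 0 < δ / 3)))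
      obtain ⟨b, hb⟩ := eventually_atTop.1 (h2.eventually
          (closedBall_mem_nhds P (by positivity : 0 < δ / 3)))
      obtain ⟨n, hn⟩ := exists_nat_ge (max a b)
      refine ⟨n, fun t ht => ?_⟩
      rcases le_total 0 t with h0 | h0
      · rw [abs_of_nonneg h0] at ht
        exact ha t ((le_max_left a b).trans (hn.trans ht))
      · rw [abs_of_nonpos h0] at ht
        have := hb (-t) ((le_max_right a b).trans (hn.trans ht))
        rwa [neg_neg] at this)
  obtain ⟨K, hK, hlip⟩ := hO.F.lip n
  obtain ⟨y', hy', t, ht⟩ := hfar y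
    (hO.nonPer_of_tendsto (hW1 y hy).2 (hcon y (hWU hy)).2) (hW1 y hy).1 (W ∩ ball y (δ / K))
    (hW.inter isOpen_ball) ⟨hy, mem_ball_self (by positivity)⟩
  rcases le_or_gt (n : ℝ) |t| with h | h
  · have h1 := hWA hy t h
    have h2 := hWA hy'.1 t h
    have h3 := dist_triangle_right (φ t y) (φ t y') P
    linarith
  · have h1 := hlip t h.le y y'
    have h2 := mem_ball'.1 hy'.2
    rw [lt_div_iff₀ hK] at h2
    linarith

end OneFlow

/-- The coordinate of `q` along the line through `z` orthogonal to `d`. -/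
noncomputable def co (z d q : ℂ) : ℝ := ((q - z) / d).im

lemma abs_ht_sub_le {z d : ℂ} (q q' : ℂ) : |ht z d q - ht z d q'| ≤ dist q q' / ‖d‖ := by
  unfold ht
  rw [← Complex.sub_re, ← sub_div, sub_sub_sub_cancel_right, dist_eq_norm, ← norm_div]
  exact Complex.abs_re_le_norm _

lemma abs_co_sub_le {z d : ℂ} (q q' : ℂ) : |co z d q - co z d q'| ≤ dist q q' / ‖d‖ := by
  unfold co
  rw [← Complex.sub_im, ← sub_div, sub_sub_sub_cancel_right, dist_eq_norm, ← norm_div]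
  exact Complex.abs_im_le_norm _

lemma eq_of_ht_eq_zero {z d q : ℂ} (hd : d ≠ 0) (h : ht z d q = 0) :
    z + co z d q * (Complex.I * d) = q := by
  have h1 : (q - z) / d = co z d q * Complex.I := by
    apply Complex.ext
    · simpa [ht] using h
    · simp [co]
  rw [← mul_assoc, ← h1, div_mul_cancel₀ _ hd, add_sub_cancel]

lemma ht_line {z d : ℂ} (hd : d ≠ 0) (v : ℝ) : ht z d (z + v * (Complex.I * d)) = 0 := by
  rw [ht_add, ht_self, ← mul_assoc, mul_div_cancel_right₀ _ hd]
  simp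

lemma co_line {z d : ℂ} (hd : d ≠ 0) (v : ℝ) : co z d (z + v * (Complex.I * d)) = v := by
  rw [co, add_sub_cancel_left, ← mul_assoc, mul_div_cancel_right₀ _ hd]
  simp

open Classical in
/-- The point of the cross section at `z` orthogonal to `d` with coordinate `v`. -/
noncomputable def secPt (z : Disc) (d : ℂ) (v : ℝ) : Disc :=
  if h : (z : ℂ) + v * (Complex.I * d) ∈ Disc then ⟨_, h⟩ else z

/-- Coordinates up to `b` of points of the disc on the cross section. -/
def secCo (z : Disc) (d : ℂ) (b : ℝ) : Set ℝ :=
  {v | (z : ℂ) + v * (Complex.I * d) ∈ Disc} ∩ Icc (-b) b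

section

variable {z : Disc} {d : ℂ} {b : ℝ}

lemma coe_secPt {v : ℝ} (h : v ∈ secCo z d b) : (secPt z d v : ℂ) = z + v * (Complex.I * d) := by
  have h1 : (z : ℂ) + v * (Complex.I * d) ∈ Disc := h.1
  rw [secPt, dif_pos h1]

lemma secPt_co (hd : d ≠ 0) {q : Disc} (h : ht z d q = 0) : secPt z d (co z d q) = q := by
  have h1 := eq_of_ht_eq_zero hd h
  rw [secPt, dif_pos (by rw [h1]; exact q.2)]
  exact Subtype.ext h1

lemma co_mem_secCo (hd : d ≠ 0) {q : Disc} (h : ht z d q = 0) (hb : |co z d q| ≤ b) :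
    co z d q ∈ secCo z d b := by
  refine ⟨?_, abs_le.1 hb⟩
  change (z : ℂ) + co z d q * (Complex.I * d) ∈ Disc
  rw [eq_of_ht_eq_zero hd h]
  exact q.2

lemma secPt_zero (z : Disc) (d : ℂ) : secPt z d 0 = z := by
  rw [secPt]
  split_ifs
  · exact Subtype.ext (by simp)
  · rfl

lemma zero_mem_secCo (hb : 0 ≤ b) : 0 ∈ secCo z d b :=
  ⟨by simpa using mem_closedBall_zero_iff.1 z.2, by constructor <;> linarith⟩

lemma dist_secPt {v v' : ℝ} (h : v ∈ secCo z d b) (h' : v' ∈ secCo z d b) :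
    dist (secPt z d v) (secPt z d v') = ‖d‖ * |v - v'| := by
  rw [Subtype.dist_eq, coe_secPt h, coe_secPt h', dist_eq_norm, add_sub_add_left_eq_sub, ← sub_mul,
    norm_mul, norm_mul, Complex.norm_I, one_mul, ← Complex.ofReal_sub, Complex.norm_real,
    Real.norm_eq_abs, mul_comm]

lemma isCompact_secCo : IsCompact (secCo z d b) :=
  isCompact_Icc.inter_left ((isClosed_closedBall).preimage (by fun_prop))

lemma ordConnected_secCo : (secCo z d b).OrdConnected := by
  refine Convex.ordConnected (Convex.inter ?_ (convex_Icc _ _))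
  intro v hv v' hv' s t hs ht hst
  have := convex_closedBall (0 : ℂ) 1 hv hv' hs ht hst
  change (z : ℂ) + ((s • v + t • v' : ℝ) : ℂ) * (Complex.I * d) ∈ closedBall (0 : ℂ) 1
  convert this using 1
  obtain rfl : t = 1 - s := by linarith
  simp only [Complex.real_smul, smul_eq_mul]
  push_cast
  ring

end

/-- Projection along the flow onto the cross section: `s` is the transit time, `v` the coordinate of
the image. -/
structure Proj (φ : ℝ → Disc → Disc) (z : Disc) (d : ℂ) (η κ B : ℝ) (s v : Disc → ℝ) : Prop where
  ne : d ≠ 0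
  η_pos : 0 < η
  κ_pos : 0 < κ
  B_pos : 0 < B
  map : ∀ Q, dist Q z < η → φ (s Q) Q = secPt z d (v Q)
  mem : ∀ Q, dist Q z < η → ∀ b, |v Q| ≤ b → v Q ∈ secCo z d b
  s_lip : ∀ Q, dist Q z < η → ∀ Q', dist Q' z < η → |s Q - s Q'| ≤ B * dist Q Q'
  v_lip : ∀ Q, dist Q z < η → ∀ Q', dist Q' z < η → |v Q - v Q'| ≤ B * dist Q Q'
  unique : ∀ Q, dist Q z < η → ∀ a, |a| ≤ κ → ht z d (φ a Q) = 0 → a = s Q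
  s_line : ∀ Q, dist Q z < η → ht z d Q = 0 → s Q = 0
  v_line : ∀ Q, dist Q z < η → ht z d Q = 0 → v Q = co z d Q

theorem DiscFlow.exists_proj {φ : ℝ → Disc → Disc} {V : ℂ → ℂ} {p : ℂ} (hF : DiscFlow φ V p)
    {z : Disc} {d : ℂ} {R : ℝ} (hB : Box V z d R) :
    ∃ η κ B s v, Proj φ z d η κ B s v := by
  obtain ⟨M, hM0, hM⟩ := hF.exists_bound
  have hR := hB.pos
  have hd := norm_pos_iff.2 hB.ne
  set κ := R / (4 * M) with hκ
  have hκ0 : 0 < κ := by positivity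
  have hMκ : M * κ = R / 4 := by rw [hκ]; field_simp
  obtain ⟨K, hK, hlip⟩ := hF.lip κ
  obtain ⟨η₁, hη₁, hhit⟩ := hF.exists_hit hB hκ0
  set η := min η₁ (R / 4) with hη
  have hη0 : 0 < η := by positivity
  have hηR : η ≤ R / 4 := min_le_right _ _
  have key : ∀ Q Q' : Disc, dist Q z < η → dist Q' z < η → ∀ a b, |a| ≤ κ → |b| ≤ κ →
      ht z d (φ a Q) = 0 → ht z d (φ b Q') = 0 → |a - b| ≤ 2 * K / ‖d‖ * dist Q Q' := by
    intro Q Q' hQ hQ' a b ha hb h0 h0'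
    wlog hab : a ≤ b generalizing Q Q' a b
    · rw [abs_sub_comm, dist_comm]
      exact this Q' Q hQ' hQ b a hb ha h0' h0 (le_of_not_ge hab)
    have h1 := hF.ht_mono hB (x := Q') hab fun s hs => by
      refine hF.near_arc (a := 0) (ρ := η) hM (by rw [hF.zero]; exact hQ'.le) ?_
      have h2 : |s| ≤ κ := by
        rw [abs_le] at *
        exact ⟨by linarith [hs.1], by linarith [hs.2]⟩
      rw [sub_zero]
      nlinarith
    have h2 := abs_ht_sub_le (z := z) (d := d) (φ a Q) (φ a Q')
    rw [h0, zero_sub, abs_neg] at h2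
    have h3 : dist (φ a Q : ℂ) (φ a Q') ≤ K * dist Q Q' := hlip a ha Q Q'
    have h4 : dist (φ a Q : ℂ) (φ a Q') / ‖d‖ ≤ K * dist Q Q' / ‖d‖ := by gcongr
    have h5 := (abs_le.1 (h2.trans h4)).1
    rw [abs_of_nonpos (by linarith)]
    have h6 : 2 * K / ‖d‖ * dist Q Q' = 2 * (K * dist Q Q' / ‖d‖) := by ring
    rw [h6]
    linarith
  have hex : ∀ Q : Disc, ∃ s, dist Q z < η → |s| < κ ∧ ht z d (φ s Q) = 0 := fun Q => by
    by_cases hQ : dist Q z < η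
    · obtain ⟨s, hs, h⟩ := hhit Q (hQ.trans_le (min_le_left _ _))
      exact ⟨s, fun _ => ⟨hs, h.1⟩⟩
    · exact ⟨0, fun h => absurd h hQ⟩
  choose s hs using hex
  have hu : ∀ Q, dist Q z < η → ∀ a, |a| ≤ κ → ht z d (φ a Q) = 0 → a = s Q := by
    intro Q hQ a ha h
    have := key Q Q hQ hQ a (s Q) ha (hs Q hQ).1.le h (hs Q hQ).2
    rw [dist_self, mul_zero] at this
    exact sub_eq_zero.1 (abs_nonpos_iff.1 this)
  have hs0 : ∀ Q, dist Q z < η → ht z d Q = 0 → s Q = 0 := fun Q hQ h =>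
    (hu Q hQ 0 (by rw [abs_zero]; exact hκ0.le) (by rwa [hF.zero])).symm
  have hsl : ∀ Q, dist Q z < η → ∀ Q', dist Q' z < η → |s Q - s Q'| ≤ 2 * K / ‖d‖ * dist Q Q' :=
    fun Q hQ Q' hQ' => key Q Q' hQ hQ' _ _ (hs Q hQ).1.le (hs Q' hQ').1.le (hs Q hQ).2 (hs Q' hQ').2
  refine ⟨η, κ, max (2 * K / ‖d‖) ((K + M * (2 * K / ‖d‖)) / ‖d‖), s,
    fun Q => co z d (φ (s Q) Q), hB.ne, hη0, hκ0, lt_max_of_lt_left (by positivity),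
    fun Q hQ => (secPt_co hB.ne (hs Q hQ).2).symm, fun Q hQ b hb => co_mem_secCo hB.ne
      (hs Q hQ).2 hb,
    fun Q hQ Q' hQ' => (hsl Q hQ Q' hQ').trans
      (mul_le_mul_of_nonneg_right (le_max_left _ _) dist_nonneg), ?_, hu, hs0,
    fun Q hQ h => by rw [hs0 Q hQ h, hF.zero]⟩
  intro Q hQ Q' hQ'
  refine le_trans ?_ (mul_le_mul_of_nonneg_right (le_max_right _ _) dist_nonneg)
  refine (abs_co_sub_le _ _).trans ?_
  rw [div_mul_eq_mul_div]
  gcongr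
  have h1 : dist (φ (s Q) Q) (φ (s Q) Q') ≤ K * dist Q Q' := hlip _ (hs Q hQ).1.le Q Q'
  have h2 := hF.speed hM Q' (s Q) (s Q')
  have h3 := dist_triangle (φ (s Q) Q) (φ (s Q) Q') (φ (s Q') Q')
  have h4 := mul_le_mul_of_nonneg_left (hsl Q hQ Q' hQ') hM0.le
  rw [Subtype.dist_eq (φ (s Q) Q) (φ (s Q') Q')] at h3
  linarith

/-- A first return map `g` with return time `θ` near a periodic orbit, in the coordinate of a cross
section. -/
structure Ret (φ : ℝ → Disc → Disc) (z : Disc) (I : Set ℝ) (σ : ℝ → Disc) (g θ : ℝ → ℝ)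
    (b m B : ℝ) : Prop where
  ord : I.OrdConnected
  compact : IsCompact I
  zero_mem : (0 : ℝ) ∈ I
  b_pos : 0 < b
  m_pos : 0 < m
  B_pos : 0 < B
  σ_zero : σ 0 = z
  σ_dist : ∀ v ∈ I, ∀ v' ∈ I, dist (σ v) (σ v') ≤ B * |v - v'|
  step : ∀ v ∈ I, φ (θ v) (σ v) = σ (g v)
  θ_ge : ∀ v ∈ I, m ≤ θ v
  θ_le : ∀ v ∈ I, θ v ≤ B
  θ_lip : ∀ v ∈ I, ∀ v' ∈ I, |θ v - θ v'| ≤ B * |v - v'|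
  g_lip : ∀ v ∈ I, ∀ v' ∈ I, |g v - g v'| ≤ B * |v - v'|
  g_zero : g 0 = 0
  g_mem : ∀ v ∈ I, |g v| ≤ b → g v ∈ I
  inj : InjOn g I
  proj : ∃ η > 0, ∃ s w : Disc → ℝ, ∀ y, dist y z < η → w y ∈ I ∧ φ (s y) y = σ (w y) ∧
    (∀ y', dist y' z < η → |s y - s y'| ≤ B * dist y y' ∧ |w y - w y'| ≤ B * dist y y') ∧
    ∀ u ∈ I, dist (σ u) z < η → s (σ u) = 0 ∧ w (σ u) = u

theorem DiscFlow.exists_ret {φ : ℝ → Disc → Disc} {V : ℂ → ℂ} {p : ℂ} (hF : DiscFlow φ V p)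
    {z : Disc} (hV : V z ≠ 0) {T : ℝ} (hT : 0 < T) (hz : φ T z = z) :
    ∃ I σ g θ b m B, Ret φ z I σ g θ b m B := by
  obtain ⟨R, hBox⟩ := hF.exists_box hV
  obtain ⟨η, κ, B, s, v, hp⟩ := hF.exists_proj hBox
  have hη := hp.η_pos
  have hκ := hp.κ_pos
  have hB := hp.B_pos
  set d := V z with hdd
  have hd := norm_pos_iff.2 hp.ne
  obtain ⟨K, hK, hlip⟩ := hF.lip T
  set m := min (T / 2) (κ / 2) with hm
  have hm0 : 0 < m := by positivity
  have hmT : m ≤ T / 2 := min_le_left _ _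
  have hmκ : m ≤ κ / 2 := min_le_right _ _
  have hzη : dist z z < η := by rwa [dist_self]
  have hsz : s z = 0 := hp.s_line z hzη (ht_self _ _)
  have hvz : v z = 0 := by
    rw [hp.v_line z hzη (ht_self _ _)]
    simp [co]
  set r := min η (m / B) with hr
  have hr0 : 0 < r := by positivity
  have hrη : r ≤ η := min_le_left _ _
  have hrB : B * r ≤ m := by
    rw [← le_div_iff₀' hB]
    exact min_le_right _ _
  have hs_small : ∀ Q, dist Q z < r → |s Q| ≤ m := fun Q hQ => by
    have := hp.s_lip Q (hQ.trans_le hrη) z hzη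
    rw [hsz, sub_zero] at this
    nlinarith
  set b := min (r / (2 * ‖d‖)) (r / (2 * K * ‖d‖)) with hb
  have hb0 : 0 < b := by positivity
  have hb1 : ‖d‖ * b < r := by
    have : b ≤ r / (2 * ‖d‖) := min_le_left _ _
    rw [le_div_iff₀ (by positivity)] at this
    linarith
  have hb2 : K * (‖d‖ * b) < r := by
    have : b ≤ r / (2 * K * ‖d‖) := min_le_right _ _
    rw [le_div_iff₀ (by positivity)] at this
    linarith
  have hσz : ∀ u ∈ secCo z d b, dist (secPt z d u) z ≤ ‖d‖ * b := fun u hu => by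
    have := dist_secPt hu (zero_mem_secCo hb0.le)
    rw [secPt_zero, sub_zero] at this
    rw [this]
    gcongr
    exact abs_le.2 hu.2
  have hTz : ∀ u ∈ secCo z d b, dist (φ T (secPt z d u)) z < r := fun u hu => by
    have h1 := hlip T (abs_of_pos hT).le (secPt z d u) z
    rw [hz] at h1
    exact (h1.trans (mul_le_mul_of_nonneg_left (hσz u hu) hK.le)).trans_lt hb2
  have hTd : ∀ u ∈ secCo z d b, ∀ u' ∈ secCo z d b,
      dist (φ T (secPt z d u)) (φ T (secPt z d u')) ≤ K * ‖d‖ * |u - u'| := fun u hu u' hu' => by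
    have h1 := hlip T (abs_of_pos hT).le (secPt z d u) (secPt z d u')
    rwa [dist_secPt hu hu', ← mul_assoc] at h1
  have hline : ∀ u ∈ secCo z d b, ht z d (secPt z d u) = 0 := fun u hu => by
    rw [coe_secPt hu, ht_line hp.ne]
  have hstep : ∀ u ∈ secCo z d b, φ (T + s (φ T (secPt z d u))) (secPt z d u) =
      secPt z d (v (φ T (secPt z d u))) := fun u hu => by
    rw [← hp.map _ ((hTz u hu).trans_le hrη), hF.add, add_comm]
  set C := max (max B (B * (K * ‖d‖))) (max ‖d‖ (2 * T)) with hC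
  have hC1 : B ≤ C := (le_max_left _ _).trans (le_max_left _ _)
  have hC2 : B * (K * ‖d‖) ≤ C := (le_max_right _ _).trans (le_max_left _ _)
  have hC3 : ‖d‖ ≤ C := (le_max_left _ _).trans (le_max_right _ _)
  have hC4 : 2 * T ≤ C := (le_max_right _ _).trans (le_max_right _ _)
  refine ⟨secCo z d b, secPt z d, fun u => v (φ T (secPt z d u)),
    fun u => T + s (φ T (secPt z d u)), b, T / 2, C, ordConnected_secCo,
    isCompact_secCo, zero_mem_secCo hb0.le, hb0, half_pos hT, hB.trans_le hC1, secPt_zero z d,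
    fun u hu u' hu' => ?_, hstep, fun u hu => ?_, fun u hu => ?_, fun u hu u' hu' => ?_,
    fun u hu u' hu' => ?_, ?_, fun u hu h => ?_, fun u hu u' hu' h => ?_, ?_⟩
  · rw [dist_secPt hu hu']
    gcongr
  · have := (abs_le.1 (hs_small _ (hTz u hu))).1
    linarith
  · have := (abs_le.1 (hs_small _ (hTz u hu))).2
    linarith
  · rw [add_sub_add_left_eq_sub]
    have h1 := hp.s_lip _ ((hTz u hu).trans_le hrη) _ ((hTz u' hu').trans_le hrη)
    have h2 := mul_le_mul_of_nonneg_left (hTd u hu u' hu') hB.le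
    have h3 := mul_le_mul_of_nonneg_right hC2 (abs_nonneg (u - u'))
    linarith
  · have h1 := hp.v_lip _ ((hTz u hu).trans_le hrη) _ ((hTz u' hu').trans_le hrη)
    have h2 := mul_le_mul_of_nonneg_left (hTd u hu u' hu') hB.le
    have h3 := mul_le_mul_of_nonneg_right hC2 (abs_nonneg (u - u'))
    linarith
  · rw [secPt_zero, hz, hvz]
  · exact hp.mem _ ((hTz u hu).trans_le hrη) _ h
  · have h1 := hstep u hu
    have h2 := hstep u' hu'
    rw [h, ← h2] at h1
    set a := s (φ T (secPt z d u)) with ha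
    set a' := s (φ T (secPt z d u')) with ha'
    have h3 : φ (a - a') (secPt z d u) = secPt z d u' := by
      apply hF.inj (t := T + a')
      rw [hF.add, ← h1]
      congr 1
      ring
    have h4 := abs_le.1 (hs_small _ (hTz u hu))
    have h5 := abs_le.1 (hs_small _ (hTz u' hu'))
    have h6 : dist (secPt z d u) z < η := ((hσz u hu).trans_lt hb1).trans_le hrη
    have h7 := hp.unique _ h6 (a - a') (abs_le.2 ⟨by linarith [h4.1, h5.2],
      by linarith [h4.2, h5.1]⟩)
      (by rw [h3]; exact hline u' hu')
    rw [hp.s_line _ h6 (hline u hu)] at h7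
    rw [h7, hF.zero] at h3
    have h8 := dist_secPt hu hu'
    rw [h3, dist_self, eq_comm, mul_eq_zero] at h8
    exact sub_eq_zero.1 (abs_eq_zero.1 (h8.resolve_left hd.ne'))
  · refine ⟨min η (b / B), by positivity, s, v, fun y hy => ?_⟩
    have hyη : dist y z < η := hy.trans_le (min_le_left _ _)
    refine ⟨hp.mem y hyη b ?_, hp.map y hyη, fun y' hy' => ?_, fun u hu hσ => ?_⟩
    · have h1 := hp.v_lip y hyη z hzη
      rw [hvz, sub_zero] at h1
      have h2 : dist y z ≤ b / B := (hy.trans_le (min_le_right _ _)).le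
      rw [le_div_iff₀' hB] at h2
      exact h1.trans h2
    · have hyη' : dist y' z < η := hy'.trans_le (min_le_left _ _)
      exact ⟨(hp.s_lip y hyη y' hyη').trans (mul_le_mul_of_nonneg_right hC1 dist_nonneg),
        (hp.v_lip y hyη y' hyη').trans (mul_le_mul_of_nonneg_right hC1 dist_nonneg)⟩
    · have hση : dist (secPt z d u) z < η := hσ.trans_le (min_le_left _ _)
      refine ⟨hp.s_line _ hση (hline u hu), ?_⟩
      rw [hp.v_line _ hση (hline u hu), coe_secPt hu, co_line hp.ne]

namespace Ret

variable {φ : ℝ → Disc → Disc} {V : ℂ → ℂ} {p : ℂ} {z : Disc} {I : Set ℝ} {σ : ℝ → Disc}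
  {g θ : ℝ → ℝ} {b m B : ℝ}

/-- The first return map with the opposite orientation of the cross section. -/
lemma neg (h : Ret φ z I σ g θ b m B) :
    Ret φ z (Neg.neg ⁻¹' I) (fun v => σ (-v)) (fun v => -g (-v)) (fun v => θ (-v)) b m B where
  ord := h.ord.preimage_anti fun _ _ h => neg_le_neg h
  compact := (Homeomorph.neg ℝ).isCompact_preimage.2 h.compact
  zero_mem := by
    rw [mem_preimage, neg_zero]
    exact h.zero_mem
  b_pos := h.b_pos
  m_pos := h.m_pos
  B_pos := h.B_pos
  σ_zero := by rw [neg_zero, h.σ_zero]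
  σ_dist v hv v' hv' := by
    have := h.σ_dist (-v) hv (-v') hv'
    rwa [neg_sub_neg, abs_sub_comm] at this
  step v hv := by
    rw [neg_neg]
    exact h.step (-v) hv
  θ_ge v hv := h.θ_ge (-v) hv
  θ_le v hv := h.θ_le (-v) hv
  θ_lip v hv v' hv' := by
    have := h.θ_lip (-v) hv (-v') hv'
    rwa [neg_sub_neg, abs_sub_comm v'] at this
  g_lip v hv v' hv' := by
    have := h.g_lip (-v) hv (-v') hv'
    rwa [neg_sub_neg, abs_sub_comm v', abs_sub_comm, ← neg_sub_neg] at this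
  g_zero := by rw [neg_zero, h.g_zero, neg_zero]
  g_mem v hv hb := by
    rw [mem_preimage, neg_neg]
    exact h.g_mem (-v) hv (by rwa [abs_neg] at hb)
  inj v hv v' hv' he := neg_injective (h.inj hv hv' (neg_injective he))
  proj := by
    obtain ⟨η, hη, s, w, hp⟩ := h.proj
    refine ⟨η, hη, s, fun y => -w y, fun y hy => ?_⟩
    obtain ⟨h1, h2, h3, h4⟩ := hp y hy
    refine ⟨by rwa [mem_preimage, neg_neg], by rwa [neg_neg], fun y' hy' => ?_, fun u hu hd => ?_⟩
    · rw [neg_sub_neg, abs_sub_comm (w y')]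
      exact h3 y' hy'
    · obtain ⟨h5, h6⟩ := h4 (-u) hu hd
      exact ⟨h5, neg_eq_iff_eq_neg.2 h6⟩

lemma abs_g_le (h : Ret φ z I σ g θ b m B) {v : ℝ} (hv : v ∈ I) : |g v| ≤ B * |v| := by
  simpa [h.g_zero] using h.g_lip v hv 0 h.zero_mem

/-- The second iterate of a first return map. -/
lemma comp (hF : DiscFlow φ V p) (h : Ret φ z I σ g θ b m B) :
    ∃ b' B', b' ≤ b ∧ (∀ v ∈ I ∩ Icc (-b') b', g v ∈ I) ∧
      Ret φ z (I ∩ Icc (-b') b') σ (fun v => g (g v)) (fun v => θ v + θ (g v)) b' m B' := by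
  have hB := h.B_pos
  have hb := h.b_pos
  have hm := h.m_pos
  set b' := min b (b / B) with hb'
  have hb0 : 0 < b' := by positivity
  have hbb : b' ≤ b := min_le_left _ _
  have hbB : B * b' ≤ b := by
    rw [← le_div_iff₀' hB]
    exact min_le_right _ _
  have hgI : ∀ v ∈ I ∩ Icc (-b') b', g v ∈ I := fun v hv => by
    refine h.g_mem v hv.1 ((h.abs_g_le hv.1).trans (le_trans ?_ hbB))
    have := abs_le.2 hv.2
    gcongr
  have hBB : 0 ≤ B * B := by positivity
  refine ⟨b', 2 * B + B * B, hbb, hgI, h.ord.inter ordConnected_Icc,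
    h.compact.inter_right isClosed_Icc, ⟨h.zero_mem, by constructor <;> linarith⟩, hb0, hm,
    by positivity, h.σ_zero, fun v hv v' hv' => ?_, fun v hv => ?_, fun v hv => ?_, fun v hv => ?_,
    fun v hv v' hv' => ?_, fun v hv v' hv' => ?_, ?_, fun v hv hb => ?_, fun v hv v' hv' he => ?_,
    ?_⟩
  · refine (h.σ_dist v hv.1 v' hv'.1).trans ?_
    gcongr
    linarith
  · rw [add_comm, ← hF.add, h.step v hv.1, h.step _ (hgI v hv)]
  · have h1 := h.θ_ge v hv.1
    have h2 := h.θ_ge _ (hgI v hv)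
    linarith
  · have h1 := h.θ_le v hv.1
    have h2 := h.θ_le _ (hgI v hv)
    linarith
  · have h1 := h.θ_lip v hv.1 v' hv'.1
    have h2 := h.θ_lip _ (hgI v hv) _ (hgI v' hv')
    have h3 := mul_le_mul_of_nonneg_left (h.g_lip v hv.1 v' hv'.1) hB.le
    have h4 := abs_add_le (θ v - θ v') (θ (g v) - θ (g v'))
    have h5 := mul_nonneg hB.le (abs_nonneg (v - v'))
    rw [add_sub_add_comm]
    linarith
  · have h2 := h.g_lip _ (hgI v hv) _ (hgI v' hv')
    have h3 := mul_le_mul_of_nonneg_left (h.g_lip v hv.1 v' hv'.1) hB.le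
    have h5 := mul_nonneg hB.le (abs_nonneg (v - v'))
    linarith
  · rw [h.g_zero, h.g_zero]
  · exact ⟨h.g_mem _ (hgI v hv) (hb.trans hbb), abs_le.1 hb⟩
  · exact h.inj hv.1 hv'.1 (h.inj (hgI v hv) (hgI v' hv') he)
  · obtain ⟨η, hη, s, w, hp⟩ := h.proj
    have hzη : dist z z < η := by rwa [dist_self]
    have hwz : w z = 0 := by
      have := ((hp z hzη).2.2.2 0 h.zero_mem (by rwa [h.σ_zero])).2
      rwa [h.σ_zero] at this
    refine ⟨min η (b' / B), by positivity, s, w, fun y hy => ?_⟩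
    obtain ⟨h1, h2, h3, h4⟩ := hp y (hy.trans_le (min_le_left _ _))
    refine ⟨⟨h1, abs_le.1 ?_⟩, h2, fun y' hy' => ?_, fun u hu hd =>
      h4 u hu.1 (hd.trans_le (min_le_left _ _))⟩
    · have h5 := (h3 z hzη).2
      rw [hwz, sub_zero] at h5
      have h6 := (hy.trans_le (min_le_right _ _)).le
      rw [le_div_iff₀' hB] at h6
      exact h5.trans h6
    · have h5 := h3 y' (hy'.trans_le (min_le_left _ _))
      have h6 : B * dist y y' ≤ (2 * B + B * B) * dist y y' := by
        gcongr
        linarith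
      exact ⟨h5.1.trans h6, h5.2.trans h6⟩

lemma continuousOn (h : Ret φ z I σ g θ b m B) : ContinuousOn g I :=
  LipschitzOnWith.continuousOn (K := ⟨B, h.B_pos.le⟩) <| LipschitzOnWith.of_dist_le_mul
    fun v hv v' hv' => h.g_lip v hv v' hv'

lemma exists_strictMonoOn (hF : DiscFlow φ V p) (h : Ret φ z I σ g θ b m B) :
    ∃ I g θ b B, Ret φ z I σ g θ b m B ∧ StrictMonoOn g I := by
  have hne : I.Nonempty := ⟨0, h.zero_mem⟩
  have hI := eq_Icc_of_connected_compact ⟨hne, h.ord.isPreconnected⟩ h.compact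
  have hle : sInf I ≤ sSup I := csInf_le_csSup hne h.compact.bddBelow h.compact.bddAbove
  have hc := h.continuousOn
  have hi := h.inj
  rw [hI] at hc hi
  rcases hc.strictMonoOn_of_injOn_Icc' hle hi with hm | ha
  · rw [← hI] at hm
    exact ⟨I, g, θ, b, B, h, hm⟩
  · rw [← hI] at ha
    obtain ⟨b', B', -, hgI, h'⟩ := h.comp hF
    exact ⟨_, _, _, b', B', h', fun v hv v' hv' hlt =>
      ha (hgI v' hv') (hgI v hv) (ha hv.1 hv'.1 hlt)⟩

lemma exists_preimage (hF : DiscFlow φ V p) (h : Ret φ z I σ g θ b m B) {v₀ : ℝ}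
    (hv₀ : v₀ ∈ I) (h0 : 0 < v₀) (hg : v₀ ≤ g v₀) (n : ℕ) :
    ∃ v t, 0 < v ∧ v ≤ v₀ ∧ v ≤ g v ∧ n * m ≤ t ∧ φ t (σ v) = σ v₀ := by
  induction n with
  | zero => exact ⟨v₀, 0, h0, le_rfl, hg, by simp, hF.zero _⟩
  | succ n ih =>
    obtain ⟨v, t, hv0, hvv, hvg, ht, he⟩ := ih
    have hsub : Icc 0 v ⊆ I := (Icc_subset_Icc_right hvv).trans (h.ord.out h.zero_mem hv₀)
    obtain ⟨u, hu, rfl⟩ := intermediate_value_Icc hv0.le (h.continuousOn.mono hsub)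
      ⟨by rw [h.g_zero]; exact hv0.le, hvg⟩
    have hu0 : u ≠ 0 := fun e => by
      rw [e, h.g_zero] at hv0
      exact hv0.false
    refine ⟨u, t + θ u, lt_of_le_of_ne hu.1 hu0.symm, hu.2.trans hvv, hu.2, ?_, ?_⟩
    · have := h.θ_ge u (hsub hu)
      push_cast
      linarith
    · rw [← hF.add, h.step u (hsub hu), he]

lemma g_lt (hF : DiscFlow φ V p) (h : Ret φ z I σ g θ b m B) {P : Disc} {v₀ : ℝ} (hv₀ : v₀ ∈ I)
    (h0 : 0 < v₀) (hP : B * v₀ < dist z P / 2)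
    (hlim : Tendsto (fun t => φ (-t) (σ v₀)) atTop (𝓝 P)) : g v₀ < v₀ := by
  by_contra! hg
  have hd : 0 < dist z P / 2 := (mul_pos h.B_pos h0).trans hP
  obtain ⟨N, hN⟩ := eventually_atTop.1 (hlim.eventually (ball_mem_nhds P hd))
  obtain ⟨n, hn⟩ := exists_nat_ge (N / m)
  rw [div_le_iff₀ h.m_pos] at hn
  obtain ⟨v, t, hv0, hv, -, ht, he⟩ := h.exists_preimage hF hv₀ h0 hg n
  have h1 : dist (φ (-t) (σ v₀)) P < dist z P / 2 := hN t (hn.trans ht)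
  rw [← he, hF.neg_cancel] at h1
  have h2 := h.σ_dist v (h.ord.out h.zero_mem hv₀ ⟨hv0.le, hv⟩) 0 h.zero_mem
  rw [h.σ_zero, sub_zero, abs_of_pos hv0] at h2
  have h3 := mul_le_mul_of_nonneg_left hv h.B_pos.le
  have h4 := dist_triangle_left z P (σ v)
  linarith

/-- Forward orbits starting between two consecutive returns of an orbit approaching the cycle stay
close to each other. -/
lemma dist_le (hF : DiscFlow φ V p) (h : Ret φ z I σ g θ b m B) (hmono : StrictMonoOn g I)
    {K M : ℝ} (hK0 : 0 < K) (hK : ∀ t, |t| ≤ B → ∀ x y, dist (φ t x) (φ t y) ≤ K * dist x y)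
    (hM0 : 0 < M) (hM : ∀ x s t, dist (φ s x) (φ t x) ≤ M * |s - t|) {u : ℝ} (n : ℕ) :
    ∀ a, 0 < a → a ≤ u → a ∈ I → g a ≤ a → ∀ c ∈ Icc (g (g a)) a, ∀ c' ∈ Icc (g (g a)) a,
      ∀ t, 0 ≤ t → t ≤ n * m → ∀ Δ,
        dist (φ t (σ c)) (φ (t + Δ) (σ c')) ≤ K * (B * u) + M * (|Δ| + B * (a + g a)) := by
  have hB := h.B_pos
  have hm := h.m_pos
  have hpos : ∀ a, 0 < a → a ∈ I → 0 < g a := fun a ha haI => by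
    have := hmono h.zero_mem haI ha
    rwa [h.g_zero] at this
  have hmem : ∀ a, 0 < a → a ∈ I → g a ≤ a → Icc (g (g a)) a ⊆ I := fun a ha haI hga => by
    have h1 : g a ∈ I := h.ord.out h.zero_mem haI ⟨(hpos a ha haI).le, hga⟩
    exact fun x hx => h.ord.out h.zero_mem haI ⟨(hpos _ (hpos a ha haI) h1).le.trans hx.1, hx.2⟩
  have hsmall : ∀ a, 0 < a → a ≤ u → a ∈ I → g a ≤ a → ∀ c ∈ Icc (g (g a)) a,
      ∀ c' ∈ Icc (g (g a)) a, ∀ t, 0 ≤ t → t ≤ θ c → ∀ Δ,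
        dist (φ t (σ c)) (φ (t + Δ) (σ c')) ≤ K * (B * u) + M * (|Δ| + B * (a + g a)) := by
    intro a ha hau haI hga c hc c' hc' t ht htθ Δ
    have hsub := hmem a ha haI hga
    have hga0 := hpos a ha haI
    have hgga0 := hpos _ hga0 (h.ord.out h.zero_mem haI ⟨hga0.le, hga⟩)
    have h1 : |c - c'| ≤ u := abs_le.2 ⟨by linarith [hc.1, hc'.2], by linarith [hc.2, hc'.1]⟩
    have h2 := h.σ_dist c (hsub hc) c' (hsub hc')
    have h3 := hK t (by rw [abs_of_nonneg ht]; exact htθ.trans (h.θ_le c (hsub hc))) (σ c) (σ c')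
    have h4 : K * dist (σ c) (σ c') ≤ K * (B * u) := by
      refine mul_le_mul_of_nonneg_left (h2.trans ?_) hK0.le
      gcongr
    have h5 := hM (σ c') t (t + Δ)
    rw [sub_add_cancel_left, abs_neg] at h5
    have h6 := dist_triangle (φ t (σ c)) (φ t (σ c')) (φ (t + Δ) (σ c'))
    have h7 : 0 ≤ M * (B * (a + g a)) := by positivity
    linarith
  induction n with
  | zero =>
    intro a ha hau haI hga c hc c' hc' t ht ht' Δ
    refine hsmall a ha hau haI hga c hc c' hc' t ht ?_ Δ
    have := h.θ_ge c (hmem a ha haI hga hc)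
    rw [Nat.cast_zero, zero_mul] at ht'
    linarith
  | succ n ih =>
    intro a ha hau haI hga c hc c' hc' t ht ht' Δ
    rcases le_or_gt t (θ c) with htθ | htθ
    · exact hsmall a ha hau haI hga c hc c' hc' t ht htθ Δ
    · have hsub := hmem a ha haI hga
      have hga0 := hpos a ha haI
      have hgaI := h.ord.out h.zero_mem haI ⟨hga0.le, hga⟩
      have hgga : g (g a) ≤ g a := hmono.monotoneOn hgaI haI hga
      have hggaI : g (g a) ∈ I := h.ord.out h.zero_mem haI ⟨(hpos _ hga0 hgaI).le, hgga.trans hga⟩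
      have hgc : ∀ c ∈ Icc (g (g a)) a, g c ∈ Icc (g (g (g a))) (g a) := fun c hc =>
        ⟨hmono.monotoneOn hggaI (hsub hc) hc.1, hmono.monotoneOn (hsub hc) haI hc.2⟩
      have h1 := ih (g a) hga0 (hga.trans hau) hgaI hgga (g c) (hgc c hc) (g c') (hgc c' hc')
        (t - θ c) (by linarith)
        (by
          have := h.θ_ge c (hsub hc)
          push_cast at ht'
          linarith) (Δ + (θ c - θ c'))
      have h2 : t - θ c + (Δ + (θ c - θ c')) = t + Δ - θ c' := by ring
      rw [h2, ← h.step c (hsub hc), ← h.step c' (hsub hc'), hF.add, hF.add, sub_add_cancel,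
        sub_add_cancel] at h1
      have h3 := h.θ_lip c (hsub hc) c' (hsub hc')
      have h4 : |c - c'| ≤ a - g (g a) :=
        abs_le.2 ⟨by linarith [hc.1, hc'.2], by linarith [hc.2, hc'.1]⟩
      have h5 := mul_le_mul_of_nonneg_left h4 hB.le
      have h6 := abs_add_le Δ (θ c - θ c')
      have h7 : M * (|Δ + (θ c - θ c')| + B * (g a + g (g a))) ≤ M * (|Δ| + B * (a + g a)) := by
        gcongr M * ?_
        linarith
      linarith

/-- An orbit spiralling to the cycle from the side of positive coordinates is stable. -/
lemma exists_stable_of_pos (hF : DiscFlow φ V p) (h : Ret φ z I σ g θ b m B)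
    (hmono : StrictMonoOn g I) {P : Disc} (hz : z ≠ P) {δ : ℝ} (hδ : 0 < δ) :
    ∃ ρ > 0, ∀ v₀ ∈ I, 0 < v₀ → v₀ < ρ → Tendsto (fun t => φ (-t) (σ v₀)) atTop (𝓝 P) →
      ∃ t₂, ∃ r > 0, ∀ y', dist y' (φ t₂ (σ v₀)) < r → ∀ t, 0 ≤ t →
        dist (φ t (φ t₂ (σ v₀))) (φ t y') < δ := by
  have hB := h.B_pos
  have hm := h.m_pos
  have hzP := dist_pos.2 hz
  obtain ⟨M, hM0, hM⟩ := hF.exists_bound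
  obtain ⟨K, hK0, hK⟩ := hF.lip B
  obtain ⟨η, hη, s, w, hp⟩ := h.proj
  refine ⟨min (δ / (2 * (K * B + 2 * M * B))) (min (η / (2 * B)) (dist z P / (2 * B))),
    by positivity, fun v₀ hv₀ h0 hv hlim => ?_⟩
  obtain ⟨h1, h2, h3⟩ : v₀ < _ ∧ v₀ < _ ∧ v₀ < _ := by simpa only [lt_min_iff] using hv
  rw [lt_div_iff₀ (by positivity)] at h1 h2 h3
  have hg := h.g_lt hF hv₀ h0 (by linarith) hlim
  have hg0 : 0 < g v₀ := by
    have := hmono h.zero_mem hv₀ h0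
    rwa [h.g_zero] at this
  have hgI := h.ord.out h.zero_mem hv₀ ⟨hg0.le, hg.le⟩
  have hgg : g (g v₀) < g v₀ := hmono hgI hv₀ hg
  have h4 := h.σ_dist _ hgI 0 h.zero_mem
  rw [h.σ_zero, sub_zero, abs_of_pos hg0] at h4
  have h5 : dist (σ (g v₀)) z < η / 2 := by
    have := mul_lt_mul_of_pos_left hg hB
    linarith
  obtain ⟨-, -, hlip, hu⟩ := hp (σ (g v₀)) (by linarith)
  obtain ⟨hs0, hw0⟩ := hu _ hgI (by linarith)
  refine ⟨θ v₀, min (min (η / 2) (δ / (2 * (M * B))))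
      (min ((v₀ - g v₀) / B) ((g v₀ - g (g v₀)) / B)),
    ?_, ?_⟩
  · have h6 : 0 < v₀ - g v₀ := by linarith
    have h7 : 0 < g v₀ - g (g v₀) := by linarith
    positivity
  rw [h.step v₀ hv₀]
  intro y' hy' t ht
  obtain ⟨⟨h6, h7⟩, h8, h9⟩ : (dist y' _ < _ ∧ dist y' _ < _) ∧ dist y' _ < _ ∧ dist y' _ < _ := by
    simpa only [lt_min_iff] using hy'
  rw [lt_div_iff₀ (by positivity)] at h7 h8 h9
  have hyz : dist y' z < η := by
    have := dist_triangle y' (σ (g v₀)) z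
    linarith
  obtain ⟨h10, h11⟩ := hlip y' hyz
  rw [hs0, zero_sub, abs_neg, dist_comm] at h10
  rw [hw0, dist_comm, abs_le] at h11
  obtain ⟨n, hn⟩ := exists_nat_ge (t / m)
  rw [div_le_iff₀ hm] at hn
  have h12 := h.dist_le hF hmono hK0 hK hM0 (hF.speed hM) n v₀ h0 le_rfl hv₀ hg.le (g v₀)
    ⟨hgg.le, hg.le⟩ (w y') ⟨by linarith, by linarith⟩ t ht hn (-s y')
  rw [← (hp y' hyz).2.1, hF.add, neg_add_cancel_right, abs_neg] at h12
  have h13 := mul_le_mul_of_nonneg_left h10 hM0.le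
  have h14 := mul_lt_mul_of_pos_left hg (mul_pos hM0 hB)
  linarith

lemma exists_stable (hF : DiscFlow φ V p) (h : Ret φ z I σ g θ b m B)
    (hmono : StrictMonoOn g I) {P : Disc} (hz : z ≠ P) {δ : ℝ} (hδ : 0 < δ) :
    ∃ ρ > 0, ∀ v₀ ∈ I, v₀ ≠ 0 → |v₀| < ρ → Tendsto (fun t => φ (-t) (σ v₀)) atTop (𝓝 P) →
      ∃ t₂, ∃ r > 0, ∀ y', dist y' (φ t₂ (σ v₀)) < r → ∀ t, 0 ≤ t →
        dist (φ t (φ t₂ (σ v₀))) (φ t y') < δ := by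
  obtain ⟨ρ, hρ, h1⟩ := h.exists_stable_of_pos hF hmono hz hδ
  obtain ⟨ρ', hρ', h2⟩ := h.neg.exists_stable_of_pos hF
    (fun v hv v' hv' hlt => neg_lt_neg (hmono hv' hv (neg_lt_neg hlt))) hz hδ
  refine ⟨min ρ ρ', lt_min hρ hρ', fun v₀ hv₀ h0 hv hlim => ?_⟩
  rcases h0.lt_or_gt with hn | hpos
  · have := h2 (-v₀) (by rwa [mem_preimage, neg_neg]) (neg_pos.2 hn)
      (by rw [← abs_of_neg hn]; exact hv.trans_le (min_le_right _ _))
    rw [neg_neg] at this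
    exact this hlim
  · exact h1 v₀ hv₀ hpos (by rw [← abs_of_pos hpos]; exact hv.trans_le (min_le_left _ _)) hlim

end Ret

namespace OneFlow

variable {φ : ℝ → Disc → Disc} {V : ℂ → ℂ} {P : Disc} (hO : OneFlow φ V P)
include hO

lemma not_om_of_not_tendsto {y : Disc} (hy : y ≠ P) (h : Tendsto (fun t => φ (-t) y) atTop (𝓝 P))
    (hn : ¬ Tendsto (fun t => φ t y) atTop (𝓝 P)) : ¬ Om φ y P := fun ho =>
  hn (tendsto_of_om fun _ hz => hO.om_eq (hO.nonPer_of_tendsto hy h) ho (om_of_tendsto h) hz)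

/-- The unstable set of the singular point has empty interior. -/
theorem exists_not_tendsto_neg {U : Set Disc} (hU : IsOpen U) (hne : U.Nonempty) :
    ∃ y ∈ U, ¬ Tendsto (fun t => φ (-t) y) atTop (𝓝 P) := by
  by_contra! hcon
  have hF := hO.F
  obtain ⟨δ, hδ, hfar⟩ := hF.exists_far
  obtain ⟨n, W, hW, hWne, hWU, hWA, hW1⟩ := exists_uniform hU hne P
    (A := fun n : ℕ => {y | ∀ t : ℝ, (n : ℝ) ≤ t → dist (φ (-t) y) P ≤ δ / 3})
    (fun n => by
      have : {y | ∀ t : ℝ, (n : ℝ) ≤ t → dist (φ (-t) y) P ≤ δ / 3} =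
          ⋂ t : ℝ, ⋂ _ : (n : ℝ) ≤ t, {y | dist (φ (-t) y) P ≤ δ / 3} := by
        ext y
        simp
      rw [this]
      exact isClosed_iInter fun t => isClosed_iInter fun _ =>
        isClosed_le ((hF.cont_x (-t)).dist continuous_const) continuous_const)
    (fun y hy => by
      obtain ⟨N, hN⟩ := eventually_atTop.1
        ((hcon y hy).eventually (closedBall_mem_nhds P (by positivity : 0 < δ / 3)))
      obtain ⟨n, hn⟩ := exists_nat_ge N
      exact ⟨n, fun t ht => hN t (hn.trans ht)⟩)
  obtain ⟨y₀, hy₀, hnh⟩ := hO.exists_not_homoclinic hW hWne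
  obtain ⟨hy1, hyP⟩ := hW1 y₀ hy₀
  have hlim := hcon y₀ (hWU hy₀)
  have hnp := hO.nonPer_of_tendsto hyP hlim
  have hom := hO.not_om_of_not_tendsto hyP hlim fun h => hnh ⟨h, hlim⟩
  obtain ⟨z, hz⟩ := exists_om φ y₀
  have hzP : z ≠ P := fun e => hom (e ▸ hz)
  obtain ⟨T, hT, hTz⟩ := hO.om_periodic hom hz
  obtain ⟨I, σ, g, θ, b, m, B, hr⟩ := hF.exists_ret (hO.ne hzP) hT hTz
  obtain ⟨I, g, θ, b, B, h, hmono⟩ := hr.exists_strictMonoOn hF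
  obtain ⟨ρ, hρ, hst⟩ := h.exists_stable hF hmono hzP hδ
  obtain ⟨η, hη, s, w, hp⟩ := h.proj
  have hB := h.B_pos
  obtain ⟨t₁, -, ht₁⟩ := om_iff.1 hz _ (ball_mem_nhds z (by positivity : 0 < min η (ρ / B))) 0
  have hy₁ : dist (φ t₁ y₀) z < min η (ρ / B) := ht₁
  have hy₁η := hy₁.trans_le (min_le_left _ _)
  have hzη : dist z z < η := by rwa [dist_self]
  have hwz : w z = 0 := by
    have := ((hp z hzη).2.2.2 0 h.zero_mem (by rwa [h.σ_zero])).2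
    rwa [h.σ_zero] at this
  obtain ⟨hwI, hσ, hlip, -⟩ := hp _ hy₁η
  have hwρ : |w (φ t₁ y₀)| < ρ := by
    have h1 := (hlip z hzη).2
    rw [hwz, sub_zero] at h1
    have h2 := hy₁.trans_le (min_le_right _ _)
    rw [lt_div_iff₀' hB] at h2
    exact h1.trans_lt h2
  rw [hF.add] at hσ
  set a := s (φ t₁ y₀) + t₁ with ha
  set v₀ := w (φ t₁ y₀) with hv₀
  have hv0 : v₀ ≠ 0 := fun e => by
    rw [e, h.σ_zero] at hσ
    rw [← hσ, hF.add] at hTz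
    have := hnp hTz
    linarith
  obtain ⟨t₂, r, hr0, hst⟩ := hst v₀ hwI hv0 hwρ (by
    rw [← hσ]
    have h1 := hlim.comp (tendsto_atTop_add_const_right atTop (-a) tendsto_id)
    refine h1.congr fun t => ?_
    rw [hF.add, Function.comp_apply, id, neg_add, neg_neg])
  rw [← hσ, hF.add] at hst
  set t₃ := t₂ + a with ht₃
  obtain ⟨K, hK, hKlip⟩ := hF.lip (max n |t₃|)
  obtain ⟨y', ⟨⟨hy'W, hy'b⟩, hy'r⟩, t, ht⟩ := hfar y₀ hnp hy1
    ((W ∩ ball y₀ (δ / K)) ∩ φ t₃ ⁻¹' ball (φ t₃ y₀) r)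
    ((hW.inter isOpen_ball).inter (isOpen_ball.preimage (hF.cont_x t₃)))
    ⟨⟨hy₀, mem_ball_self (by positivity)⟩, mem_ball_self hr0⟩
  rcases le_or_gt t₃ t with h1 | h1
  · have h2 := hst _ hy'r (t - t₃) (by linarith)
    rw [hF.add, hF.add, sub_add_cancel] at h2
    exact ht.not_gt h2
  rcases le_or_gt |t| (max n |t₃|) with h2 | h2
  · have h3 := hKlip t h2 y₀ y'
    have h4 := mem_ball'.1 hy'b
    rw [lt_div_iff₀' hK] at h4
    linarith
  · have h3 := (le_max_right _ _).trans_lt h2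
    have h4 := (le_max_left _ _).trans_lt h2
    have h5 : t < 0 := by
      by_contra! h6
      rw [abs_of_nonneg h6] at h3
      linarith [le_abs_self t₃]
    rw [abs_of_neg h5] at h4
    have h6 := hWA hy₀ (-t) h4.le
    have h7 := hWA hy'W (-t) h4.le
    rw [neg_neg] at h6 h7
    have h8 := dist_triangle_right (φ t y₀) (φ t y') P
    linarith

end OneFlow

/-- A loop that traverses the homoclinic orbit of `x` and passes through `P`. -/
structure IsHomLoop (φ : ℝ → Disc → Disc) (P x : Disc) (c : ℝ → ℂ) : Prop where
  loop : IsLoop c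
  sub : ∀ s, c s = P ∨ ∃ t, c s = φ t x
  mem : (P : ℂ) ∈ range c
  arc : ∀ t, (φ t x : ℂ) ∈ range c

lemma IsHomLoop.rev {φ : ℝ → Disc → Disc} {P x : Disc} {c : ℝ → ℂ} (h : IsHomLoop φ P x c) :
    IsHomLoop (fun t => φ (-t)) P x c where
  loop := h.loop
  sub s := (h.sub s).imp id fun ⟨t, ht⟩ => ⟨-t, by rwa [neg_neg]⟩
  mem := h.mem
  arc t := h.arc (-t)

lemma tendsto_logit_zero : Tendsto (fun s : ℝ => Real.log s - Real.log (1 - s)) (𝓝[>] 0) atBot := by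
  have h1 : Tendsto (fun s : ℝ => -Real.log (1 - s)) (𝓝[>] 0) (𝓝 (-Real.log (1 - 0))) := by
    refine Tendsto.mono_left ?_ nhdsWithin_le_nhds
    have : ContinuousAt (fun s : ℝ => -Real.log (1 - s)) 0 := by
      refine ((continuous_const.sub continuous_id).continuousAt.log ?_).neg
      norm_num
    exact this
  simpa only [sub_eq_add_neg] using Real.tendsto_log_nhdsGT_zero.atBot_add h1

lemma tendsto_logit_one : Tendsto (fun s : ℝ => Real.log s - Real.log (1 - s)) (𝓝[<] 1) atTop := by
  have h1 : Tendsto (fun s : ℝ => 1 - s) (𝓝[<] 1) (𝓝[>] 0) := by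
    refine tendsto_nhdsWithin_iff.2 ⟨?_, eventually_nhdsWithin_of_forall
      fun s (hs : s < 1) => show (0 : ℝ) < 1 - s from sub_pos.2 hs⟩
    have : ContinuousAt (fun s : ℝ => 1 - s) 1 := by fun_prop
    simpa using this.tendsto.mono_left (nhdsWithin_le_nhds (s := Iio 1))
  refine (tendsto_neg_atBot_atTop.comp (tendsto_logit_zero.comp h1)).congr fun s => ?_
  simp only [Function.comp_apply, sub_sub_cancel, neg_sub]

lemma exists_logit_eq (t : ℝ) : ∃ s ∈ Ioo (0 : ℝ) 1, Real.log s - Real.log (1 - s) = t := by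
  have h := Real.exp_pos t
  have h1 : 1 - Real.exp t / (1 + Real.exp t) = 1 / (1 + Real.exp t) := by
    field_simp
    ring
  refine ⟨Real.exp t / (1 + Real.exp t), ⟨by positivity, ?_⟩, ?_⟩
  · rw [div_lt_one (by positivity)]
    linarith
  · rw [h1, Real.log_div h.ne' (by positivity), Real.log_div one_ne_zero (by positivity),
      Real.log_exp, Real.log_one]
    ring

namespace OneFlow

variable {φ : ℝ → Disc → Disc} {V : ℂ → ℂ} {P : Disc} (hO : OneFlow φ V P)
include hO

lemma eventually_ht_pos {x : Disc} (hx : x ≠ P) :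
    ∀ᶠ t in 𝓝[>] (0 : ℝ), 0 < (((φ t x : ℂ) - x) / V x).re := by
  have h1 : Tendsto (fun t : ℝ => t⁻¹ • ((φ (0 + t) x : ℂ) - φ 0 x)) (𝓝[>] 0) (𝓝 (V (φ 0 x))) :=
    (hO.F.deriv x 0).tendsto_slope_zero_right
  rw [hO.F.zero] at h1
  have hV := hO.ne hx
  have h2 : Tendsto (fun t : ℝ => (t⁻¹ • ((φ (0 + t) x : ℂ) - x) / V x).re) (𝓝[>] 0)
      (𝓝 (V x / V x).re) := (Complex.continuous_re.tendsto _).comp (h1.div_const _)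
  rw [div_self hV, Complex.one_re] at h2
  filter_upwards [h2.eventually (lt_mem_nhds one_pos), self_mem_nhdsWithin] with t ht ht0
  rw [zero_add, smul_div_assoc, Complex.real_smul, Complex.re_ofReal_mul] at ht
  exact (pos_iff_pos_of_mul_pos ht).1 (inv_pos.2 ht0)

lemma exists_homLoop {x : Disc} (hx : x ≠ P) (h1 : Tendsto (fun t => φ t x) atTop (𝓝 P))
    (h2 : Tendsto (fun t => φ (-t) x) atTop (𝓝 P)) :
    ∃ c, IsHomLoop φ P x c ∧ ∃ q, q ∉ range c ∧ wind c q ≠ 0 := by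
  have hF := hO.F
  have hnp := hO.nonPer_of_tendsto hx h2
  set β : ℝ → ℝ := fun s => Real.log s - Real.log (1 - s) with hβ
  set f : ℝ → ℂ := fun s => φ (β s) x with hf
  have hβc : ContinuousOn β (Ioo 0 1) := by
    refine (Real.continuousOn_log.mono fun s hs => hs.1.ne').sub
      (Real.continuousOn_log.comp (by fun_prop) fun s hs => ?_)
    exact (sub_pos.2 hs.2).ne'
  have hfc : ContinuousOn f (Ioo 0 1) := (hF.contC x).comp_continuousOn hβc
  have hP : Tendsto (fun t => (φ t x : ℂ)) atTop (𝓝 P) :=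
    (continuous_subtype_val.tendsto P).comp h1
  have hP' : Tendsto (fun t => (φ t x : ℂ)) atBot (𝓝 P) := by
    have := ((continuous_subtype_val.tendsto P).comp h2).comp tendsto_neg_atBot_atTop
    refine this.congr fun t => ?_
    simp only [Function.comp_apply, neg_neg]
  have hf0 : Tendsto f (𝓝[>] 0) (𝓝 P) := hP'.comp tendsto_logit_zero
  have hf1 : Tendsto f (𝓝[<] 1) (𝓝 P) := hP.comp tendsto_logit_one
  set g := extendFrom (Ioo 0 1) f with hg
  have hgc : ContinuousOn g (Icc 0 1) := continuousOn_Icc_extendFrom_Ioo hfc hf0 hf1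
  have hg0 : g 0 = P := eq_lim_at_left_extendFrom_Ioo one_pos hf0
  have hg1 : g 1 = P := eq_lim_at_right_extendFrom_Ioo one_pos hf1
  have hgf : ∀ s ∈ Ioo (0 : ℝ) 1, g s = φ (β s) x := extendFrom_extends hfc
  have hL := isLoop_fract hgc (hg0.trans hg1.symm)
  set c := fun s => g (Int.fract s) with hc
  have hcg : ∀ s ∈ Ioo (0 : ℝ) 1, c s = φ (β s) x := fun s hs => by
    rw [← hgf s hs, hc]
    beta_reduce
    rw [Int.fract_eq_self.2 ⟨hs.1.le, hs.2⟩]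
  have hsub : ∀ s, c s = P ∨ (Int.fract s ∈ Ioo (0 : ℝ) 1 ∧ c s = φ (β (Int.fract s)) x) :=
    fun s => by
    rcases (Int.fract_nonneg s).eq_or_lt with h | h
    · left
      rw [hc]
      beta_reduce
      rw [← h, hg0]
    · exact Or.inr ⟨⟨h, Int.fract_lt_one s⟩, hgf _ ⟨h, Int.fract_lt_one s⟩⟩
  have hH : IsHomLoop φ P x c := by
    refine ⟨hL, fun s => (hsub s).imp id fun h => ⟨_, h.2⟩, ⟨0, ?_⟩, fun t => ?_⟩
    · rw [hc]
      beta_reduce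
      rw [Int.fract_zero, hg0]
    · obtain ⟨s, hs, rfl⟩ := exists_logit_eq t
      exact ⟨s, hcg s hs⟩
  refine ⟨c, hH, ?_⟩
  have hhalf : (1 / 2 : ℝ) ∈ Ioo (0 : ℝ) 1 := by constructor <;> norm_num
  have hβ0 : β (1 / 2) = 0 := by
    rw [hβ]
    norm_num
  have hchalf : c (1 / 2) = x := by rw [hcg _ hhalf, hβ0, hF.zero]
  have hβat : Tendsto β (𝓝 (1 / 2)) (𝓝 0) := by
    rw [← hβ0]
    exact hβc.continuousAt (isOpen_Ioo.mem_nhds hhalf)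
  have hmono : StrictMonoOn β (Ioo 0 1) := fun s hs t ht hst => by
    have h3 := Real.log_lt_log hs.1 hst
    have h4 := Real.log_lt_log (sub_pos.2 ht.2) (sub_lt_sub_left hst 1)
    rw [hβ]
    beta_reduce
    linarith
  have hpos : ∀ᶠ s in 𝓝[>] (1 / 2 : ℝ), 0 < ((c s - c (1 / 2)) / V x).re := by
    have h3 : Tendsto β (𝓝[>] (1 / 2)) (𝓝[>] 0) := by
      refine tendsto_nhdsWithin_iff.2 ⟨hβat.mono_left nhdsWithin_le_nhds, ?_⟩
      filter_upwards [Ioo_mem_nhdsGT hhalf.2] with s hs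
      rw [mem_Ioi, ← hβ0]
      exact hmono hhalf ⟨hhalf.1.trans hs.1, hs.2⟩ hs.1
    filter_upwards [h3.eventually (hO.eventually_ht_pos hx), Ioo_mem_nhdsGT hhalf.2] with s hs hs1
    rwa [hchalf, hcg s ⟨hhalf.1.trans hs1.1, hs1.2⟩]
  have hneg : ∀ᶠ s in 𝓝[<] (1 / 2 : ℝ), ((c s - c (1 / 2)) / V x).re < 0 := by
    have h3 : Tendsto (fun s => -β s) (𝓝[<] (1 / 2)) (𝓝[>] 0) := by
      refine tendsto_nhdsWithin_iff.2 ⟨?_, ?_⟩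
      · rw [← neg_zero]
        exact (hβat.mono_left nhdsWithin_le_nhds).neg
      filter_upwards [Ioo_mem_nhdsLT hhalf.1] with s hs
      rw [mem_Ioi, neg_pos, ← hβ0]
      exact hmono ⟨hs.1, hs.2.trans hhalf.2⟩ hhalf hs.2
    filter_upwards [h3.eventually (hO.rev.eventually_ht_pos hx), Ioo_mem_nhdsLT hhalf.1] with s
      hs hs1
    rw [hchalf, hcg s ⟨hs1.1, hs1.2.trans hhalf.2⟩]
    rwa [neg_neg, div_neg, Complex.neg_re, neg_pos] at hs
  have hne : ∀ s ∈ Ioo (1 / 2 : ℝ) (1 / 2 + 1), c s ≠ c (1 / 2) := fun s hs h => by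
    rw [hchalf] at h
    rcases hsub s with h3 | ⟨h3, h4⟩
    · exact hx (Subtype.ext (h.symm.trans h3))
    · have h5 : φ (β (Int.fract s)) x = φ 0 x := by
        rw [hF.zero]
        exact Subtype.ext (h4.symm.trans h)
      have h6 : β (Int.fract s) = β (1 / 2) := (hnp h5).trans hβ0.symm
      have h7 := hmono.injOn h3 hhalf h6
      have h8 := Int.fract_add_floor s
      rw [h7] at h8
      have h9 : (0 : ℝ) < ⌊s⌋ := by linarith [hs.1]
      have h10 : (⌊s⌋ : ℝ) < 1 := by linarith [hs.2]
      norm_cast at h9 h10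
      omega
  obtain ⟨ε, h3, h4, h5⟩ := (hL.eventually_wind_ne hne (hO.ne hx) hpos hneg).exists
  by_cases h6 : wind c (c (1 / 2) + ε * (Complex.I * V x)) = 0
  · exact ⟨_, h4, fun h7 => h5 (h6.trans h7.symm)⟩
  · exact ⟨_, h3, h6⟩

lemma orbit_notMem_homLoop {x y : Disc} {c : ℝ → ℂ} (hc : IsHomLoop φ P x c)
    (hy : (y : ℂ) ∉ range c)
    (t : ℝ) : (φ t y : ℂ) ∉ range c := by
  rintro ⟨s, hs⟩
  rcases hc.sub s with h | ⟨a, h⟩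
  · have h1 : φ t y = P := Subtype.ext (hs.symm.trans h)
    have h2 : y ≠ P := fun e => hy (e ▸ hc.mem)
    exact hO.orbit_ne h2 t h1
  · have h1 : φ t y = φ a x := Subtype.ext (hs.symm.trans h)
    have h2 : y = φ (-t + a) x := by rw [← hO.F.add, ← h1, hO.F.neg_cancel]
    exact hy (h2 ▸ hc.arc _)

/-- A nonperiodic orbit inside a homoclinic loop accumulates only on the singular point. -/
lemma eq_of_om_of_homLoop {x y z : Disc} {c : ℝ → ℂ} (hc : IsHomLoop φ P x c) (hx : Om φ x P)
    (hx' : Om (fun t => φ (-t)) x P) (hy : (y : ℂ) ∉ range c) (hw : wind c y ≠ 0)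
    (hnp : NonPer φ y) (hz : Om φ y z) : z = P := by
  by_contra hne
  have hF := hO.F
  have hd : 0 < dist z P := dist_pos.2 hne
  obtain ⟨b, t₀, t₁, km, kp, h⟩ := hF.exists_cycle_near hnp hz (hO.ne hne) (half_pos hd)
  have hP := hO.notMem_cycle (hO.ne_of_nonPer hnp) (half_lt_self hd) h
  have hxy : ∀ t, x ≠ φ t y := fun t e => by
    refine hO.orbit_notMem_homLoop hc hy t ?_
    rw [← e]
    simpa only [hF.zero] using hc.arc 0
  have hcross : ∀ a, (φ a x : ℂ) ∉ range b := fun a ha => by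
    obtain ⟨t, ht, -, hw⟩ := hx.exists_wind h.loop hP (a + 1)
    obtain ⟨s, hs, -, hw'⟩ := hx'.exists_wind h.loop hP (-a + 1)
    rw [(h.cross_fwd x hxy a ha t (by linarith)).2] at hw
    rw [(h.cross_bwd x hxy a ha (-s) (by linarith)).2] at hw'
    exact h.ne (hw'.trans hw.symm)
  have hdisj : ∀ s, c s ∉ range b := fun s hs => by
    rcases hc.sub s with e | ⟨t, e⟩
    · exact hP (e ▸ hs)
    · exact hcross t (e ▸ hs)
  have hdisj' : Disjoint (range c) (range b) := by
    rw [Set.disjoint_left]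
    rintro _ ⟨s, rfl⟩
    exact hdisj s
  refine hc.loop.not_mutually_inside h.loop hdisj' (fun t => ?_) fun t => ?_
  · rw [hc.loop.wind_eq_of_preconnected h.loop.isPreconnected_range
      (fun q hq hq' => Set.disjoint_left.1 hdisj' hq' hq) (mem_range_self t)
      (h.arc t₀ ⟨le_rfl, h.lt.le⟩),
      DiscFlow.wind_orbit hc.loop (hF.contC y) (hO.orbit_notMem_homLoop hc hy) t₀ 0, hF.zero]
    exact hw
  · rw [h.loop.wind_eq_of_preconnected hc.loop.isPreconnected_range
      (by rintro _ ⟨s, rfl⟩; exact hdisj s) (mem_range_self t) hc.mem]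
    exact h.wp hP

theorem not_homoclinic {x : Disc} (hx : x ≠ P) (h1 : Tendsto (fun t => φ t x) atTop (𝓝 P))
    (h2 : Tendsto (fun t => φ (-t) x) atTop (𝓝 P)) : False := by
  have hF := hO.F
  obtain ⟨c, hc, q, hq, hwq⟩ := hO.exists_homLoop hx h1 h2
  have hL := hc.loop
  have hcD : ∀ s, ‖c s‖ ≤ 1 := fun s => by
    rcases hc.sub s with h | ⟨t, h⟩
    · rw [h]
      exact mem_closedBall_zero_iff.1 P.2
    · rw [h]
      exact mem_closedBall_zero_iff.1 (φ t x).2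
  have hqD : q ∈ Disc := by
    rw [mem_closedBall_zero_iff]
    by_contra! hlt
    exact hwq (hL.wind_eq_zero hq fun t => (hcD t).trans hlt.le)
  have hU : IsOpen {y : Disc | (y : ℂ) ∉ range c ∧ wind c y ≠ 0} := by
    rw [isOpen_iff_mem_nhds]
    rintro y ⟨hy, hw⟩
    filter_upwards [(continuous_subtype_val.tendsto y).eventually (hL.eventually_wind_eq hy)]
      with y' hy'
    exact ⟨hy'.1, by rw [hy'.2]; exact hw⟩
  obtain ⟨y, ⟨hy, hw⟩, hn⟩ := hO.exists_not_homoclinic hU ⟨⟨q, hqD⟩, hq, hwq⟩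
  have hyP : y ≠ P := fun e => hy (e ▸ hc.mem)
  have hoy := hO.orbit_notMem_homLoop hc hy
  rcases hF.nonPer_or y with hnp | ⟨T, hT, hTy⟩
  · refine hn ⟨tendsto_of_om fun z hz => ?_, tendsto_of_om fun z hz => ?_⟩
    · exact hO.eq_of_om_of_homLoop hc (om_of_tendsto h1) (om_of_tendsto h2) hy hw hnp hz
    · exact hO.rev.eq_of_om_of_homLoop hc.rev (om_of_tendsto h2)
        (by simpa only [neg_neg] using om_of_tendsto h1) hy hw hnp.rev hz
  · obtain ⟨T, hT⟩ := hF.exists_minPer (hO.ne hyP) hT hTy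
    have hb := hF.perCurve_loop hT
    have hdisj : ∀ s, perCurve φ y T s ∉ range c := fun s => hoy (s * T)
    have hdisj' : Disjoint (range c) (range (perCurve φ y T)) := by
      rw [Set.disjoint_right]
      rintro _ ⟨s, rfl⟩
      exact hdisj s
    have hP : (P : ℂ) ∉ range (perCurve φ y T) := Set.disjoint_left.1 hdisj' hc.mem
    refine hL.not_mutually_inside hb hdisj' (fun t => ?_) fun t => ?_
    · have := DiscFlow.wind_orbit hL (hF.contC y) hoy (t * T) 0
      rw [hF.zero] at this
      rw [perCurve, this]
      exact hw
    · rw [hb.wind_eq_of_preconnected hL.isPreconnected_range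
        (fun q hq => Set.disjoint_left.1 hdisj' hq) (mem_range_self t) hc.mem]
      exact hF.perCurve_wind hT (hO.ne hyP) hP

/-- The unstable set of the singular point contains other points. -/
theorem exists_tendsto_neg : ∃ v, v ≠ P ∧ Tendsto (fun t => φ (-t) v) atTop (𝓝 P) := by
  by_contra! hcon
  have hF := hO.F
  obtain ⟨r, hr, hiso⟩ := hO.exists_isolated
  have hesc : ∀ e : Disc, r ≤ dist e P → ∃ t > 0, r < dist (φ (-t) e) P := fun e he => by
    by_contra! h
    have heP : e ≠ P := dist_pos.1 (hr.trans_le he)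
    exact hcon e heP (hO.rev.tendsto_of_eventually_near (r := r)
      (fun y hy => hiso y fun t => by simpa only [neg_neg] using hy (-t))
          (eventually_gt_atTop 0 |>.mono h))
  have hcpt : IsCompact {e : Disc | r ≤ dist e P} := by
    have : CompactSpace Disc := isCompact_iff_compactSpace.1 (isCompact_closedBall _ _)
    exact (isClosed_le continuous_const (continuous_id.dist continuous_const)).isCompact
  obtain ⟨n, hn⟩ := hcpt.elim_directed_cover
    (fun n : ℕ => {e : Disc | ∃ t : ℝ, 0 < t ∧ t < n ∧ r < dist (φ (-t) e) P})
    (fun n => by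
      have : {e : Disc | ∃ t : ℝ, 0 < t ∧ t < n ∧ r < dist (φ (-t) e) P} =
          ⋃ t : ℝ, ⋃ _ : 0 < t ∧ t < n, {e | r < dist (φ (-t) e) P} := by
        ext e
        simp [and_assoc]
      rw [this]
      exact isOpen_iUnion fun t => isOpen_iUnion fun _ =>
        isOpen_lt continuous_const ((hF.cont_x (-t)).dist continuous_const))
    (fun e he => by
      obtain ⟨t, ht, h⟩ := hesc e he
      obtain ⟨n, hn⟩ := exists_nat_gt t
      exact mem_iUnion.2 ⟨n, t, ht, hn, h⟩)
    (directed_of_isDirected_le fun i j hij e ⟨t, h0, h1, h2⟩ =>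
      ⟨t, h0, h1.trans_le (by exact_mod_cast hij), h2⟩)
  obtain ⟨K, hK, hlip⟩ := hF.lip n
  have hstay : ∀ y ∈ ball P (r / K), ∀ t, 0 ≤ t → dist (φ t y) P < r := by
    intro y hy t ht
    by_contra! hcon
    have hfc : Continuous fun s => dist (φ s y) P := (hF.cont_t y).dist continuous_const
    obtain ⟨τ, ⟨⟨h0, -⟩, hτ⟩, hmin⟩ := (isCompact_Icc.inter_right
      (isClosed_le continuous_const hfc) : IsCompact
          (Icc 0 t ∩ {s | r ≤ dist (φ s y) P})).exists_isLeast
      ⟨t, ⟨ht, le_rfl⟩, hcon⟩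
    have hnτ : (n : ℝ) < τ := by
      by_contra! h
      have h1 := hlip τ (by rwa [abs_of_nonneg h0]) y P
      rw [hO.fix] at h1
      have h2 := mem_ball.1 hy
      rw [lt_div_iff₀' hK] at h2
      exact (h1.trans_lt h2).not_ge hτ
    obtain ⟨u, hu0, hun, hu⟩ := hn hτ
    rw [hF.add] at hu
    have := hmin (a := -u + τ) ⟨⟨by linarith, ?_⟩, hu.le⟩
    · linarith
    · have : τ ≤ t := hmin ⟨⟨ht, le_rfl⟩, hcon⟩
      linarith
  obtain ⟨y, hy, hny⟩ := hO.rev.exists_not_tendsto_neg isOpen_ball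
    ⟨P, mem_ball_self (by positivity : 0 < r / K)⟩
  refine hny ?_
  simp only [neg_neg]
  exact hO.tendsto_of_eventually_near hiso ((eventually_ge_atTop 0).mono fun t ht =>
    (hstay y hy t ht).le)

theorem false_of_oneFlow : False := by
  have hF := hO.F
  obtain ⟨v, hvP, hv⟩ := hO.exists_tendsto_neg
  obtain ⟨u, huP, hu⟩ := hO.rev.exists_tendsto_neg
  simp only [neg_neg] at hu
  have hvn := hO.nonPer_of_tendsto hvP hv
  have hun : NonPer (fun t => φ (-t)) u :=
    hO.rev.nonPer_of_tendsto huP (by simpa only [neg_neg] using hu)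
  have hvh : ¬ Tendsto (fun t => φ t v) atTop (𝓝 P) := fun h => hO.not_homoclinic hvP h hv
  have huh : ¬ Tendsto (fun t => φ (-t) u) atTop (𝓝 P) := fun h => hO.not_homoclinic huP hu h
  have hvo : ¬ Om φ v P := hO.not_om_of_not_tendsto hvP hv hvh
  have huo : ¬ Om (fun t => φ (-t)) u P :=
    hO.rev.not_om_of_not_tendsto huP (by simpa only [neg_neg] using hu) huh
  have hvα : Om (fun t => φ (-t)) v P := om_of_tendsto hv
  have huω : Om φ u P := om_of_tendsto hu
  have huv : ∀ t, u ≠ φ t v := fun t e => hvo (by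
    have := hF.om_orbit huω (-t)
    rwa [e, hF.neg_cancel] at this)
  have hvu : ∀ t, v ≠ φ t u := fun t e => huv (-t) (by rw [e, hF.neg_cancel])
  -- a cycle along the orbit of `v`
  obtain ⟨z, hz⟩ := exists_om φ v
  have hzP : z ≠ P := fun e => hvo (e ▸ hz)
  have hdz := dist_pos.2 hzP
  obtain ⟨c, t₀, t₁, km, kp, h⟩ := hF.exists_cycle_near hvn hz (hO.ne hzP) (half_pos hdz)
  have hP := hO.notMem_cycle hvP (half_lt_self hdz) h
  have hkm : wind c P = km := by
    obtain ⟨s, hs, -, hw⟩ := hvα.exists_wind h.loop hP (-t₀ + 1)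
    rw [← hw]
    exact (h.bwd (-s) (by linarith)).2
  have hu_miss : ∀ t, (φ t u : ℂ) ∉ range c := fun a ha => by
    obtain ⟨t, ht, -, hw⟩ := huω.exists_wind h.loop hP (a + 1)
    rw [(h.cross_fwd u huv a ha t (by linarith)).2] at hw
    exact h.ne (hkm.symm.trans hw.symm)
  have hu_wind : ∀ t, wind c (φ t u) = km := fun t => by
    obtain ⟨s, -, -, hw⟩ := huω.exists_wind h.loop hP 0
    rw [DiscFlow.wind_orbit h.loop (hF.contC u) hu_miss t s]
    exact hw.trans hkm
  obtain ⟨z', hz'⟩ := exists_om (fun t => φ (-t)) u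
  have hzP' : z' ≠ P := fun e => huo (e ▸ hz')
  have hz'v : ∀ t, z' ≠ φ t v := fun t e => huo (by
    refine hO.rev.F.om_trans hz' ?_
    have := hO.rev.F.om_orbit hvα (-t)
    rwa [neg_neg, ← e] at this)
  have hz'c : (z' : ℂ) ∉ range c := fun hin => by
    rw [← hF.zero z'] at hin
    obtain ⟨h1, h2⟩ := h.cross_fwd z' hz'v 0 hin 1 one_pos
    have h3 := hO.rev.F.om_flow hz' (-1)
    rw [neg_neg] at h3
    obtain ⟨s, -, -, hw⟩ := h3.exists_wind h.loop h1 0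
    rw [hu_wind, h2] at hw
    exact h.ne hw
  -- a cycle along the orbit of `u`
  obtain ⟨ρ, hρ, hball⟩ := Metric.isOpen_iff.1 h.loop.isOpen_compl z' hz'c
  have hdz' := dist_pos.2 hzP'
  obtain ⟨b, s₀, s₁, jm, jp, hb⟩ := hO.rev.F.exists_cycle_near hun hz' (hO.rev.ne hzP')
    (lt_min (half_pos hρ) (half_pos hdz'))
  have hPb := hO.rev.notMem_cycle huP ((min_le_right _ _).trans_lt (half_lt_self hdz')) hb
  have hbc : ∀ s, b s ∉ range c := fun s => by
    rcases hb.sub s with ⟨t, e⟩ | hd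
    · rw [e]
      exact hu_miss (-t)
    · exact hball (mem_ball.2 (hd.trans_lt ((min_le_left _ _).trans_lt (half_lt_self hρ))))
  have hdisj : Disjoint (range c) (range b) := by
    rw [Set.disjoint_right]
    rintro _ ⟨s, rfl⟩
    exact hbc s
  have hjm : wind b P = jm := by
    obtain ⟨s, hs, -, hw⟩ := huω.exists_wind hb.loop hPb (-s₀ + 1)
    rw [← hw]
    simpa only [neg_neg] using (hb.bwd (-s) (by linarith)).2
  have hv_miss : ∀ t, (φ t v : ℂ) ∉ range b := fun a ha => by
    obtain ⟨t, ht, -, hw⟩ := hvα.exists_wind hb.loop hPb (-a + 1)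
    rw [(hb.cross_fwd v (fun t => hvu (-t)) (-a) (by simpa only [neg_neg] using ha) t
      (by linarith)).2] at hw
    exact hb.ne (hjm.symm.trans hw.symm)
  have hv_wind : ∀ t, wind b (φ t v) = wind b P := fun t => by
    obtain ⟨s, -, -, hw⟩ := hvα.exists_wind hb.loop hPb 0
    rw [DiscFlow.wind_orbit hb.loop (hF.contC v) hv_miss t (-s)]
    exact hw
  refine h.loop.not_mutually_inside hb.loop hdisj (fun t => ?_) fun t => ?_
  · rw [h.loop.wind_eq_of_preconnected hb.loop.isPreconnected_range
      (fun q hq => Set.disjoint_right.1 hdisj hq) (mem_range_self t)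
      (hb.arc s₀ ⟨le_rfl, hb.lt.le⟩), hu_wind, ← hkm]
    exact h.wp hP
  · rw [hb.loop.wind_eq_of_preconnected h.loop.isPreconnected_range
      (fun q hq => Set.disjoint_left.1 hdisj hq) (mem_range_self t)
      (h.arc t₀ ⟨le_rfl, h.lt.le⟩), hv_wind]
    exact hb.wp hPb

end OneFlow

section
variable {φ : ℝ → Disc → Disc} {Φ : ℝ × ℂ → ℂ}

lemma hasDerivAt_flow (hφ : IsFlow φ) (hC1 : ContDiffOn ℝ 1 Φ (univ ×ˢ Disc))
    (heq : ∀ t x, (φ t x : ℂ) = Φ (t, x)) (x : Disc) (t : ℝ) :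
    HasDerivAt (fun s => (φ s x : ℂ))
      (fderivWithin ℝ Φ (univ ×ˢ Disc) (0, (φ t x : ℂ)) (1, 0)) t := by
  have h1 := (hC1.differentiableOn one_ne_zero (0, (φ t x : ℂ))
    ⟨mem_univ _, (φ t x).2⟩).hasFDerivWithinAt
  have h2 : HasDerivAt (fun s : ℝ => (s - t, (φ t x : ℂ))) (1, 0) t :=
    ((hasDerivAt_id' t).sub_const t).prodMk (hasDerivAt_const t _)
  have h3 := HasFDerivWithinAt.comp_hasDerivWithinAt_of_eq (s := univ) t h1 h2.hasDerivWithinAt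
    (fun s _ => ⟨mem_univ _, (φ t x).2⟩) (by simp)
  rw [hasDerivWithinAt_univ] at h3
  refine h3.congr_of_eventuallyEq (Eventually.of_forall fun s => ?_)
  rw [Function.comp_apply, ← heq, hφ.2.2, sub_add_cancel]

lemma uniqueDiffOn_univ_prod_disc : UniqueDiffOn ℝ ((univ : Set ℝ) ×ˢ Disc) := by
  refine uniqueDiffOn_univ.prod (uniqueDiffOn_convex (convex_closedBall _ _) ?_)
  rw [interior_closedBall _ one_ne_zero]
  exact ⟨0, by simp⟩

lemma flow_lipschitz (hC1 : ContDiffOn ℝ 1 Φ (univ ×ˢ Disc))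
    (heq : ∀ t x, (φ t x : ℂ) = Φ (t, x)) (T : ℝ) :
    ∃ K, 0 < K ∧ ∀ t, |t| ≤ T → ∀ x y, dist (φ t x) (φ t y) ≤ K * dist x y := by
  have hc := hC1.continuousOn_fderivWithin uniqueDiffOn_univ_prod_disc le_rfl
  obtain ⟨M, hM⟩ := (isCompact_Icc (a := -T) (b := T)).prod (isCompact_closedBall (0 : ℂ) 1)
    |>.exists_bound_of_continuousOn (hc.mono (prod_mono (subset_univ _) subset_rfl))
  refine ⟨max M 1, by positivity, fun t ht x y => ?_⟩
  have h := (convex_Icc (-T) T).prod (convex_closedBall (0 : ℂ) 1)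
    |>.norm_image_sub_le_of_norm_hasFDerivWithin_le (f := Φ)
      (fun z hz => ((hC1.differentiableOn one_ne_zero z ⟨mem_univ _, hz.2⟩).hasFDerivWithinAt).mono
        (prod_mono (subset_univ _) subset_rfl)) hM
      (x := (t, (y : ℂ))) (y := (t, (x : ℂ))) ⟨abs_le.1 ht, y.2⟩ ⟨abs_le.1 ht, x.2⟩
  rw [← heq, ← heq, Prod.mk_sub_mk, sub_self, Prod.norm_mk, norm_zero,
    max_eq_right (norm_nonneg _), ← dist_eq_norm, ← dist_eq_norm] at h
  exact h.trans (mul_le_mul_of_nonneg_right (le_max_left _ _) dist_nonneg)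

theorem exists_two_singular_points (hφ : IsFlow φ) (hC1 : ContDiffOn ℝ 1 Φ (univ ×ˢ Disc))
    (heq : ∀ t x, (φ t x : ℂ) = Φ (t, x)) (hke : KinematicExpansive φ) :
    ∃ p q, p ≠ q ∧ (∀ t, φ t p = p) ∧ ∀ t, φ t q = q := by
  by_contra! hcon
  set V : ℂ → ℂ := fun x => fderivWithin ℝ Φ (univ ×ˢ Disc) (0, x) (1, 0)
  have hsing : ∀ x : Disc, V x = 0 → ∀ t, φ t x = x := fun x hx t => by
    have h := hasDerivAt_flow hφ hC1 heq x 0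
    rw [hφ.2.1] at h
    exact hφ.apply_eq_self_of_velocity_eq_zero (flow_lipschitz hC1 heq) (hx ▸ h) t
  obtain ⟨p, hp⟩ : ∃ p : ℂ, ∀ x : Disc, V x = 0 → (x : ℂ) = p := by
    by_cases h : ∃ P : Disc, V P = 0
    · obtain ⟨P, hP⟩ := h
      refine ⟨P, fun x hx => by_contra fun hne => ?_⟩
      obtain ⟨t, ht⟩ := hcon x P (fun h => hne (congrArg _ h)) (hsing x hx)
      exact ht (hsing P hP t)
    · exact ⟨0, fun x hx => absurd ⟨x, hx⟩ h⟩
  have hF : DiscFlow φ V p :=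
    { flow := hφ
      contV := by
        have hc := hC1.continuousOn_fderivWithin uniqueDiffOn_univ_prod_disc le_rfl
        have h0 : ContinuousOn (fun x : ℂ => ((0 : ℝ), x)) Disc := by fun_prop
        exact (hc.comp h0 fun x hx => ⟨mem_univ _, hx⟩).clm_apply continuousOn_const
      deriv := hasDerivAt_flow hφ hC1 heq
      lip := flow_lipschitz hC1 heq
      ke := hke
      V_ne := fun x hx hne h => hne (hp ⟨x, hx⟩ h) }
  obtain ⟨P, rfl, hP⟩ := hF.exists_singular
  exact OneFlow.false_of_oneFlow ⟨hF, hP⟩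

end

/-- A continuously differentiable kinematic expansive flow on the closed unit
disc has at least two singular points. -/
theorem stmt14
    (φ : ℝ → (Metric.closedBall (0 : EuclideanSpace ℝ (Fin 2)) 1) →
      (Metric.closedBall (0 : EuclideanSpace ℝ (Fin 2)) 1))
    (hφ : IsFlow φ)
    (hC1 : ∃ Φ : ℝ × EuclideanSpace ℝ (Fin 2) → EuclideanSpace ℝ (Fin 2),
      ContDiffOn ℝ 1 Φ
        (Set.univ ×ˢ Metric.closedBall (0 : EuclideanSpace ℝ (Fin 2)) 1) ∧
      ∀ (t : ℝ) (x : Metric.closedBall (0 : EuclideanSpace ℝ (Fin 2)) 1),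
        (φ t x : EuclideanSpace ℝ (Fin 2)) = Φ (t, (x : EuclideanSpace ℝ (Fin 2))))
    (hke : KinematicExpansive φ) :
    ∃ p q : Metric.closedBall (0 : EuclideanSpace ℝ (Fin 2)) 1, p ≠ q ∧
      (∀ t : ℝ, φ t p = p) ∧ (∀ t : ℝ, φ t q = q) := by
  obtain ⟨Φ, hΦ, heq⟩ := hC1
  let L : ℂ ≃ₗᵢ[ℝ] EuclideanSpace ℝ (Fin 2) := Complex.orthonormalBasisOneI.repr
  have hmem : ∀ x, L x ∈ closedBall (0 : EuclideanSpace ℝ (Fin 2)) 1 ↔ x ∈ Disc := fun x => by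
    rw [mem_closedBall_zero_iff, mem_closedBall_zero_iff, L.norm_map]
  let e : Disc ≃ᵢ closedBall (0 : EuclideanSpace ℝ (Fin 2)) 1 :=
    { toFun := fun x => ⟨L x, (hmem x).2 x.2⟩
      invFun := fun y => ⟨L.symm y, (hmem _).1 (by rw [L.apply_symm_apply]; exact y.2)⟩
      left_inv := fun x => Subtype.ext (L.symm_apply_apply _)
      right_inv := fun y => Subtype.ext (L.apply_symm_apply _)
      isometry_toFun := Isometry.of_dist_eq fun x y => L.dist_map x y }
  have hψ : IsFlow fun t x => e.symm (φ t (e x)) := by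
    refine ⟨e.symm.continuous.comp (hφ.1.comp (continuous_fst.prodMk
      (e.continuous.comp continuous_snd))), fun x => ?_, fun s t x => ?_⟩
    · beta_reduce
      rw [hφ.2.1, e.symm_apply_apply]
    · beta_reduce
      rw [e.apply_symm_apply, hφ.2.2]
  have hψC : ContDiffOn ℝ 1 (fun z : ℝ × ℂ => L.symm (Φ (z.1, L z.2))) (univ ×ˢ Disc) := by
    refine L.symm.contDiff.comp_contDiffOn (hΦ.comp ?_ fun z hz => ⟨mem_univ _, (hmem _).2 hz.2⟩)
    exact (contDiff_fst.prodMk (L.contDiff.comp contDiff_snd)).contDiffOn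
  have hψe : KinematicExpansive fun t x => e.symm (φ t (e x)) := by
    intro ε hε
    obtain ⟨δ, hδ, h⟩ := hke ε hε
    refine ⟨δ, hδ, fun x y hxy => ?_⟩
    obtain ⟨s, hs, hy⟩ := h (e x) (e y) fun t => by simpa only [e.symm.dist_eq] using hxy t
    exact ⟨s, hs, (e.symm_apply_eq.2 hy.symm).symm⟩
  obtain ⟨p, q, hpq, hp, hq⟩ := exists_two_singular_points hψ hψC
    (fun t x => congrArg L.symm (heq t (e x))) hψe
  exact ⟨e p, e q, e.injective.ne hpq, fun t => e.symm_apply_eq.1 (hp t),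
    fun t => e.symm_apply_eq.1 (hq t)⟩
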